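/- The mixed torsional rigidity τ₁ is continuous with respect to the Hausdorff metric in both arguments: if Ω, Ω' and Ω_i, Ω'_i (i ∈ ℕ) are open bounded convex subsets of ℝ^n such that cl(Ω_i) → cl(Ω) and cl(Ω'_i) → cl(Ω') in the Hausdorff metric, then τ₁(Ω_i, Ω'_i) → τ₁(Ω, Ω') as i → ∞. -/

import Mathlib

open MeasureTheory Metric Set Filter Bornology
open scoped Topology Pointwise RealInnerProductSpace ENNReal NNReal BigOperators Classical

noncomputable section

/-- Euclidean `n`-space. -/
abbrev Euc (n : ℕ) : Type := EuclideanSpace ℝ (Fin n)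

variable {n : ℕ}

/-- The Laplacian of `u`, as the sum of the pure second derivatives in the coordinate
directions. -/
def lapl (u : Euc n → ℝ) (x : Euc n) : ℝ :=
  ∑ i : Fin n, iteratedFDeriv ℝ 2 u x (fun _ => EuclideanSpace.single i (1 : ℝ))

/-- `u` is the torsion function of `Ω`: the solution of `Δu = -2` in `Ω`, `u = 0` on `∂Ω`,
continuous up to the boundary and smooth inside. -/
structure IsTorsionFunction (Ω : Set (Euc n)) (u : Euc n → ℝ) : Prop where
  continuousOn : ContinuousOn u (closure Ω)
  smooth : ContDiffOn ℝ (⊤ : ℕ∞) u Ω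
  lapl_eq : ∀ x ∈ Ω, lapl u x = -2
  boundary_zero : ∀ x ∈ frontier Ω, u x = 0

/-- The torsional rigidity `τ(Ω) = ∫_Ω ‖∇u‖²` where `u` is the torsion function of `Ω`. -/
def torsionRigidity (Ω : Set (Euc n)) : ℝ :=
  if h : ∃ u, IsTorsionFunction Ω u then ∫ x in Ω, ‖gradient h.choose x‖ ^ 2 else 0

/-- The nontangential cone `Γ_α(x̄) = {x ∈ Ω : |x - x̄| ≤ (1+α) dist(x, ∂Ω)}`. -/
def ntCone (Ω : Set (Euc n)) (x : Euc n) (α : ℝ) : Set (Euc n) :=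
  {y ∈ Ω | dist y x ≤ (1 + α) * infDist y (frontier Ω)}

/-- `w` has nontangential limit `L` at the boundary point `x`. -/
def HasNTLimitAt {F : Type*} [TopologicalSpace F] (Ω : Set (Euc n)) (w : Euc n → F)
    (x : Euc n) (L : F) : Prop :=
  ∀ α > 0, Tendsto w (𝓝[ntCone Ω x α] x) (𝓝 L)

/-- The nontangential boundary values of `∇u` (junk value `0` where they do not exist). -/
def ntGradient (Ω : Set (Euc n)) (u : Euc n → ℝ) (x : Euc n) : Euc n :=
  if h : ∃ L, HasNTLimitAt Ω (gradient u) x L then h.choose else 0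

/-- `X` is an outer unit normal to `K` at `x`. -/
def IsOuterNormalAt (K : Set (Euc n)) (x X : Euc n) : Prop :=
  ‖X‖ = 1 ∧ ∀ y ∈ K, ⟪y, X⟫ ≤ ⟪x, X⟫

/-- The Gauss map of `K`: the outer unit normal at the points of `∂K` where it is unique
(i.e. where `∂K` is differentiable), junk value `0` elsewhere. -/
def gaussMap (K : Set (Euc n)) (x : Euc n) : Euc n :=
  if h : ∃! X, IsOuterNormalAt K x X then h.choose else 0

/-- The support function of a set: `h_K(X) = sup_{y ∈ K} ⟨y, X⟩`. -/
def suppFn (K : Set (Euc n)) (X : Euc n) : ℝ :=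
  sSup ((fun y => ⟪y, X⟫) '' K)

/-- The measure `μ_{τ,Ω}(η) = ∫_{ν⁻¹(η)} |∇u|² dH^{n-1}` (as a set function on Borel sets
`η ⊆ S^{n-1}`), where `ν` is the Gauss map and `∇u` is taken in the sense of nontangential
limits. -/
def torsionMeasure (Ω : Set (Euc n)) (u : Euc n → ℝ) (η : Set (Euc n)) : ℝ≥0∞ :=
  ∫⁻ x in frontier Ω ∩ gaussMap (closure Ω) ⁻¹' η,
    ENNReal.ofReal (‖ntGradient Ω u x‖ ^ 2) ∂μH[(n : ℝ) - 1]

/-- The mixed torsional rigidity `τ₁(Ω, Ω') = ∫_{∂Ω} h_{Ω'}(ν(x)) ‖∇u(x)‖² dH^{n-1}(x)`. -/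
def mixedTorsion (Ω Ω' : Set (Euc n)) : ℝ :=
  if h : ∃ u, IsTorsionFunction Ω u then
    ∫ x in frontier Ω,
      suppFn (closure Ω') (gaussMap (closure Ω) x) * ‖ntGradient Ω h.choose x‖ ^ 2
        ∂μH[(n : ℝ) - 1]
  else 0

/-- The Alexandrov body `B[g] = {x : ⟨x, X⟩ ≤ g(X) for all X ∈ S^{n-1}}` of a positive
continuous function `g` on the sphere. -/
def alexandrovBody (g : Euc n → ℝ) : Set (Euc n) :=
  {x | ∀ X ∈ sphere (0 : Euc n) 1, ⟪x, X⟫ ≤ g X}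

open scoped ContDiff

/-! ### Calculus for the Laplacian -/

lemma two_le_infty : (2 : WithTop ℕ∞) ≤ ((⊤ : ℕ∞) : WithTop ℕ∞) := by
  exact WithTop.coe_le_coe.2 (le_top : (2 : ℕ∞) ≤ ⊤)

/-- The `i`-th coordinate vector. -/
abbrev stdVec (i : Fin n) : Euc n := EuclideanSpace.single i (1 : ℝ)

lemma lapl_eq_laplacian (f : Euc n → ℝ) : lapl f = Laplacian.laplacian f := by
  rw [InnerProductSpace.laplacian_eq_iteratedFDeriv_orthonormalBasis f
    (EuclideanSpace.basisFun (Fin n) ℝ)]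
  funext x
  refine Finset.sum_congr rfl fun i _ => ?_
  congr 1
  funext j
  fin_cases j <;> simp

lemma lapl_congr_nhds {f g : Euc n → ℝ} {x : Euc n} (h : f =ᶠ[𝓝 x] g) :
    lapl f x = lapl g x := by
  rw [lapl_eq_laplacian, lapl_eq_laplacian]
  exact (InnerProductSpace.laplacian_congr_nhds h).eq_of_nhds

lemma lapl_add {f g : Euc n → ℝ} {x : Euc n} (hf : ContDiffAt ℝ 2 f x) (hg : ContDiffAt ℝ 2 g x) :
    lapl (fun y => f y + g y) x = lapl f x + lapl g x := by
  simp only [lapl_eq_laplacian]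
  exact hf.laplacian_add hg

lemma lapl_sub {f g : Euc n → ℝ} {x : Euc n} (hf : ContDiffAt ℝ 2 f x) (hg : ContDiffAt ℝ 2 g x) :
    lapl (fun y => f y - g y) x = lapl f x - lapl g x := by
  simp only [lapl_eq_laplacian]
  exact hf.laplacian_sub hg

lemma lapl_const_mul {f : Euc n → ℝ} {x : Euc n} (c : ℝ) (hf : ContDiffAt ℝ 2 f x) :
    lapl (fun y => c * f y) x = c * lapl f x := by
  simp only [lapl_eq_laplacian]
  exact InnerProductSpace.laplacian_smul c hf

lemma lapl_eq_sum_fderiv (f : Euc n → ℝ) (x : Euc n) :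
    lapl f x = ∑ i, fderiv ℝ (fderiv ℝ f) x (stdVec i) (stdVec i) := by
  simp [lapl, iteratedFDeriv_two_apply]

lemma fderiv_differentiableAt {f : Euc n → ℝ} {x : Euc n} (hf : ContDiffAt ℝ 2 f x) :
    DifferentiableAt ℝ (fderiv ℝ f) x :=
  (hf.fderiv_right (m := 1) (by norm_num)).differentiableAt (by norm_num)

lemma fderiv_fderiv_apply {f : Euc n → ℝ} {x : Euc n} (hf : ContDiffAt ℝ 2 f x) (v w : Euc n) :
    fderiv ℝ (fun y => fderiv ℝ f y v) x w = fderiv ℝ (fderiv ℝ f) x w v := by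
  rw [fderiv_clm_apply (fderiv_differentiableAt hf) (differentiableAt_const v)]
  simp

lemma lapl_eq_sum {f : Euc n → ℝ} {x : Euc n} (hf : ContDiffAt ℝ 2 f x) :
    lapl f x = ∑ i, fderiv ℝ (fun y => fderiv ℝ f y (stdVec i)) x (stdVec i) := by
  rw [lapl_eq_sum_fderiv]
  exact Finset.sum_congr rfl fun i _ => (fderiv_fderiv_apply hf _ _).symm

lemma lapl_contDiff {f : Euc n → ℝ} (hf : ContDiff ℝ ∞ f) : ContDiff ℝ ∞ (lapl f) := by
  have : lapl f = fun x => ∑ i, fderiv ℝ (fun y => fderiv ℝ f y (stdVec i)) x (stdVec i) := by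
    funext x
    exact lapl_eq_sum (hf.contDiffAt.of_le two_le_infty)
  rw [this]
  refine ContDiff.sum fun i _ => ?_
  have h1 : ContDiff ℝ ∞ (fun y => fderiv ℝ f y (stdVec i)) :=
    (hf.fderiv_right (m := ∞) (by exact_mod_cast le_top)).clm_apply contDiff_const
  exact (h1.fderiv_right (m := ∞) (by exact_mod_cast le_top)).clm_apply contDiff_const

lemma lapl_eq_zero_of_notMem_tsupport {f : Euc n → ℝ} {x : Euc n} (hx : x ∉ tsupport f) :
    lapl f x = 0 := by
  have : f =ᶠ[𝓝 x] fun _ => (0 : ℝ) := notMem_tsupport_iff_eventuallyEq.1 hx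
  rw [lapl_congr_nhds this, lapl_eq_laplacian, InnerProductSpace.laplacian_const]
  rfl

lemma tsupport_lapl_subset (f : Euc n → ℝ) : tsupport (lapl f) ⊆ tsupport f := by
  refine closure_minimal (fun x hx => ?_) (isClosed_tsupport f)
  by_contra h
  exact hx (lapl_eq_zero_of_notMem_tsupport h)

lemma HasCompactSupport.lapl {f : Euc n → ℝ} (hf : HasCompactSupport f) :
    HasCompactSupport (lapl f) :=
  hf.mono' ((subset_tsupport _).trans (tsupport_lapl_subset f))

lemma lapl_comp_affine {f : Euc n → ℝ} (a : Euc n) (s : ℝ) (x : Euc n)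
    (hf : ContDiffAt ℝ 2 f (a + s • x)) :
    lapl (fun y => f (a + s • y)) x = s ^ 2 * lapl f (a + s • x) := by
  have hA : ContDiff ℝ ∞ (fun y : Euc n => a + s • y) := by fun_prop
  have hd : ∀ᶠ y in 𝓝 (a + s • x), DifferentiableAt ℝ f y :=
    (hf.eventually (by norm_num)).mono fun y hy => hy.differentiableAt (by norm_num)
  have hd' : ∀ᶠ y in 𝓝 x, DifferentiableAt ℝ f (a + s • y) :=
    (hA.continuous.tendsto x).eventually hd
  have hAd : ∀ y : Euc n, HasFDerivAt (fun y : Euc n => a + s • y)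
      (s • ContinuousLinearMap.id ℝ (Euc n)) y := fun y =>
    ((hasFDerivAt_id y).const_smul s).const_add a
  have hfx : ContDiffAt ℝ 2 (fun y => f (a + s • y)) x :=
    ContDiffAt.comp (g := f) x hf (hA.contDiffAt.of_le two_le_infty)
  rw [lapl_eq_sum hfx, lapl_eq_sum_fderiv, Finset.mul_sum]
  refine Finset.sum_congr rfl fun i _ => ?_
  have h1 : (fun y => fderiv ℝ (fun z => f (a + s • z)) y (stdVec i)) =ᶠ[𝓝 x]
      fun y => s * fderiv ℝ f (a + s • y) (stdVec i) := by
    filter_upwards [hd'] with y hy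
    have := (hy.hasFDerivAt.comp y (hAd y)).fderiv
    simp only [Function.comp_def] at this
    rw [this]
    simp
  rw [h1.fderiv_eq]
  have h2 : HasFDerivAt (fun y => fderiv ℝ f (a + s • y))
      ((fderiv ℝ (fderiv ℝ f) (a + s • x)).comp (s • ContinuousLinearMap.id ℝ (Euc n))) x :=
    HasFDerivAt.comp (g := fderiv ℝ f) x (fderiv_differentiableAt hf).hasFDerivAt (hAd x)
  have h3 := ((h2.clm_apply (hasFDerivAt_const (stdVec i) x)).const_mul s).fderiv
  rw [h3]
  simp
  ring

lemma lapl_comp_norm_sq {γ : ℝ → ℝ} (x : Euc n) (hγ : ContDiff ℝ ∞ γ) :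
    lapl (fun y => γ (‖y‖ ^ 2)) x
      = 4 * ‖x‖ ^ 2 * deriv (deriv γ) (‖x‖ ^ 2) + 2 * n * deriv γ (‖x‖ ^ 2) := by
  have hN : ∀ y : Euc n, HasFDerivAt (fun y : Euc n => ‖y‖ ^ 2) (2 • innerSL ℝ y) y :=
    fun y => (hasStrictFDerivAt_norm_sq y).hasFDerivAt
  have hγ' : ContDiff ℝ ∞ (deriv γ) := (contDiff_infty_iff_deriv.1 hγ).2
  have hs : ContDiff ℝ ∞ (fun y : Euc n => γ (‖y‖ ^ 2)) := hγ.comp (contDiff_norm_sq ℝ)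
  rw [lapl_eq_sum (hs.contDiffAt.of_le two_le_infty)]
  have h1 : ∀ i : Fin n, (fun y : Euc n => fderiv ℝ (fun z : Euc n => γ (‖z‖ ^ 2)) y (stdVec i))
      = fun y => deriv γ (‖y‖ ^ 2) * (2 * y i) := by
    intro i
    funext y
    have := ((hγ.differentiable (by simp)) (‖y‖ ^ 2)).hasDerivAt.comp_hasFDerivAt y (hN y)
    rw [HasFDerivAt.fderiv (f := fun z : Euc n => γ (‖z‖ ^ 2)) this]
    simp [EuclideanSpace.inner_single_right]
  have h2 : ∀ i : Fin n, fderiv ℝ (fun y : Euc n => deriv γ (‖y‖ ^ 2) * (2 * y i)) x (stdVec i)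
      = deriv γ (‖x‖ ^ 2) * 2 + 4 * (x i) ^ 2 * deriv (deriv γ) (‖x‖ ^ 2) := by
    intro i
    have ha := ((hγ'.differentiable (by simp)) (‖x‖ ^ 2)).hasDerivAt.comp_hasFDerivAt x (hN x)
    have hb : HasFDerivAt (fun y : Euc n => 2 * y i)
        ((2 : ℝ) • (EuclideanSpace.proj i : Euc n →L[ℝ] ℝ)) x :=
      ((EuclideanSpace.proj i : Euc n →L[ℝ] ℝ).hasFDerivAt).const_mul 2
    have := ha.mul hb
    rw [HasFDerivAt.fderiv (f := fun y : Euc n => deriv γ (‖y‖ ^ 2) * (2 * y i)) this]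
    simp [EuclideanSpace.inner_single_right]
    ring
  simp only [h1, h2]
  rw [Finset.sum_add_distrib, Finset.sum_const, ← Finset.sum_mul, ← Finset.mul_sum]
  rw [EuclideanSpace.real_norm_sq_eq]
  simp
  ring

lemma lapl_norm_sq (x : Euc n) : lapl (fun y : Euc n => ‖y‖ ^ 2) x = 2 * n := by
  have := lapl_comp_norm_sq (γ := fun s => s) x contDiff_id
  simpa using this

lemma lapl_inner (v x : Euc n) (c : ℝ) : lapl (fun y : Euc n => ⟪y, v⟫ + c) x = 0 := by
  have h1 : ∀ y : Euc n, HasFDerivAt (fun y : Euc n => ⟪y, v⟫ + c) (innerSL ℝ v) y := by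
    intro y
    have := ((innerSL ℝ v).hasFDerivAt (x := y)).add_const c
    refine this.congr_of_eventuallyEq (Eventually.of_forall fun z => ?_)
    simp [real_inner_comm]
  have h2 : fderiv ℝ (fun y : Euc n => ⟪y, v⟫ + c) = fun _ => innerSL ℝ v := by
    funext y; exact (h1 y).fderiv
  rw [lapl_eq_sum_fderiv, h2]
  simp

/-- Green's second identity with a compactly supported test function. -/
lemma integral_mul_lapl_eq {f φ : Euc n → ℝ} {U : Set (Euc n)} (hU : IsOpen U)
    (hf : ContDiffOn ℝ 2 f U) (hφ : ContDiff ℝ ∞ φ) (hc : HasCompactSupport φ)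
    (hs : tsupport φ ⊆ U) : ∫ x, f x * lapl φ x = ∫ x, lapl f x * φ x := by
  have hfa : ∀ x ∈ U, ContDiffAt ℝ 2 f x := fun x hx => hf.contDiffAt (hU.mem_nhds hx)
  have hφ2 : ∀ x, ContDiffAt ℝ 2 φ x := fun x => hφ.contDiffAt.of_le two_le_infty
  have key : ∀ a b : Euc n → ℝ, (∀ x ∈ U, ContinuousAt a x) → Continuous b →
      tsupport b ⊆ tsupport φ → Integrable (fun x => a x * b x) := by
    intro a b ha hb hbs
    have hts : tsupport (fun x => a x * b x) ⊆ tsupport b :=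
      closure_mono (fun x hx => right_ne_zero_of_mul hx)
    refine Continuous.integrable_of_hasCompactSupport
      (continuous_of_tsupport fun x hx => (ha x (hs (hbs (hts hx)))).mul hb.continuousAt) ?_
    exact hc.mono' ((subset_tsupport _).trans (hts.trans hbs))
  have hpf : ∀ (v : Euc n), ∀ x ∈ U, ContinuousAt (fun y => fderiv ℝ f y v) x := fun v x hx =>
    ((fderiv_differentiableAt (hfa x hx)).continuousAt).clm_apply continuousAt_const
  have hpφ : ∀ (v : Euc n), ContDiff ℝ ∞ (fun y => fderiv ℝ φ y v) := fun v =>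
    (hφ.fderiv_right (m := ∞) (by exact_mod_cast le_top)).clm_apply contDiff_const
  have hppφ : ∀ (v : Euc n), ContDiff ℝ ∞ (fun y => fderiv ℝ (fun z => fderiv ℝ φ z v) y v) :=
    fun v => ((hpφ v).fderiv_right (m := ∞) (by exact_mod_cast le_top)).clm_apply contDiff_const
  have hts : ∀ (ψ : Euc n → ℝ) (v : Euc n), tsupport (fun y => fderiv ℝ ψ y v) ⊆ tsupport ψ :=
    fun ψ v => tsupport_fderiv_apply_subset ℝ v
  have hppf : ∀ (v : Euc n), ∀ x ∈ U,
      ContinuousAt (fun y => fderiv ℝ (fun z => fderiv ℝ f z v) y v) x := by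
    intro v x hx
    have h1 : ContDiffAt ℝ 1 (fun z => fderiv ℝ f z v) x :=
      ((hfa x hx).fderiv_right (m := 1) (by norm_num)).clm_apply contDiffAt_const
    exact ((h1.fderiv_right (m := 0) (by norm_num)).clm_apply contDiffAt_const).continuousAt
  have step : ∀ v : Euc n, ∫ x, f x * fderiv ℝ (fun z => fderiv ℝ φ z v) x v
      = ∫ x, fderiv ℝ (fun z => fderiv ℝ f z v) x v * φ x := by
    intro v
    have hfd : ∀ x ∈ U, DifferentiableAt ℝ f x := fun x hx =>
      (hfa x hx).differentiableAt (by norm_num)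
    have e1 := integral_mul_fderiv_eq_neg_fderiv_mul_of_integrable (μ := (volume : Measure (Euc n)))
      (f := f) (g := fun z => fderiv ℝ φ z v) (v := v)
      (key _ _ (hpf v) (hpφ v).continuous (hts φ v))
      (key _ _ (fun x hx => (hfd x hx).continuousAt) (hppφ v).continuous
        ((hts _ v).trans (hts φ v)))
      (key _ _ (fun x hx => (hfd x hx).continuousAt) (hpφ v).continuous (hts φ v))
      (fun x hx => hfd x (hs (hts φ v hx)))
      (fun x _ => (hpφ v).differentiable (by simp) x)
    have e2 := integral_mul_fderiv_eq_neg_fderiv_mul_of_integrable (μ := (volume : Measure (Euc n)))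
      (f := fun z => fderiv ℝ f z v) (g := φ) (v := v)
      (key _ _ (hppf v) hφ.continuous subset_rfl)
      (key _ _ (hpf v) (hpφ v).continuous (hts φ v))
      (key _ _ (hpf v) hφ.continuous subset_rfl)
      (fun x hx => (fderiv_differentiableAt (hfa x (hs hx))).clm_apply (differentiableAt_const v))
      (fun x _ => hφ.differentiable (by simp) x)
    rw [e1, e2, neg_neg]
  have hL : ∀ x, f x * lapl φ x
      = ∑ i, f x * fderiv ℝ (fun z => fderiv ℝ φ z (stdVec i)) x (stdVec i) := fun x => by
    rw [lapl_eq_sum (hφ2 x), Finset.mul_sum]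
  have hR : ∀ x, lapl f x * φ x
      = ∑ i, fderiv ℝ (fun z => fderiv ℝ f z (stdVec i)) x (stdVec i) * φ x := fun x => by
    by_cases hx : x ∈ U
    · rw [lapl_eq_sum (hfa x hx), Finset.sum_mul]
    · rw [image_eq_zero_of_notMem_tsupport (fun h => hx (hs h))]; simp
  simp only [hL, hR]
  rw [integral_finsetSum, integral_finsetSum]
  · exact Finset.sum_congr rfl fun i _ => step _
  · exact fun i _ => key _ _ (hppf _) hφ.continuous subset_rfl
  · intro i _
    exact key _ _ (fun x hx => ((hfa x hx).continuousAt)) (hppφ _).continuous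
        ((hts _ _).trans (hts φ _))

/-- At an interior maximum the Laplacian is nonpositive. -/
lemma lapl_nonpos_of_isLocalMax {f : Euc n → ℝ} {x : Euc n} (hf : ContDiffAt ℝ 2 f x)
    (hm : IsLocalMax f x) : lapl f x ≤ 0 := by
  rw [lapl_eq_sum_fderiv]
  refine Finset.sum_nonpos fun i _ => ?_
  by_contra! hpos
  set v := stdVec i
  let γ : ℝ → Euc n := fun t => x + t • v
  have hγ : ∀ t, HasDerivAt γ v t := fun t => by
    simpa only [one_smul] using ((hasDerivAt_id' t).smul_const v).const_add x
  have hγ0 : γ 0 = x := by simp [γ]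
  have hγc : Tendsto γ (𝓝 0) (𝓝 x) := by
    have := (hγ 0).continuousAt.tendsto; rwa [hγ0] at this
  have hd : ∀ᶠ t in 𝓝 (0 : ℝ), HasDerivAt (fun t => f (γ t)) (fderiv ℝ f (γ t) v) t := by
    filter_upwards [hγc.eventually (hf.eventually (by norm_num))] with t ht
    exact (ht.differentiableAt (by norm_num)).hasFDerivAt.comp_hasDerivAt t (hγ t)
  have hdd : HasDerivAt (fun t => fderiv ℝ f (γ t) v) (fderiv ℝ (fderiv ℝ f) x v v) 0 := by
    have h1 : HasFDerivAt (fderiv ℝ f) (fderiv ℝ (fderiv ℝ f) x) (γ 0) := by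
      rw [hγ0]; exact (fderiv_differentiableAt hf).hasFDerivAt
    have h2 := h1.comp_hasDerivAt (0 : ℝ) (hγ 0)
    simpa using h2.clm_apply (hasDerivAt_const (0 : ℝ) v)
  have hderiv : deriv (fun t => f (γ t)) =ᶠ[𝓝 0] fun t => fderiv ℝ f (γ t) v :=
    hd.mono fun t ht => ht.deriv
  have hmax : IsLocalMax (fun t => f (γ t)) 0 := by
    have : ∀ᶠ t in 𝓝 (0 : ℝ), f (γ t) ≤ f x := hγc.eventually hm
    simpa [IsLocalMax, IsMaxFilter, hγ0] using this
  have hmin : IsLocalMin (fun t => f (γ t)) 0 :=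
    isLocalMin_of_deriv_deriv_pos (by rw [hderiv.deriv_eq, hdd.deriv]; exact hpos)
      hmax.deriv_eq_zero (hd.self_of_nhds.continuousAt)
  have hconst : (fun t => f (γ t)) =ᶠ[𝓝 0] fun _ => f (γ 0) := by
    filter_upwards [hmax, hmin] with t h1 h2 using le_antisymm h1 h2
  have h0 : (fun t => fderiv ℝ f (γ t) v) =ᶠ[𝓝 0] fun _ => 0 := by
    refine hderiv.symm.trans ?_
    refine hconst.eventuallyEq_nhds.mono fun t ht => ?_
    rw [ht.deriv_eq]; simp
  have := hdd.deriv
  rw [h0.deriv_eq] at this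
  simp at this
  exact hpos.ne this

/-- Weak maximum principle for subharmonic functions on bounded open sets. -/
lemma le_zero_of_lapl_nonneg [NeZero n] {Ω : Set (Euc n)} (hΩ : IsOpen Ω) (hb : IsBounded Ω)
    {h : Euc n → ℝ} (hc : ContinuousOn h (closure Ω)) (hd : ContDiffOn ℝ 2 h Ω)
    (hL : ∀ x ∈ Ω, 0 ≤ lapl h x) (hbd : ∀ x ∈ frontier Ω, h x ≤ 0) :
    ∀ x ∈ closure Ω, h x ≤ 0 := by
  obtain ⟨R, hR0, hR⟩ := hb.closure.exists_pos_norm_le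
  have key : ∀ δ > 0, ∀ x ∈ closure Ω, h x + δ * ‖x‖ ^ 2 ≤ δ * R ^ 2 := by
    intro δ hδ x hx
    obtain ⟨z, hz, hzm⟩ := (isCompact_of_isClosed_isBounded isClosed_closure
      hb.closure).exists_isMaxOn ⟨x, hx⟩
      (hc.add (Continuous.continuousOn (by fun_prop : Continuous fun y : Euc n => δ * ‖y‖ ^ 2)))
    refine (hzm hx).trans ?_
    have hzR : δ * ‖z‖ ^ 2 ≤ δ * R ^ 2 := by
      have := hR z hz
      gcongr
    by_cases hzΩ : z ∈ Ω
    · exfalso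
      have hloc : IsLocalMax (fun y => h y + δ * ‖y‖ ^ 2) z := by
        filter_upwards [hΩ.mem_nhds hzΩ] with y hy using hzm (subset_closure hy)
      have h1 : ContDiffAt ℝ 2 h z := hd.contDiffAt (hΩ.mem_nhds hzΩ)
      have h2 : ContDiffAt ℝ 2 (fun y : Euc n => ‖y‖ ^ 2) z := (contDiff_norm_sq ℝ).contDiffAt
      have h3 : ContDiffAt ℝ 2 (fun y : Euc n => δ * ‖y‖ ^ 2) z := contDiffAt_const.mul h2
      have := lapl_nonpos_of_isLocalMax (h1.add h3) hloc
      rw [lapl_add h1 h3, lapl_const_mul δ h2, lapl_norm_sq] at this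
      have hn : (0 : ℝ) < n := by exact_mod_cast Nat.pos_of_ne_zero (NeZero.ne n)
      have := hL z hzΩ
      have : 0 < δ * (2 * n) := by positivity
      linarith
    · have := hbd z ⟨hz, by rwa [hΩ.interior_eq]⟩
      change h z + δ * ‖z‖ ^ 2 ≤ _
      linarith
  intro x hx
  by_contra! hpos
  have := key (h x / (2 * R ^ 2)) (by positivity) x hx
  have h2 : h x / (2 * R ^ 2) * R ^ 2 = h x / 2 := by field_simp
  have h3 : 0 ≤ h x / (2 * R ^ 2) * ‖x‖ ^ 2 := by positivity
  linarith

/-! ### A radial averaging kernel -/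

/-- A smooth step: `0` up to `1/4` and `1` from `1` on. -/
def stepFn (s : ℝ) : ℝ := Real.smoothTransition ((4 * s - 1) / 3)

lemma stepFn_contDiff : ContDiff ℝ ∞ stepFn :=
  Real.smoothTransition.contDiff.comp (by fun_prop)

lemma stepFn_of_le {s : ℝ} (hs : s ≤ 1 / 4) : stepFn s = 0 :=
  Real.smoothTransition.zero_of_nonpos (by linarith)

lemma stepFn_of_ge {s : ℝ} (hs : 1 ≤ s) : stepFn s = 1 :=
  Real.smoothTransition.one_of_one_le (by linarith)

lemma stepFn_mono : Monotone stepFn := fun a b h =>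
  Real.smoothTransition.monotone (by linarith)

/-- The truncated power `s ^ (-n/2)`. -/
def truncPow (n : ℕ) (s : ℝ) : ℝ := s ^ (-(n : ℝ) / 2) * stepFn s

lemma truncPow_of_lt {s : ℝ} (hs : s ≤ 1 / 4) : truncPow n s = 0 := by
  simp [truncPow, stepFn_of_le hs]

lemma truncPow_contDiff : ContDiff ℝ ∞ (truncPow n) := by
  rw [contDiff_iff_contDiffAt]
  intro s
  rcases lt_or_ge s (1 / 4) with hs | hs
  · refine (contDiffAt_const (c := (0 : ℝ))).congr_of_eventuallyEq ?_
    filter_upwards [Iio_mem_nhds hs] with t ht using truncPow_of_lt (le_of_lt ht)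
  · exact (Real.contDiffAt_rpow_const_of_ne (by linarith)).mul stepFn_contDiff.contDiffAt

lemma truncPow_scale {r s : ℝ} (hr : 0 < r) (hs : r ^ 2 ≤ s) :
    (r ^ n)⁻¹ * truncPow n (s / r ^ 2) = s ^ (-(n : ℝ) / 2) := by
  have hs0 : 0 < s := lt_of_lt_of_le (by positivity) hs
  have h1 : 1 ≤ s / r ^ 2 := by rw [le_div_iff₀ (by positivity)]; linarith
  rw [truncPow, stepFn_of_ge h1, mul_one, Real.div_rpow hs0.le (by positivity)]
  have : (r ^ 2) ^ (-(n : ℝ) / 2) = (r ^ n)⁻¹ := by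
    rw [← Real.rpow_natCast r 2, ← Real.rpow_mul hr.le, ← Real.rpow_natCast r n,
      ← Real.rpow_neg hr.le]
    congr 1
    push_cast
    ring
  rw [this]
  field_simp

/-- The profile of the averaging kernel. -/
def kerProfile (n : ℕ) (s : ℝ) : ℝ := 4 * s * deriv (truncPow n) s + 2 * n * truncPow n s

lemma kerProfile_contDiff : ContDiff ℝ ∞ (kerProfile n) := by
  have := (contDiff_infty_iff_deriv.1 (truncPow_contDiff (n := n))).2
  have h2 := truncPow_contDiff (n := n)
  unfold kerProfile
  fun_prop

lemma kerProfile_eq {s : ℝ} (hs : 0 < s) :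
    kerProfile n s = 4 * s * s ^ (-(n : ℝ) / 2) * deriv stepFn s := by
  have h1 : HasDerivAt (truncPow n) ((-(n : ℝ) / 2) * s ^ (-(n : ℝ) / 2 - 1) * stepFn s
      + s ^ (-(n : ℝ) / 2) * deriv stepFn s) s :=
    (Real.hasDerivAt_rpow_const (Or.inl hs.ne')).mul
      (stepFn_contDiff.differentiable (by simp) s).hasDerivAt
  rw [kerProfile, h1.deriv, truncPow, Real.rpow_sub_one hs.ne']
  field_simp
  ring

lemma deriv_stepFn_nonneg (s : ℝ) : 0 ≤ deriv stepFn s := stepFn_mono.deriv_nonneg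

lemma deriv_stepFn_of_ge {s : ℝ} (hs : 1 ≤ s) : deriv stepFn s = 0 := by
  have hc : IsClosed {s | deriv stepFn s = 0} :=
    isClosed_eq (contDiff_infty_iff_deriv.1 stepFn_contDiff).2.continuous continuous_const
  have hI : Ioi (1 : ℝ) ⊆ {s | deriv stepFn s = 0} := by
    intro t ht
    have : stepFn =ᶠ[𝓝 t] fun _ => 1 := by
      filter_upwards [Ioi_mem_nhds ht] with y hy using stepFn_of_ge (le_of_lt hy)
    simp [this.deriv_eq]
  have := hc.closure_subset_iff.2 hI
  rw [closure_Ioi] at this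
  exact this hs

lemma kerProfile_nonneg {s : ℝ} (hs : 0 ≤ s) : 0 ≤ kerProfile n s := by
  rcases hs.eq_or_lt with rfl | hs
  · simp [kerProfile, truncPow_of_lt (n := n) (show (0 : ℝ) ≤ 1 / 4 by norm_num)]
  · rw [kerProfile_eq hs]
    have := deriv_stepFn_nonneg s
    positivity

lemma kerProfile_of_ge {s : ℝ} (hs : 1 ≤ s) : kerProfile n s = 0 := by
  rw [kerProfile_eq (by linarith), deriv_stepFn_of_ge hs, mul_zero]

lemma exists_kerProfile_pos : ∃ s, 0 < s ∧ 0 < kerProfile n s := by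
  obtain ⟨s, hs, h⟩ := exists_deriv_eq_slope stepFn (show (1 / 4 : ℝ) < 1 by norm_num)
    stepFn_contDiff.continuous.continuousOn
    (stepFn_contDiff.differentiable (by simp)).differentiableOn
  have hs0 : 0 < s := by have := hs.1; linarith
  refine ⟨s, hs0, ?_⟩
  rw [kerProfile_eq hs0, h, stepFn_of_ge le_rfl, stepFn_of_le le_rfl]
  positivity

/-- The unnormalised kernel. -/
def kerPre (x : Euc n) : ℝ := kerProfile n (‖x‖ ^ 2)

lemma kerPre_contDiff : ContDiff ℝ ∞ (kerPre (n := n)) :=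
  kerProfile_contDiff.comp (contDiff_norm_sq ℝ)

lemma kerPre_nonneg (x : Euc n) : 0 ≤ kerPre x := kerProfile_nonneg (by positivity)

lemma kerPre_of_ge {x : Euc n} (hx : 1 ≤ ‖x‖) : kerPre x = 0 :=
  kerProfile_of_ge (one_le_pow₀ hx)

lemma kerPre_hasCompactSupport : HasCompactSupport (kerPre (n := n)) :=
  HasCompactSupport.intro (isCompact_closedBall (0 : Euc n) 1) fun x hx => by
    refine kerPre_of_ge (le_of_lt ?_)
    simpa using hx

lemma integral_kerPre_pos [NeZero n] : 0 < ∫ x : Euc n, kerPre x := by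
  obtain ⟨s, hs, hpos⟩ := exists_kerProfile_pos (n := n)
  refine kerPre_contDiff.continuous.integral_pos_of_hasCompactSupport_nonneg_nonzero
    kerPre_hasCompactSupport kerPre_nonneg (x := √s • stdVec 0) ?_
  simp only [kerPre, norm_smul, PiLp.norm_single]
  simp [abs_of_nonneg, Real.sq_sqrt hs.le]
  exact hpos.ne'

/-- The normalised averaging kernel at scale `r`. -/
def avKer (r : ℝ) (x : Euc n) : ℝ := (r ^ n)⁻¹ * (kerPre (r⁻¹ • x) / ∫ y : Euc n, kerPre y)

lemma avKer_contDiff (r : ℝ) : ContDiff ℝ ∞ (avKer (n := n) r) := by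
  have := (kerPre_contDiff (n := n)).comp (f := fun x : Euc n => r⁻¹ • x) (by fun_prop)
  exact contDiff_const.mul (this.div_const _)

lemma avKer_nonneg [NeZero n] {r : ℝ} (hr : 0 < r) (x : Euc n) : 0 ≤ avKer r x :=
  mul_nonneg (inv_nonneg.2 (pow_nonneg hr.le n))
    (div_nonneg (kerPre_nonneg _) integral_kerPre_pos.le)

lemma avKer_of_ge {r : ℝ} (hr : 0 < r) {x : Euc n} (hx : r ≤ ‖x‖) : avKer r x = 0 := by
  rw [avKer, kerPre_of_ge]
  · simp
  · rw [norm_smul, norm_inv, Real.norm_of_nonneg hr.le, ← div_eq_inv_mul, le_div_iff₀ hr]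
    linarith

lemma avKer_hasCompactSupport {r : ℝ} (hr : 0 < r) : HasCompactSupport (avKer (n := n) r) :=
  HasCompactSupport.intro (isCompact_closedBall (0 : Euc n) r) fun x hx => by
    refine avKer_of_ge hr (le_of_lt ?_)
    simpa using hx

lemma avKer_neg (r : ℝ) (x : Euc n) : avKer r (-x) = avKer r x := by
  simp [avKer, kerPre]

lemma avKer_integral [NeZero n] {r : ℝ} (hr : 0 < r) : ∫ x : Euc n, avKer r x = 1 := by
  have := integral_kerPre_pos (n := n)
  unfold avKer
  rw [integral_const_mul, integral_div]
  rw [Measure.integral_comp_inv_smul_of_nonneg volume (fun y => kerPre y) hr.le]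
  simp
  field_simp

lemma avKer_scale [NeZero n] {r : ℝ} (x : Euc n) :
    avKer r x = (r ^ n)⁻¹ * avKer 1 (r⁻¹ • x) := by
  simp [avKer]

/-- The difference of two kernels is the Laplacian of a compactly supported function. -/
lemma exists_lapl_eq_avKer_sub [NeZero n] {δ R : ℝ} (hδ : 0 < δ) (hR : δ ≤ R) :
    ∃ Ψ : Euc n → ℝ, ContDiff ℝ ∞ Ψ ∧ (∀ x, R ≤ ‖x‖ → Ψ x = 0) ∧
      ∀ x, lapl Ψ x = avKer R x - avKer δ x := by
  have hR0 : 0 < R := hδ.trans_le hR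
  let N := ∫ y : Euc n, kerPre y
  let ρ : ℝ → ℝ → ℝ := fun r s => (r ^ n)⁻¹ * truncPow n (s / r ^ 2)
  have hρ : ∀ r, ContDiff ℝ ∞ (ρ r) := fun r =>
    contDiff_const.mul (truncPow_contDiff.comp (f := fun s : ℝ => s / r ^ 2) (by fun_prop))
  let d : ℝ → ℝ := fun s => ρ R s - ρ δ s
  have hd : ContDiff ℝ ∞ d := (hρ R).sub (hρ δ)
  let ψ : ℝ → ℝ := fun s => ∫ t in (R ^ 2)..s, d t
  have hψd : ∀ s, HasDerivAt ψ (d s) s := fun s =>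
    intervalIntegral.integral_hasDerivAt_right (hd.continuous.intervalIntegrable _ _)
      (hd.continuous.stronglyMeasurableAtFilter _ _) hd.continuous.continuousAt
  have hψ' : deriv ψ = d := funext fun s => (hψd s).deriv
  have hψ : ContDiff ℝ ∞ ψ := by
    rw [contDiff_infty_iff_deriv, hψ']
    exact ⟨fun s => (hψd s).differentiableAt, hd⟩
  have hψ0 : ∀ s, R ^ 2 ≤ s → ψ s = 0 := by
    intro s hs
    refine intervalIntegral.integral_zero_ae (Eventually.of_forall fun t ht => ?_)
    rw [uIoc_of_le hs] at ht
    simp only [d, ρ]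
    rw [truncPow_scale hR0 ht.1.le, truncPow_scale hδ ((pow_le_pow_left₀ hδ.le hR 2).trans ht.1.le),
      sub_self]
  have hρ' : ∀ r s, deriv (ρ r) s = (r ^ n)⁻¹ * (deriv (truncPow n) (s / r ^ 2) / r ^ 2) := by
    intro r s
    have h1 := ((truncPow_contDiff (n := n)).differentiable (by simp) (s / r ^ 2)).hasDerivAt
    have h2 := h1.comp s ((hasDerivAt_id' s).div_const (r ^ 2))
    have h3 := (h2.const_mul (r ^ n)⁻¹).deriv
    change deriv (ρ r) s = _ at h3
    rw [h3]; ring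
  have hk : ∀ r, 0 < r → ∀ x : Euc n, 4 * ‖x‖ ^ 2 * deriv (ρ r) (‖x‖ ^ 2)
      + 2 * n * ρ r (‖x‖ ^ 2) = N * avKer r x := by
    intro r hr x
    have hN : N ≠ 0 := integral_kerPre_pos.ne'
    have e : ‖r⁻¹ • x‖ ^ 2 = ‖x‖ ^ 2 / r ^ 2 := by
      rw [norm_smul, norm_inv, Real.norm_of_nonneg hr.le]; field_simp
    rw [hρ']
    simp only [ρ, avKer, kerPre, e, kerProfile]
    change _ = N * (_ * (_ / N))
    field_simp
  refine ⟨fun x => N⁻¹ * ψ (‖x‖ ^ 2), contDiff_const.mul (hψ.comp (contDiff_norm_sq ℝ)),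
    fun x hx => ?_, fun x => ?_⟩
  · simp [hψ0 _ (pow_le_pow_left₀ hR0.le hx 2)]
  · have hN : N ≠ 0 := integral_kerPre_pos.ne'
    have h2 : ContDiff ℝ ∞ fun x : Euc n => ψ (‖x‖ ^ 2) := hψ.comp (contDiff_norm_sq ℝ)
    rw [lapl_const_mul _ (h2.contDiffAt.of_le two_le_infty), lapl_comp_norm_sq x hψ, hψ']
    have : deriv d (‖x‖ ^ 2) = deriv (ρ R) (‖x‖ ^ 2) - deriv (ρ δ) (‖x‖ ^ 2) :=
      deriv_sub ((hρ R).differentiable (by simp) _) ((hρ δ).differentiable (by simp) _)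
    rw [this]
    simp only [d]
    have a1 := hk R hR0 x
    have a2 := hk δ hδ x
    field_simp
    linarith

/-! ### Averages and Weyl's lemma -/

/-- The average of `w` at scale `r` around `y`. -/
def avg (r : ℝ) (w : Euc n → ℝ) (y : Euc n) : ℝ := ∫ z, w z * avKer r (y - z)

lemma avg_integrand_hasCompactSupport {r : ℝ} (hr : 0 < r) (w : Euc n → ℝ) (y : Euc n) :
    HasCompactSupport fun z => w z * avKer r (y - z) :=
  HasCompactSupport.intro (isCompact_closedBall y r) fun z hz => by
    rw [avKer_of_ge hr, mul_zero]
    rw [mem_closedBall, dist_eq_norm, norm_sub_rev] at hz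
    linarith

lemma avKer_shift_continuous (r : ℝ) (y : Euc n) : Continuous fun z : Euc n => avKer r (y - z) :=
  (avKer_contDiff r).continuous.comp (by fun_prop)

lemma avg_integrable {r : ℝ} (hr : 0 < r) {w : Euc n → ℝ} (hw : Continuous w) (y : Euc n) :
    Integrable fun z => w z * avKer r (y - z) :=
  (hw.mul (avKer_shift_continuous r y)).integrable_of_hasCompactSupport
    (avg_integrand_hasCompactSupport hr w y)

lemma avKer_shift_integral [NeZero n] {r : ℝ} (hr : 0 < r) (y : Euc n) :
    ∫ z, avKer r (y - z) = 1 := by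
  rw [integral_sub_left_eq_self (fun z => avKer r z) volume y, avKer_integral hr]

lemma avg_contDiff {r : ℝ} (hr : 0 < r) {w : Euc n → ℝ} (hw : Continuous w) :
    ContDiff ℝ ∞ (avg r w) :=
  (avKer_hasCompactSupport hr).contDiff_convolution_right (ContinuousLinearMap.mul ℝ ℝ)
    (hw.locallyIntegrable (μ := volume)) (avKer_contDiff r)

lemma abs_avg_sub_le [NeZero n] {r ε c : ℝ} (hr : 0 < r) {w : Euc n → ℝ} (hw : Continuous w)
    {y : Euc n} (h : ∀ z, ‖z - y‖ ≤ r → |w z - c| ≤ ε) : |avg r w y - c| ≤ ε := by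
  have hc : ∫ z, c * avKer r (y - z) = c := by
    rw [integral_const_mul, avKer_shift_integral hr, mul_one]
  have hic := avg_integrable hr (continuous_const (y := c)) y
  have hie := avg_integrable hr (continuous_const (y := ε)) y
  have h1 : avg r w y - c = ∫ z, (w z - c) * avKer r (y - z) := by
    simp only [sub_mul]
    rw [integral_sub (avg_integrable hr hw y) hic, hc]
    rfl
  have h2 : ∫ z, ε * avKer r (y - z) = ε := by
    rw [integral_const_mul, avKer_shift_integral hr, mul_one]
  rw [h1, ← h2]
  refine (abs_integral_le_integral_abs).trans (integral_mono ?_ hie fun z => ?_)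
  · exact (avg_integrable hr (hw.sub continuous_const) y).abs
  · change |(w z - c) * avKer r (y - z)| ≤ ε * avKer r (y - z)
    rw [abs_mul, abs_of_nonneg (avKer_nonneg hr _)]
    by_cases hz : ‖z - y‖ ≤ r
    · exact mul_le_mul_of_nonneg_right (h z hz) (avKer_nonneg hr _)
    · rw [norm_sub_rev] at hz
      rw [avKer_of_ge hr (not_le.1 hz).le]
      simp

lemma abs_avg_sub_le_of_lipschitz [NeZero n] {r : ℝ} (hr : 0 < r) {w : Euc n → ℝ} {M : ℝ}
    (hw : ∀ x y, |w x - w y| ≤ M * ‖x - y‖) (hc : Continuous w) (hM : 0 ≤ M) (y : Euc n) :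
    |avg r w y - w y| ≤ M * r :=
  abs_avg_sub_le hr hc fun z hz => (hw z y).trans (mul_le_mul_of_nonneg_left hz hM)

lemma tendsto_avg [NeZero n] {w : Euc n → ℝ} (hw : Continuous w) (y : Euc n) :
    Tendsto (fun r => avg r w y) (𝓝[>] 0) (𝓝 (w y)) := by
  rw [Metric.tendsto_nhds]
  intro ε hε
  obtain ⟨d, hd, h⟩ := Metric.continuous_iff.1 hw y (ε / 2) (by positivity)
  filter_upwards [self_mem_nhdsWithin, nhdsWithin_le_nhds (Iio_mem_nhds hd)] with r hr hrd
  rw [Real.dist_eq]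
  refine lt_of_le_of_lt (abs_avg_sub_le (ε := ε / 2) hr hw fun z hz => ?_) (by linarith)
  exact (h z (by rw [dist_eq_norm]; exact lt_of_le_of_lt hz hrd)).le

/-- `w` is harmonic in `U` in the sense of distributions. -/
def WeaklyHarmonic (U : Set (Euc n)) (w : Euc n → ℝ) : Prop :=
  ∀ φ : Euc n → ℝ, ContDiff ℝ ∞ φ → HasCompactSupport φ → tsupport φ ⊆ U →
    ∫ x, w x * lapl φ x = 0

lemma WeaklyHarmonic.avg_eq_avg [NeZero n] {U : Set (Euc n)} {w : Euc n → ℝ}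
    (h : WeaklyHarmonic U w) (hw : Continuous w) {δ R : ℝ} (hδ : 0 < δ) (hR : δ ≤ R) {y : Euc n}
    (hy : closedBall y R ⊆ U) : avg R w y = avg δ w y := by
  obtain ⟨Ψ, hΨ, hs, hL⟩ := exists_lapl_eq_avKer_sub (n := n) hδ hR
  have hs' : ∀ z, z ∉ closedBall y R → Ψ (y - z) = 0 := fun z hz => hs _ <| by
    rw [mem_closedBall, dist_eq_norm, norm_sub_rev] at hz
    linarith
  have e : ∀ z, lapl (fun z => Ψ (y - z)) z = avKer R (y - z) - avKer δ (y - z) := by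
    intro z
    have := lapl_comp_affine (f := Ψ) y (-1) z (hΨ.contDiffAt.of_le two_le_infty)
    simp only [neg_smul, one_smul, ← sub_eq_add_neg, hL] at this
    rw [this]; ring
  have := h (fun z => Ψ (y - z)) (hΨ.comp (by fun_prop))
    (HasCompactSupport.intro (isCompact_closedBall y R) hs')
    ((closure_minimal (fun z hz => by by_contra h; exact hz (hs' z h)) isClosed_closedBall).trans hy)
  simp only [e, mul_sub] at this
  rw [integral_sub (avg_integrable (hδ.trans_le hR) hw y) (avg_integrable hδ hw y)] at this
  exact sub_eq_zero.1 this

lemma WeaklyHarmonic.avg_eq [NeZero n] {U : Set (Euc n)} {w : Euc n → ℝ}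
    (h : WeaklyHarmonic U w) (hw : Continuous w) {R : ℝ} (hR : 0 < R) {y : Euc n}
    (hy : closedBall y R ⊆ U) : avg R w y = w y := by
  refine tendsto_nhds_unique (tendsto_const_nhds.congr' ?_) (tendsto_avg hw y)
  filter_upwards [self_mem_nhdsWithin, nhdsWithin_le_nhds (Iio_mem_nhds hR)] with r hr hrd
  exact h.avg_eq_avg hw hr (le_of_lt hrd) hy

lemma WeaklyHarmonic.contDiffOn [NeZero n] {U : Set (Euc n)} (hU : IsOpen U) {w : Euc n → ℝ}
    (h : WeaklyHarmonic U w) (hw : Continuous w) : ContDiffOn ℝ ∞ w U := by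
  intro x hx
  obtain ⟨ρ, hρ, hρU⟩ := Metric.isOpen_iff.1 hU x hx
  have : avg (ρ / 2) w =ᶠ[𝓝 x] w := by
    filter_upwards [ball_mem_nhds x (half_pos (half_pos hρ))] with y hy
    refine h.avg_eq hw (half_pos hρ) (fun z hz => hρU ?_)
    rw [mem_ball] at *
    rw [mem_closedBall] at hz
    linarith [dist_triangle z y x]
  exact ((avg_contDiff (half_pos hρ) hw).contDiffAt.congr_of_eventuallyEq
    this.symm).contDiffWithinAt

lemma WeaklyHarmonic.lapl_eq_zero [NeZero n] {U : Set (Euc n)} (hU : IsOpen U) {w : Euc n → ℝ}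
    (h : WeaklyHarmonic U w) (hw : Continuous w) : ∀ x ∈ U, lapl w x = 0 := by
  have hs := h.contDiffOn hU hw
  have hcont : ContinuousOn (lapl w) U := by
    have e : ∀ x ∈ U, lapl w x = ∑ i, fderiv ℝ (fderiv ℝ w) x (stdVec i) (stdVec i) :=
      fun x _ => lapl_eq_sum_fderiv w x
    refine ContinuousOn.congr ?_ e
    refine continuousOn_finsetSum _ fun i _ => fun x hx => ?_
    have h1 : ContDiffAt ℝ 2 w x := (hs.contDiffAt (hU.mem_nhds hx)).of_le two_le_infty
    have h2 : ContDiffAt ℝ 1 (fderiv ℝ w) x := h1.fderiv_right (by norm_num)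
    have h3 : ContDiffAt ℝ 0 (fderiv ℝ (fderiv ℝ w)) x := h2.fderiv_right (by norm_num)
    exact ((h3.continuousAt.clm_apply continuousAt_const).clm_apply
      continuousAt_const).continuousWithinAt
  have hae : ∀ᵐ x, x ∈ U → lapl w x = 0 := by
    refine hU.ae_eq_zero_of_integral_contDiff_smul_eq_zero
      (hcont.locallyIntegrableOn hU.measurableSet) fun φ hφ hc hsup => ?_
    have := h φ hφ hc hsup
    rw [integral_mul_lapl_eq hU (hs.of_le two_le_infty) hφ hc hsup] at this
    simpa [mul_comm] using this
  have := Measure.eqOn_open_of_ae_eq (μ := volume) (f := lapl w) (g := fun _ => 0)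
    ((ae_restrict_iff' hU.measurableSet).2 hae) hU hcont continuousOn_const
  exact this

lemma exists_avKer_lipschitz [NeZero n] : ∃ L : ℝ, 0 ≤ L ∧ ∀ r > 0, ∀ x y : Euc n,
    |avKer r x - avKer r y| ≤ L * (r ^ (n + 1))⁻¹ * ‖x - y‖ := by
  obtain ⟨C, hC⟩ := (avKer_contDiff (n := n) 1).lipschitzWith_of_hasCompactSupport
    (avKer_hasCompactSupport one_pos) (by simp)
  refine ⟨C, C.2, fun r hr x y => ?_⟩
  rw [avKer_scale (r := r), avKer_scale (r := r) y, ← mul_sub, abs_mul,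
    abs_of_nonneg (by positivity : 0 ≤ (r ^ n)⁻¹)]
  have := hC.dist_le_mul (r⁻¹ • x) (r⁻¹ • y)
  rw [Real.dist_eq, dist_eq_norm, ← smul_sub, norm_smul, norm_inv, Real.norm_of_nonneg hr.le] at this
  refine (mul_le_mul_of_nonneg_left this (by positivity)).trans_eq ?_
  field_simp
  ring

lemma exists_avKer_secondDiff [NeZero n] : ∃ L : ℝ, 0 ≤ L ∧ ∀ r > 0, ∀ x a : Euc n,
    |avKer r (x + a) + avKer r (x - a) - 2 * avKer r x| ≤ L * (r ^ (n + 2))⁻¹ * ‖a‖ ^ 2 := by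
  have hK := avKer_contDiff (n := n) 1
  obtain ⟨C, hC⟩ := (hK.fderiv_right (m := ∞) (by exact_mod_cast le_top)).lipschitzWith_of_hasCompactSupport
    ((avKer_hasCompactSupport one_pos).fderiv ℝ) (by simp)
  have key : ∀ x a : Euc n, |avKer 1 (x + a) + avKer 1 (x - a) - 2 * avKer 1 x|
      ≤ 2 * C * ‖a‖ ^ 2 := by
    intro x a
    let f : ℝ → ℝ := fun t => avKer 1 (x + t • a) + avKer 1 (x - t • a)
    have hf : ∀ t, HasDerivAt f (fderiv ℝ (avKer 1) (x + t • a) a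
        - fderiv ℝ (avKer 1) (x - t • a) a) t := by
      intro t
      have h1 : HasDerivAt (fun t : ℝ => x + t • a) a t := by
        simpa only [one_smul] using ((hasDerivAt_id' t).smul_const a).const_add x
      have h2 : HasDerivAt (fun t : ℝ => x - t • a) (-a) t := by
        simpa only [one_smul] using ((hasDerivAt_id' t).smul_const a).const_sub x
      have g1 := ((hK.differentiable (by simp)) (x + t • a)).hasFDerivAt.comp_hasDerivAt t h1
      have g2 := ((hK.differentiable (by simp)) (x - t • a)).hasFDerivAt.comp_hasDerivAt t h2
      have := g1.add g2
      rw [map_neg, ← sub_eq_add_neg] at this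
      exact this
    have := norm_image_sub_le_of_norm_deriv_le_segment_01' (f := f) (C := 2 * C * ‖a‖ ^ 2)
      (fun t _ => (hf t).hasDerivWithinAt) (fun t ht => ?_)
    · have e : f 1 - f 0 = avKer 1 (x + a) + avKer 1 (x - a) - 2 * avKer 1 x := by
        simp [f]; ring
      rwa [e] at this
    · rw [← sub_apply]
      refine (ContinuousLinearMap.le_opNorm _ _).trans ?_
      have h3 := hC.dist_le_mul (x + t • a) (x - t • a)
      rw [dist_eq_norm, dist_eq_norm] at h3
      have e : x + t • a - (x - t • a) = (2 * t) • a := by module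
      rw [e, norm_smul, Real.norm_of_nonneg (by linarith [ht.1])] at h3
      have hC0 : (0 : ℝ) ≤ C := C.2
      have h4 : 2 * t * ‖a‖ ≤ 2 * ‖a‖ := by
        have := ht.2.le
        have := norm_nonneg a
        nlinarith
      calc _ ≤ (C * (2 * t * ‖a‖)) * ‖a‖ := mul_le_mul_of_nonneg_right h3 (norm_nonneg _)
        _ ≤ (C * (2 * ‖a‖)) * ‖a‖ := by gcongr
        _ = _ := by ring
  refine ⟨2 * C, mul_nonneg two_pos.le C.2, fun r hr x a => ?_⟩
  rw [avKer_scale (r := r), avKer_scale (r := r) (x - a), avKer_scale (r := r) x]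
  have h1 := key (r⁻¹ • x) (r⁻¹ • a)
  rw [← smul_add, ← smul_sub, norm_smul, norm_inv, Real.norm_of_nonneg hr.le] at h1
  have e : (r ^ n)⁻¹ * avKer 1 (r⁻¹ • (x + a)) + (r ^ n)⁻¹ * avKer 1 (r⁻¹ • (x - a))
      - 2 * ((r ^ n)⁻¹ * avKer 1 (r⁻¹ • x)) = (r ^ n)⁻¹ * (avKer 1 (r⁻¹ • (x + a))
      + avKer 1 (r⁻¹ • (x - a)) - 2 * avKer 1 (r⁻¹ • x)) := by ring
  rw [e, abs_mul, abs_of_nonneg (by positivity : 0 ≤ (r ^ n)⁻¹)]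
  refine (mul_le_mul_of_nonneg_left h1 (by positivity)).trans_eq ?_
  field_simp
  ring

/-- The volume of the unit ball. -/
def ballVol (n : ℕ) : ℝ := (volume : Measure (Euc n)).real (ball 0 1)

lemma ballVol_nonneg : 0 ≤ ballVol n := measureReal_nonneg

lemma volume_real_closedBall (a : Euc n) {r : ℝ} (hr : 0 ≤ r) :
    (volume : Measure (Euc n)).real (closedBall a r) = r ^ n * ballVol n := by
  rw [Measure.real, Measure.addHaar_closedBall _ _ hr, ENNReal.toReal_mul,
    ENNReal.toReal_ofReal (by positivity)]
  simp [ballVol, Measure.real]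

lemma abs_integral_le_of_supp {f : Euc n → ℝ} {a : Euc n} {r C : ℝ} (hr : 0 ≤ r)
    (hf : ∀ x, x ∉ closedBall a r → f x = 0) (hC : ∀ x ∈ closedBall a r, |f x| ≤ C) :
    |∫ x, f x| ≤ C * (r ^ n * ballVol n) := by
  rw [← setIntegral_eq_integral_of_forall_compl_eq_zero hf, ← volume_real_closedBall a hr]
  exact norm_setIntegral_le_of_norm_le_const (f := f) measure_closedBall_lt_top hC

/-- Interior gradient estimate. -/
lemma exists_gradient_estimate [NeZero n] : ∃ C : ℝ, 0 ≤ C ∧ ∀ (w : Euc n → ℝ) (U : Set (Euc n))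
    (a : Euc n) (ρ M : ℝ), Continuous w → WeaklyHarmonic U w → 0 < ρ → 0 ≤ M →
    closedBall a (2 * ρ) ⊆ U → (∀ x ∈ closedBall a (2 * ρ), |w x| ≤ M) →
    ‖fderiv ℝ w a‖ ≤ C * M / ρ := by
  obtain ⟨L, hL0, hL⟩ := exists_avKer_lipschitz (n := n)
  refine ⟨L * 2 ^ n * ballVol n, by have := ballVol_nonneg (n := n); positivity, ?_⟩
  intro w U a ρ M hw h hρ hM hU hb
  have hB := ballVol_nonneg (n := n)
  refine norm_fderiv_le_of_lip' ℝ (by positivity) ?_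
  filter_upwards [closedBall_mem_nhds a hρ] with y hy
  rw [mem_closedBall] at hy
  have h1 : avg ρ w y = w y := h.avg_eq hw hρ fun z hz => hU <| by
    rw [mem_closedBall] at *
    linarith [dist_triangle z y a]
  have h2 : avg ρ w a = w a := h.avg_eq hw hρ fun z hz => hU <| by
    rw [mem_closedBall] at *
    linarith
  rw [← h1, ← h2, avg, avg, ← integral_sub (avg_integrable hρ hw y) (avg_integrable hρ hw a)]
  simp only [← mul_sub]
  refine (abs_integral_le_of_supp (a := a) (r := 2 * ρ)
    (C := M * (L * (ρ ^ (n + 1))⁻¹ * ‖y - a‖)) (by positivity) (fun z hz => ?_)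
    (fun z hz => ?_)).trans_eq ?_
  · rw [mem_closedBall, not_le] at hz
    rw [avKer_of_ge hρ, avKer_of_ge hρ]
    · simp
    · rw [← dist_eq_norm, dist_comm]; linarith
    · rw [← dist_eq_norm, dist_comm]; linarith [dist_triangle z y a]
  · rw [abs_mul]
    refine mul_le_mul (hb z hz) ?_ (abs_nonneg _) hM
    simpa using hL ρ hρ (y - z) (a - z)
  · rw [mul_pow, pow_succ]; field_simp

/-- Second differences of averages of Lipschitz functions at large scales are small. -/
lemma exists_avg_secondDiff [NeZero n] : ∃ C : ℝ, 0 ≤ C ∧ ∀ (w : Euc n → ℝ) (M R : ℝ) (a : Euc n),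
    Continuous w → (∀ z, |w z| ≤ M * ‖z‖) → 0 ≤ M → 0 < R → ‖a‖ ≤ R →
    |avg R w a + avg R w (-a) - 2 * avg R w 0| ≤ C * M * ‖a‖ ^ 2 / R := by
  obtain ⟨L, hL0, hL⟩ := exists_avKer_secondDiff (n := n)
  refine ⟨L * 2 ^ (n + 1) * ballVol n, by have := ballVol_nonneg (n := n); positivity, ?_⟩
  intro w M R a hw hb hM hR ha
  have e : avg R w a + avg R w (-a) - 2 * avg R w 0 = ∫ z, w z * (avKer R (-z + a)
      + avKer R (-z - a) - 2 * avKer R (-z)) := by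
    have e1 : avg R w a = ∫ z, w z * avKer R (-z + a) := by
      simp only [avg, neg_add_eq_sub]
    have e2 : avg R w (-a) = ∫ z, w z * avKer R (-z - a) := by
      simp only [avg]
      refine integral_congr_ae (Eventually.of_forall fun z => ?_)
      simp only
      congr 2
      abel
    have e3 : avg R w 0 = ∫ z, w z * avKer R (-z) := by simp only [avg, zero_sub]
    have i1 := avg_integrable hR hw a
    have i2 := avg_integrable hR hw (-a)
    have i3 := avg_integrable hR hw 0
    have c1 : ∀ z : Euc n, a - z = -z + a := fun z => by abel
    have c2 : ∀ z : Euc n, -a - z = -z - a := fun z => by abel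
    simp only [c1] at i1
    simp only [c2] at i2
    simp only [zero_sub] at i3
    rw [e1, e2, e3, ← integral_const_mul, ← integral_add i1 i2,
      ← integral_sub (by exact i1.add i2) (i3.const_mul 2)]
    refine integral_congr_ae (Eventually.of_forall fun z => ?_)
    simp only
    ring
  rw [e]
  have hB := ballVol_nonneg (n := n)
  refine (abs_integral_le_of_supp (a := 0) (r := 2 * R)
    (C := (M * (2 * R)) * (L * (R ^ (n + 2))⁻¹ * ‖a‖ ^ 2)) (by positivity) (fun z hz => ?_)
    (fun z hz => ?_)).trans_eq ?_
  · rw [mem_closedBall, not_le, dist_zero_right] at hz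
    rw [avKer_of_ge hR, avKer_of_ge hR, avKer_of_ge hR]
    · simp
    · rw [norm_neg]; linarith
    · have := norm_sub_norm_le (-z) a; rw [norm_neg] at this; linarith
    · have := norm_sub_norm_le (-z) (-a); rw [norm_neg, norm_neg, sub_neg_eq_add] at this; linarith
  · rw [mem_closedBall, dist_zero_right] at hz
    rw [abs_mul]
    refine mul_le_mul ((hb z).trans ?_) (hL R hR (-z) a) (abs_nonneg _) (by positivity)
    gcongr
  · rw [mul_pow, pow_succ, pow_succ]; field_simp
    ring

/-! ### Existence of the torsion function by finite differences -/

/-- The mean of `v` over the `2n` lattice neighbours at distance `ε`. -/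
def nbMean (ε : ℝ) (v : Euc n → ℝ) (x : Euc n) : ℝ :=
  (∑ i, (v (x + ε • stdVec i) + v (x - ε • stdVec i))) / (2 * n)

/-- Iterates towards the solution of the discrete torsion problem. -/
def discTorsion (Ω : Set (Euc n)) (ε : ℝ) : ℕ → Euc n → ℝ
  | 0 => fun _ => 0
  | k + 1 => Ω.indicator fun x => nbMean ε (discTorsion Ω ε k) x + ε ^ 2 / n

lemma natCast_pos_of_neZero [NeZero n] : (0 : ℝ) < n := by
  exact_mod_cast Nat.pos_of_ne_zero (NeZero.ne n)

lemma nbMean_mono {ε : ℝ} {v w : Euc n → ℝ} {x : Euc n}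
    (h : ∀ i, v (x + ε • stdVec i) ≤ w (x + ε • stdVec i))
    (h' : ∀ i, v (x - ε • stdVec i) ≤ w (x - ε • stdVec i)) : nbMean ε v x ≤ nbMean ε w x := by
  unfold nbMean
  gcongr with i
  · exact h i
  · exact h' i

lemma nbMean_nonneg {ε : ℝ} {v : Euc n → ℝ} (hv : ∀ x, 0 ≤ v x) (x : Euc n) :
    0 ≤ nbMean ε v x :=
  div_nonneg (Finset.sum_nonneg fun i _ => add_nonneg (hv _) (hv _)) (by positivity)

lemma nbMean_sub_le [NeZero n] {ε C : ℝ} {v : Euc n → ℝ} {x y : Euc n}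
    (h : ∀ τ, v (x + τ) - v (y + τ) ≤ C) : nbMean ε v x - nbMean ε v y ≤ C := by
  have hn := natCast_pos_of_neZero (n := n)
  unfold nbMean
  rw [← sub_div, ← Finset.sum_sub_distrib, div_le_iff₀ (by positivity)]
  refine (Finset.sum_le_sum (g := fun _ => 2 * C) fun i _ => ?_).trans_eq ?_
  · have h1 := h (ε • stdVec i)
    have h2 := h (-(ε • stdVec i))
    simp only [← sub_eq_add_neg] at h2
    linarith
  · simp; ring

lemma discTorsion_nonneg (Ω : Set (Euc n)) (ε : ℝ) (k : ℕ) (x : Euc n) :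
    0 ≤ discTorsion Ω ε k x := by
  induction k generalizing x with
  | zero => exact le_rfl
  | succ k ih =>
    refine indicator_nonneg (fun y _ => ?_) x
    have := nbMean_nonneg ih (ε := ε) y
    positivity

lemma discTorsion_of_notMem {Ω : Set (Euc n)} (ε : ℝ) (k : ℕ) {x : Euc n} (hx : x ∉ Ω) :
    discTorsion Ω ε k x = 0 := by
  cases k with
  | zero => rfl
  | succ k => exact indicator_of_notMem hx _

lemma discTorsion_succ {Ω : Set (Euc n)} (ε : ℝ) (k : ℕ) {x : Euc n} (hx : x ∈ Ω) :
    discTorsion Ω ε (k + 1) x = nbMean ε (discTorsion Ω ε k) x + ε ^ 2 / n :=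
  indicator_of_mem hx _

lemma discTorsion_le_succ (Ω : Set (Euc n)) (ε : ℝ) (k : ℕ) (x : Euc n) :
    discTorsion Ω ε k x ≤ discTorsion Ω ε (k + 1) x := by
  induction k generalizing x with
  | zero => exact discTorsion_nonneg _ _ _ _
  | succ k ih =>
    by_cases hx : x ∈ Ω
    · rw [discTorsion_succ _ _ hx, discTorsion_succ _ _ hx]
      have := nbMean_mono (ε := ε) (x := x) (fun i => ih (x + ε • stdVec i))
        (fun i => ih (x - ε • stdVec i))
      linarith
    · rw [discTorsion_of_notMem _ _ hx, discTorsion_of_notMem _ _ hx]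

lemma discTorsion_barrier [NeZero n] {Ω : Set (Euc n)} {ε h D : ℝ} {ν : Euc n} (hε : 0 ≤ ε)
    (hν : ‖ν‖ = 1) (hΩ : ∀ x ∈ Ω, ⟪x, ν⟫ ≤ h ∧ h - D ≤ ⟪x, ν⟫) (k : ℕ) (x : Euc n)
    (h0 : 0 ≤ h + ε - ⟪x, ν⟫) (h1 : h + ε - ⟪x, ν⟫ ≤ D + 2 * ε) :
    discTorsion Ω ε k x ≤ (h + ε - ⟪x, ν⟫) * (D + 2 * ε - (h + ε - ⟪x, ν⟫)) := by
  have hn := natCast_pos_of_neZero (n := n)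
  induction k generalizing x with
  | zero => exact mul_nonneg h0 (by linarith)
  | succ k ih =>
    by_cases hx : x ∈ Ω
    swap
    · rw [discTorsion_of_notMem _ _ hx]; exact mul_nonneg h0 (by linarith)
    rw [discTorsion_succ _ _ hx]
    obtain ⟨ha, hb⟩ := hΩ x hx
    have hνi : ∀ i, |ε * ν i| ≤ ε := fun i => by
      have h2 : |ν i| ≤ 1 := hν ▸ PiLp.norm_apply_le ν i
      rw [abs_mul, abs_of_nonneg hε]
      nlinarith
    have hin : ∀ i, ⟪x + ε • stdVec i, ν⟫ = ⟪x, ν⟫ + ε * ν i := fun i => by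
      rw [inner_add_left, inner_smul_left]
      simp [EuclideanSpace.inner_single_left]
    have hin' : ∀ i, ⟪x - ε • stdVec i, ν⟫ = ⟪x, ν⟫ - ε * ν i := fun i => by
      rw [inner_sub_left, inner_smul_left]
      simp [EuclideanSpace.inner_single_left]
    have key := nbMean_mono (ε := ε) (x := x) (v := discTorsion Ω ε k)
      (w := fun x => (h + ε - ⟪x, ν⟫) * (D + 2 * ε - (h + ε - ⟪x, ν⟫)))
      (fun i => ih _ (by rw [hin]; linarith [abs_le.1 (hνi i)])
        (by rw [hin]; linarith [(abs_le.1 (hνi i)).1]))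
      (fun i => ih _ (by rw [hin']; linarith [(abs_le.1 (hνi i)).1])
        (by rw [hin']; linarith [(abs_le.1 (hνi i)).2]))
    have e : nbMean ε (fun x => (h + ε - ⟪x, ν⟫) * (D + 2 * ε - (h + ε - ⟪x, ν⟫))) x
        = (h + ε - ⟪x, ν⟫) * (D + 2 * ε - (h + ε - ⟪x, ν⟫)) - ε ^ 2 / n := by
      have hsq : ∑ i, ν i ^ 2 = 1 := by
        rw [← EuclideanSpace.real_norm_sq_eq, hν, one_pow]
      have e2 : ∀ i, (h + ε - ⟪x + ε • stdVec i, ν⟫) * (D + 2 * ε - (h + ε - ⟪x + ε • stdVec i, ν⟫))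
          + (h + ε - ⟪x - ε • stdVec i, ν⟫) * (D + 2 * ε - (h + ε - ⟪x - ε • stdVec i, ν⟫))
          = 2 * ((h + ε - ⟪x, ν⟫) * (D + 2 * ε - (h + ε - ⟪x, ν⟫))) - 2 * ε ^ 2 * ν i ^ 2 :=
        fun i => by rw [hin, hin']; ring
      unfold nbMean
      simp only [e2]
      rw [Finset.sum_sub_distrib, Finset.sum_const, ← Finset.mul_sum, hsq]
      simp only [Finset.card_univ, Fintype.card_fin, nsmul_eq_mul]
      field_simp
    linarith

lemma exists_unit_normal {Ω : Set (Euc n)} (hΩ : IsOpen Ω) (hc : Convex ℝ Ω) (hne : Ω.Nonempty)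
    {y : Euc n} (hy : y ∉ Ω) : ∃ ν : Euc n, ‖ν‖ = 1 ∧ ∀ x ∈ Ω, ⟪x, ν⟫ < ⟪y, ν⟫ := by
  obtain ⟨f, hf⟩ := geometric_hahn_banach_open_point hc hΩ hy
  obtain ⟨v, rfl⟩ := (InnerProductSpace.toDual ℝ (Euc n)).surjective f
  simp only [InnerProductSpace.toDual_apply_apply] at hf
  obtain ⟨z, hz⟩ := hne
  have hv : 0 < ‖v‖ := norm_pos_iff.2 fun h => by simpa [h] using hf z hz
  refine ⟨‖v‖⁻¹ • v, by rw [norm_smul, norm_inv, norm_norm, inv_mul_cancel₀ hv.ne'],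
    fun x hx => ?_⟩
  rw [inner_smul_right, inner_smul_right, real_inner_comm, real_inner_comm v y]
  exact mul_lt_mul_of_pos_left (hf x hx) (inv_pos.2 hv)

lemma discTorsion_sub_le [NeZero n] {Ω : Set (Euc n)} {ε R : ℝ} (hε : 0 ≤ ε) (hR : 0 ≤ R)
    (hΩ : IsOpen Ω) (hc : Convex ℝ Ω) (hb : Ω ⊆ closedBall 0 R) (k : ℕ) (x y : Euc n) :
    discTorsion Ω ε k x - discTorsion Ω ε k y ≤ (2 * R + 2 * ε) * (‖x - y‖ + ε) := by
  induction k generalizing x y with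
  | zero => simp only [discTorsion, sub_self]; positivity
  | succ k ih =>
    by_cases hx : x ∈ Ω
    swap
    · rw [discTorsion_of_notMem _ _ hx]
      have := discTorsion_nonneg Ω ε (k + 1) y
      have : 0 ≤ (2 * R + 2 * ε) * (‖x - y‖ + ε) := by positivity
      linarith
    by_cases hy : y ∈ Ω
    · rw [discTorsion_succ _ _ hx, discTorsion_succ _ _ hy, add_sub_add_right_eq_sub]
      exact nbMean_sub_le fun τ => by simpa using ih (x + τ) (y + τ)
    · rw [discTorsion_of_notMem _ _ hy, sub_zero]
      obtain ⟨ν, hν, hsep⟩ := exists_unit_normal hΩ hc ⟨x, hx⟩ hy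
      have hR' : ∀ z ∈ Ω, |⟪z, ν⟫| ≤ R := fun z hz => by
        have := abs_real_inner_le_norm z ν
        rw [hν, mul_one] at this
        exact this.trans (by simpa using hb hz)
      have hle : min ⟪y, ν⟫ R ≤ R := min_le_right _ _
      have hle' : min ⟪y, ν⟫ R ≤ ⟪y, ν⟫ := min_le_left _ _
      have hxm : ⟪x, ν⟫ ≤ min ⟪y, ν⟫ R := le_min (hsep x hx).le (abs_le.1 (hR' x hx)).2
      have hbar := discTorsion_barrier (D := 2 * R) (h := min ⟪y, ν⟫ R) hε hν
        (fun z hz => ⟨le_min (hsep z hz).le (abs_le.1 (hR' z hz)).2,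
          by linarith [(abs_le.1 (hR' z hz)).1]⟩) (k + 1) x
        (by linarith)
        (by linarith [(abs_le.1 (hR' x hx)).1])
      refine hbar.trans ?_
      have h3 : ⟪y, ν⟫ - ⟪x, ν⟫ ≤ ‖x - y‖ := by
        rw [← inner_sub_left, norm_sub_rev]
        exact (real_inner_le_norm _ _).trans (by rw [hν, mul_one])
      have h4 : 0 ≤ min ⟪y, ν⟫ R + ε - ⟪x, ν⟫ := by linarith
      nlinarith

lemma discTorsion_measurable {Ω : Set (Euc n)} (hΩ : IsOpen Ω) (ε : ℝ) (k : ℕ) :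
    Measurable (discTorsion Ω ε k) := by
  induction k with
  | zero => exact measurable_const
  | succ k ih =>
    refine Measurable.indicator ?_ hΩ.measurableSet
    unfold nbMean
    refine Measurable.add_const (Measurable.div_const (Finset.measurable_fun_sum _ fun i _ => ?_) _) _
    exact (ih.comp (by fun_prop)).add (ih.comp (by fun_prop))

/-- The discrete torsion problem has a solution with uniform bounds. -/
lemma exists_discrete_solution [NeZero n] {Ω : Set (Euc n)} {ε R : ℝ} (hε : 0 ≤ ε) (hR : 0 ≤ R)
    (hΩ : IsOpen Ω) (hc : Convex ℝ Ω) (hb : Ω ⊆ closedBall 0 R) :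
    ∃ u : Euc n → ℝ, Measurable u ∧ (∀ x, 0 ≤ u x) ∧ (∀ x ∉ Ω, u x = 0) ∧
      (∀ x ∈ Ω, u x = nbMean ε u x + ε ^ 2 / n) ∧
      ∀ x y, u x - u y ≤ (2 * R + 2 * ε) * (‖x - y‖ + ε) := by
  have hmono : ∀ x, Monotone fun k => discTorsion Ω ε k x := fun x =>
    monotone_nat_of_le_succ fun k => discTorsion_le_succ Ω ε k x
  obtain ⟨y, hy⟩ : ∃ y, y ∉ Ω := by
    by_contra! h
    have := hb (h ((R + 1) • stdVec 0))
    rw [mem_closedBall, dist_zero_right, norm_smul, PiLp.norm_single,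
      Real.norm_of_nonneg (by positivity)] at this
    simp at this
    linarith
  have hbdd : ∀ x, BddAbove (range fun k => discTorsion Ω ε k x) := fun x => by
    refine ⟨(2 * R + 2 * ε) * (‖x - y‖ + ε), ?_⟩
    rintro _ ⟨k, rfl⟩
    have := discTorsion_sub_le hε hR hΩ hc hb k x y
    rwa [discTorsion_of_notMem _ _ hy, sub_zero] at this
  have hlim : ∀ x, Tendsto (fun k => discTorsion Ω ε k x) atTop
      (𝓝 (⨆ k, discTorsion Ω ε k x)) := fun x => tendsto_atTop_ciSup (hmono x) (hbdd x)
  refine ⟨fun x => ⨆ k, discTorsion Ω ε k x, ?_, fun x => ?_, fun x hx => ?_, fun x hx => ?_,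
    fun x y => ?_⟩
  · exact measurable_of_tendsto_metrizable (discTorsion_measurable hΩ ε)
      (tendsto_pi_nhds.2 hlim)
  · exact ge_of_tendsto' (hlim x) fun k => discTorsion_nonneg Ω ε k x
  · simp [discTorsion_of_notMem _ _ hx]
  · refine tendsto_nhds_unique ((hlim x).comp (tendsto_add_atTop_nat 1)) ?_
    have : Tendsto (fun k => nbMean ε (discTorsion Ω ε k) x + ε ^ 2 / n) atTop
        (𝓝 (nbMean ε (fun x => ⨆ k, discTorsion Ω ε k x) x + ε ^ 2 / n)) := by
      unfold nbMean
      exact ((tendsto_finsetSum _ fun i _ => (hlim _).add (hlim _)).div_const _).add_const _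
    exact this.congr fun k => (discTorsion_succ ε k hx).symm
  · exact le_of_tendsto' ((hlim x).sub (hlim y)) fun k => discTorsion_sub_le hε hR hΩ hc hb k x y

/-- Second-order Taylor expansion of symmetric differences in one variable. -/
lemma abs_secondDiff_sub_le_real {p p' p'' : ℝ → ℝ} {C ε : ℝ} (hC : 0 ≤ C) (hε : 0 ≤ ε)
    (h1 : ∀ t, HasDerivAt p (p' t) t) (h2 : ∀ t, HasDerivAt p' (p'' t) t)
    (hl : ∀ t, |p'' t - p'' 0| ≤ C * |t|) :
    |p ε + p (-ε) - 2 * p 0 - ε ^ 2 * p'' 0| ≤ 2 * C * ε ^ 3 := by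
  let f : ℝ → ℝ := fun t => p t + p (-t) - t ^ 2 * p'' 0
  let f' : ℝ → ℝ := fun t => p' t - p' (-t) - 2 * t * p'' 0
  let f'' : ℝ → ℝ := fun t => p'' t + p'' (-t) - 2 * p'' 0
  have hf : ∀ t, HasDerivAt f (f' t) t := by
    intro t
    have := ((h1 t).add ((h1 (-t)).comp t (hasDerivAt_neg' t))).sub
      ((hasDerivAt_pow 2 t).mul_const (p'' 0))
    refine this.congr_deriv ?_
    simp [f']; ring
  have hf' : ∀ t, HasDerivAt f' (f'' t) t := by
    intro t
    have := ((h2 t).sub ((h2 (-t)).comp t (hasDerivAt_neg' t))).sub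
      (((hasDerivAt_id' t).const_mul 2).mul_const (p'' 0))
    refine this.congr_deriv ?_
    simp [f'']
  have hf''b : ∀ t ∈ Icc 0 ε, |f'' t| ≤ 2 * C * ε := by
    intro t ht
    have a1 := hl t
    have a2 := hl (-t)
    rw [abs_neg] at a2
    rw [abs_of_nonneg ht.1] at a1 a2
    have e3 : f'' t = (p'' t - p'' 0) + (p'' (-t) - p'' 0) := by simp only [f'']; ring
    rw [e3]
    refine (abs_add_le _ _).trans ?_
    have := mul_le_mul_of_nonneg_left ht.2 hC
    linarith
  have hf'b : ∀ t ∈ Icc 0 ε, |f' t| ≤ 2 * C * ε ^ 2 := by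
    intro t ht
    have := norm_image_sub_le_of_norm_deriv_le_segment' (f := f') (f' := f'') (a := 0) (b := ε)
      (fun s _ => (hf' s).hasDerivWithinAt) (fun s hs => hf''b s ⟨hs.1, hs.2.le⟩) t ht
    have e0 : f' 0 = 0 := by simp [f']
    rw [e0, sub_zero, sub_zero] at this
    refine this.trans ?_
    have := mul_le_mul_of_nonneg_left ht.2 (by positivity : 0 ≤ 2 * C * ε)
    linarith
  have := norm_image_sub_le_of_norm_deriv_le_segment' (f := f) (f' := f') (a := 0) (b := ε)
      (fun s _ => (hf s).hasDerivWithinAt) (fun s hs => hf'b s ⟨hs.1, hs.2.le⟩) ε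
      (right_mem_Icc.2 hε)
  have e : f ε - f 0 = p ε + p (-ε) - 2 * p 0 - ε ^ 2 * p'' 0 := by simp [f]; ring
  rw [e, Real.norm_eq_abs] at this
  refine this.trans_eq ?_
  ring

lemma hasDerivAt_add_smul (x v : Euc n) (t : ℝ) : HasDerivAt (fun t : ℝ => x + t • v) v t := by
  simpa only [one_smul] using ((hasDerivAt_id' t).smul_const v).const_add x

/-- Second-order Taylor expansion of symmetric differences. -/
lemma abs_secondDiff_sub_le {φ : Euc n → ℝ} (hφ : ContDiff ℝ ∞ φ) {C : ℝ≥0}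
    (hC : LipschitzWith C (fderiv ℝ (fderiv ℝ φ))) {v : Euc n} (hv : ‖v‖ = 1) {ε : ℝ}
    (hε : 0 ≤ ε) (x : Euc n) : |φ (x + ε • v) + φ (x - ε • v) - 2 * φ x
      - ε ^ 2 * fderiv ℝ (fderiv ℝ φ) x v v| ≤ 2 * C * ε ^ 3 := by
  have hφ1 : ContDiff ℝ ∞ (fderiv ℝ φ) := hφ.fderiv_right (m := ∞) (by exact_mod_cast le_top)
  have hd1 : ∀ y, HasFDerivAt φ (fderiv ℝ φ y) y := fun y =>
    (hφ.differentiable (by simp) y).hasFDerivAt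
  have hd2 : ∀ y, HasFDerivAt (fderiv ℝ φ) (fderiv ℝ (fderiv ℝ φ) y) y := fun y =>
    (hφ1.differentiable (by simp) y).hasFDerivAt
  have hl : ∀ t : ℝ, |fderiv ℝ (fderiv ℝ φ) (x + t • v) v v
      - fderiv ℝ (fderiv ℝ φ) (x + (0 : ℝ) • v) v v| ≤ C * |t| := by
    intro t
    have := hC.dist_le_mul (x + t • v) (x + (0 : ℝ) • v)
    rw [dist_eq_norm, dist_eq_norm, add_sub_add_left_eq_sub, zero_smul, sub_zero, norm_smul, hv,
      mul_one] at this
    have h3 := ((fderiv ℝ (fderiv ℝ φ) (x + t • v)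
      - fderiv ℝ (fderiv ℝ φ) (x + (0 : ℝ) • v)) v).le_opNorm v
    have h4 := (fderiv ℝ (fderiv ℝ φ) (x + t • v)
      - fderiv ℝ (fderiv ℝ φ) (x + (0 : ℝ) • v)).le_opNorm v
    rw [hv, mul_one] at h3 h4
    rw [zero_smul] at h3 h4 ⊢
    exact h3.trans (h4.trans this)
  have h1 : ∀ t : ℝ, HasDerivAt (fun t : ℝ => φ (x + t • v)) (fderiv ℝ φ (x + t • v) v) t :=
    fun t => (hd1 _).comp_hasDerivAt t (hasDerivAt_add_smul x v t)
  have h2 : ∀ t : ℝ, HasDerivAt (fun t : ℝ => fderiv ℝ φ (x + t • v) v)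
      (fderiv ℝ (fderiv ℝ φ) (x + t • v) v v) t := by
    intro t
    have h := (hd2 (x + t • v)).comp_hasDerivAt t (hasDerivAt_add_smul x v t)
    have := h.clm_apply (hasDerivAt_const t v)
    rw [map_zero, add_zero] at this
    exact this
  have := abs_secondDiff_sub_le_real C.2 hε h1 h2 hl
  rw [zero_smul, add_zero, neg_smul, ← sub_eq_add_neg] at this
  exact this

lemma nbMean_sub_sub_eq [NeZero n] (φ : Euc n → ℝ) (ε : ℝ) (x : Euc n) :
    nbMean ε φ x - φ x - ε ^ 2 / (2 * n) * lapl φ x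
      = (∑ i, (φ (x + ε • stdVec i) + φ (x - ε • stdVec i) - 2 * φ x
      - ε ^ 2 * fderiv ℝ (fderiv ℝ φ) x (stdVec i) (stdVec i))) / (2 * n) := by
  have hn := natCast_pos_of_neZero (n := n)
  rw [lapl_eq_sum_fderiv, Finset.sum_sub_distrib, Finset.sum_sub_distrib, nbMean,
    Finset.sum_const, ← Finset.mul_sum]
  simp only [Finset.card_univ, Fintype.card_fin, nsmul_eq_mul]
  generalize (∑ i : Fin n, (φ (x + ε • stdVec i) + φ (x - ε • stdVec i))) = a
  generalize ∑ i : Fin n, fderiv ℝ (fderiv ℝ φ) x (stdVec i) (stdVec i) = b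
  field_simp

lemma exists_lipschitz_hessian {φ : Euc n → ℝ} (hφ : ContDiff ℝ ∞ φ)
    (hs : HasCompactSupport φ) : ∃ C, LipschitzWith C (fderiv ℝ (fderiv ℝ φ)) := by
  have hφ1 : ContDiff ℝ ∞ (fderiv ℝ φ) := hφ.fderiv_right (m := ∞) (by exact_mod_cast le_top)
  have hφ2 : ContDiff ℝ ∞ (fderiv ℝ (fderiv ℝ φ)) :=
    hφ1.fderiv_right (m := ∞) (by exact_mod_cast le_top)
  exact hφ2.lipschitzWith_of_hasCompactSupport ((hs.fderiv ℝ).fderiv ℝ) (by simp)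

/-- The discrete Laplacian converges uniformly on smooth functions. -/
lemma exists_nbMean_taylor [NeZero n] {φ : Euc n → ℝ} (hφ : ContDiff ℝ ∞ φ)
    (hs : HasCompactSupport φ) : ∃ C, 0 ≤ C ∧ ∀ ε, 0 ≤ ε → ∀ x,
      |nbMean ε φ x - φ x - ε ^ 2 / (2 * n) * lapl φ x| ≤ C * ε ^ 3 := by
  have hn := natCast_pos_of_neZero (n := n)
  obtain ⟨C, hC⟩ := exists_lipschitz_hessian hφ hs
  refine ⟨C, C.2, fun ε hε x => ?_⟩
  rw [nbMean_sub_sub_eq, abs_div, abs_of_pos (a := (2 : ℝ) * n) (by linarith),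
    div_le_iff₀ (by linarith)]
  refine (Finset.abs_sum_le_sum_abs _ _).trans ((Finset.sum_le_sum fun i _ =>
    abs_secondDiff_sub_le hφ hC (by simp) hε x).trans_eq ?_)
  rw [Finset.sum_const, Finset.card_univ, Fintype.card_fin, nsmul_eq_mul]
  ring

lemma integrable_of_bounded_supp {u : Euc n → ℝ} (hm : Measurable u) {B R : ℝ}
    (hB : ∀ x, |u x| ≤ B) (hs : ∀ x, x ∉ closedBall (0 : Euc n) R → u x = 0) : Integrable u := by
  have : IntegrableOn u (closedBall 0 R) :=
    Measure.integrableOn_of_bounded (M := B) measure_closedBall_lt_top.ne hm.aestronglyMeasurable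
      (Eventually.of_forall hB)
  exact (integrableOn_iff_integrable_of_support_subset fun x hx => by
    by_contra h; exact hx (hs x h)).1 this

lemma exists_abs_le_of_hasCompactSupport {φ : Euc n → ℝ} (hφ : Continuous φ)
    (hc : HasCompactSupport φ) : ∃ C, 0 ≤ C ∧ ∀ x, |φ x| ≤ C := by
  obtain ⟨C, hC⟩ := hc.exists_bound_of_continuous hφ
  exact ⟨C, (norm_nonneg _).trans (hC 0), hC⟩

lemma integral_mul_nbMean [NeZero n] {u φ : Euc n → ℝ} (hu : Integrable u) (hφ : Continuous φ)
    (hc : HasCompactSupport φ) (ε : ℝ) :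
    ∫ x, u x * nbMean ε φ x = ∫ x, nbMean ε u x * φ x := by
  obtain ⟨C, hC0, hC⟩ := exists_abs_le_of_hasCompactSupport hφ hc
  have i1 : ∀ τ : Euc n, Integrable fun x => u x * φ (x + τ) := fun τ =>
    hu.mul_bdd (c := C) (hφ.comp (by fun_prop)).aestronglyMeasurable
      (Eventually.of_forall fun x => hC _)
  have i2 : ∀ τ : Euc n, Integrable fun x => u (x + τ) * φ x := fun τ =>
    (hu.comp_add_right τ).mul_bdd (c := C) hφ.aestronglyMeasurable
      (Eventually.of_forall fun x => hC _)
  have key : ∀ τ : Euc n, ∫ x, u x * φ (x + τ) = ∫ x, u (x - τ) * φ x := fun τ => by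
    rw [← integral_add_right_eq_self (fun x => u (x - τ) * φ x) τ]
    simp
  have i1' : ∀ τ : Euc n, Integrable fun x => u x * φ (x - τ) := fun τ => by
    simpa [sub_eq_add_neg] using i1 (-τ)
  have i2' : ∀ τ : Euc n, Integrable fun x => u (x - τ) * φ x := fun τ => by
    simpa [sub_eq_add_neg] using i2 (-τ)
  have key' : ∀ τ : Euc n, ∫ x, u x * φ (x - τ) = ∫ x, u (x + τ) * φ x := fun τ => by
    simpa [sub_eq_add_neg] using key (-τ)
  have e1 : ∀ x, u x * nbMean ε φ x = (∑ i, (u x * φ (x + ε • stdVec i)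
      + u x * φ (x - ε • stdVec i))) / (2 * n) := fun x => by
    rw [nbMean, mul_div_assoc', Finset.mul_sum]
    simp only [mul_add]
  have e2 : ∀ x, nbMean ε u x * φ x = (∑ i, (u (x + ε • stdVec i) * φ x
      + u (x - ε • stdVec i) * φ x)) / (2 * n) := fun x => by
    rw [nbMean, div_mul_eq_mul_div, Finset.sum_mul]
    simp only [add_mul]
  simp only [e1, e2]
  rw [integral_div, integral_div, integral_finsetSum, integral_finsetSum]
  · congr 1
    refine Finset.sum_congr rfl fun i _ => ?_
    rw [integral_add (i1 _) (i1' _), integral_add (i2 _) (i2' _), key, key', add_comm]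
  · exact fun i _ => (i2 _).add (i2' _)
  · exact fun i _ => (i1 _).add (i1' _)

/-- The discrete solutions solve the continuous problem up to an error of order `ε`. -/
lemma exists_discrete_weak [NeZero n] {Ω : Set (Euc n)} {R B : ℝ} (hb : Ω ⊆ closedBall 0 R)
    (hR : 0 ≤ R) (hB : 0 ≤ B) {φ : Euc n → ℝ} (hφ : ContDiff ℝ ∞ φ) (hc : HasCompactSupport φ)
    (hs : tsupport φ ⊆ Ω) :
    ∃ K, ∀ ε, 0 < ε → ∀ u : Euc n → ℝ, Measurable u → (∀ x, |u x| ≤ B) → (∀ x ∉ Ω, u x = 0) →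
      (∀ x ∈ Ω, u x = nbMean ε u x + ε ^ 2 / n) →
      |(∫ x, u x * lapl φ x) + 2 * ∫ x, φ x| ≤ K * ε := by
  have hn := natCast_pos_of_neZero (n := n)
  obtain ⟨C, hC0, hC⟩ := exists_nbMean_taylor hφ hc
  refine ⟨2 * n * (B * C * (R ^ n * ballVol n)), fun ε hε u hm hbd h0 heq => ?_⟩
  have hu : Integrable u := integrable_of_bounded_supp hm hbd fun x hx => h0 x fun h => hx (hb h)
  have hmul : ∀ ψ : Euc n → ℝ, Continuous ψ → HasCompactSupport ψ →
      Integrable fun x => u x * ψ x := fun ψ h1 h2 => by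
    obtain ⟨c, _, hc'⟩ := exists_abs_le_of_hasCompactSupport h1 h2
    exact hu.mul_bdd (c := c) h1.aestronglyMeasurable (Eventually.of_forall hc')
  have hφb := exists_abs_le_of_hasCompactSupport hφ.continuous hc
  have i1 := hmul φ hφ.continuous hc
  have i2 := hmul (lapl φ) (lapl_contDiff hφ).continuous hc.lapl
  have i3 : Integrable fun x => u x * nbMean ε φ x := by
    obtain ⟨c, _, hc'⟩ := hφb
    have h1 : Continuous (nbMean ε φ) := by
      have := hφ.continuous
      unfold nbMean
      fun_prop
    refine hu.mul_bdd (c := c) h1.aestronglyMeasurable (Eventually.of_forall fun x => ?_)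
    have a1 := nbMean_mono (ε := ε) (v := φ) (w := fun _ => c) (x := x)
      (fun i => (abs_le.1 (hc' _)).2) (fun i => (abs_le.1 (hc' _)).2)
    have a2 := nbMean_mono (ε := ε) (v := fun _ => -c) (w := φ) (x := x)
      (fun i => (abs_le.1 (hc' _)).1) (fun i => (abs_le.1 (hc' _)).1)
    have a3 : ∀ d : ℝ, nbMean ε (fun _ => d) x = d := fun d => by
      simp only [nbMean, Finset.sum_const, Finset.card_univ, Fintype.card_fin, nsmul_eq_mul]
      field_simp
      ring
    rw [a3] at a1 a2
    exact abs_le.2 ⟨a2, a1⟩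
  have e1 : (∫ x, u x * nbMean ε φ x) - ∫ x, u x * φ x = - (ε ^ 2 / n * ∫ x, φ x) := by
    rw [integral_mul_nbMean hu hφ.continuous hc, ← integral_const_mul, ← integral_neg,
      sub_eq_iff_eq_add, ← integral_add _ i1]
    · refine integral_congr_ae (Eventually.of_forall fun x => ?_)
      by_cases hx : x ∈ Ω
      · simp only; rw [heq x hx]; ring
      · have : φ x = 0 := image_eq_zero_of_notMem_tsupport fun h => hx (hs h)
        simp [this]
    · exact ((hφ.continuous.integrable_of_hasCompactSupport hc).const_mul _).neg
  have e2 : ∫ x, u x * (nbMean ε φ x - φ x - ε ^ 2 / (2 * n) * lapl φ x)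
      = - (ε ^ 2 / n * ∫ x, φ x) - ε ^ 2 / (2 * n) * ∫ x, u x * lapl φ x := by
    rw [← e1, ← integral_sub i3 i1, ← integral_const_mul, ← integral_sub (by exact i3.sub i1)
      (by exact i2.const_mul _)]
    refine integral_congr_ae (Eventually.of_forall fun x => ?_)
    simp only
    ring
  have e3 := abs_integral_le_of_supp (f := fun x => u x * (nbMean ε φ x - φ x
      - ε ^ 2 / (2 * n) * lapl φ x)) (a := 0) (C := B * (C * ε ^ 3)) hR
    (fun x hx => by rw [h0 x fun h => hx (hb h), zero_mul])
    (fun x _ => by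
      rw [abs_mul]
      exact mul_le_mul (hbd x) (hC ε hε.le x) (abs_nonneg _) hB)
  rw [e2] at e3
  have e4 : - (ε ^ 2 / n * ∫ x, φ x) - ε ^ 2 / (2 * n) * ∫ x, u x * lapl φ x
      = - (ε ^ 2 / (2 * n)) * ((∫ x, u x * lapl φ x) + 2 * ∫ x, φ x) := by
    field_simp
    ring
  rw [e4, abs_mul, abs_neg, abs_of_pos (by positivity : 0 < ε ^ 2 / (2 * n))] at e3
  have h5 : 0 < ε ^ 2 / (2 * n) := by positivity
  refine le_of_mul_le_mul_left (e3.trans_eq ?_) h5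
  field_simp

/-- Distributional torsion functions which are continuous are classical in the interior. -/
lemma smooth_of_weak_torsion [NeZero n] {Ω : Set (Euc n)} (hΩ : IsOpen Ω) {u : Euc n → ℝ}
    (hu : Continuous u) (h : ∀ φ : Euc n → ℝ, ContDiff ℝ ∞ φ → HasCompactSupport φ →
      tsupport φ ⊆ Ω → ∫ x, u x * lapl φ x = -2 * ∫ x, φ x) :
    ContDiffOn ℝ ∞ u Ω ∧ ∀ x ∈ Ω, lapl u x = -2 := by
  have hn := natCast_pos_of_neZero (n := n)
  have hq : ContDiff ℝ ∞ fun x : Euc n => (n : ℝ)⁻¹ * ‖x‖ ^ 2 :=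
    contDiff_const.mul (contDiff_norm_sq ℝ)
  have hql : ∀ x, lapl (fun x : Euc n => (n : ℝ)⁻¹ * ‖x‖ ^ 2) x = 2 := fun x => by
    rw [lapl_const_mul _ (contDiff_norm_sq ℝ).contDiffAt, lapl_norm_sq]
    field_simp
  let w : Euc n → ℝ := fun x => u x + (n : ℝ)⁻¹ * ‖x‖ ^ 2
  have hw : Continuous w := hu.add hq.continuous
  have hwh : WeaklyHarmonic Ω w := by
    intro φ hφ hc hs
    have i : ∀ v : Euc n → ℝ, Continuous v → Integrable fun x => v x * lapl φ x := fun v hv =>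
      (hv.mul (lapl_contDiff hφ).continuous).integrable_of_hasCompactSupport hc.lapl.mul_left
    simp only [w, add_mul]
    rw [integral_add (i _ hu) (i _ hq.continuous), h φ hφ hc hs,
      integral_mul_lapl_eq isOpen_univ (hq.contDiffOn.of_le two_le_infty) hφ hc (subset_univ _)]
    simp only [hql]
    rw [integral_const_mul]
    ring
  have h1 := hwh.contDiffOn hΩ hw
  have h2 := hwh.lapl_eq_zero hΩ hw
  have e : u = fun x => w x - (n : ℝ)⁻¹ * ‖x‖ ^ 2 := by funext x; simp [w]
  refine ⟨by rw [e]; exact h1.sub hq.contDiffOn, fun x hx => ?_⟩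
  rw [e, lapl_sub ((h1.contDiffAt (hΩ.mem_nhds hx)).of_le two_le_infty)
    (hq.contDiffAt.of_le two_le_infty), h2 x hx, hql]
  norm_num

/-- Existence of the torsion function, with a Lipschitz bound. -/
lemma exists_torsionFunction [NeZero n] {Ω : Set (Euc n)} {R : ℝ} (hR : 0 ≤ R)
    (hΩ : IsOpen Ω) (hc : Convex ℝ Ω) (hb : Ω ⊆ closedBall 0 R) :
    ∃ u : Euc n → ℝ, IsTorsionFunction Ω u ∧ (∀ x, 0 ≤ u x) ∧ (∀ x ∉ Ω, u x = 0) ∧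
      ∀ x y, |u x - u y| ≤ 2 * R * ‖x - y‖ := by
  let ε : ℕ → ℝ := fun m => 1 / ((m : ℝ) + 1)
  have hε0 : ∀ m, 0 < ε m := fun m => by positivity
  have hε1 : ∀ m, ε m ≤ 1 := fun m => by
    rw [div_le_one (by positivity)]
    have : (0 : ℝ) ≤ m := by positivity
    linarith
  have hεt : Tendsto ε (hyperfilter ℕ) (𝓝 0) :=
    (tendsto_one_div_add_atTop_nhds_zero_nat (𝕜 := ℝ)).mono_left
      (hyperfilter_le_cofinite.trans_eq Nat.cofinite_eq_atTop)
  choose u hum hu0 huo hueq hul using fun m =>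
    exists_discrete_solution (hε0 m).le hR hΩ hc hb
  obtain ⟨y, hy⟩ : ∃ y, y ∉ Ω := by
    by_contra! h
    have := hb (h ((R + 1) • stdVec 0))
    rw [mem_closedBall, dist_zero_right, norm_smul, PiLp.norm_single,
      Real.norm_of_nonneg (by positivity)] at this
    simp at this
    linarith
  let B : ℝ := (2 * R + 2) * (R + ‖y‖ + 1)
  have hB0 : 0 ≤ B := by positivity
  have huB : ∀ m x, |u m x| ≤ B := by
    intro m x
    rw [abs_of_nonneg (hu0 m x)]
    by_cases hx : x ∈ Ω
    · have h1 := hul m x y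
      rw [huo m y hy, sub_zero] at h1
      refine h1.trans (mul_le_mul (by linarith [hε1 m]) ?_ (by have := hε0 m; positivity)
        (by positivity))
      have h2 : ‖x‖ ≤ R := by simpa using hb hx
      linarith [norm_sub_le x y, hε1 m]
    · rw [huo m x hx]; exact hB0
  have hlim : ∀ x, ∃ l, Tendsto (fun m => u m x) (hyperfilter ℕ) (𝓝 l) := by
    intro x
    obtain ⟨l, _, hl⟩ := (isCompact_Icc (a := -B) (b := B)).ultrafilter_le_nhds
      (Ultrafilter.map (fun m : ℕ => u m x) (hyperfilter ℕ))
      (le_principal_iff.2 <| Ultrafilter.mem_coe.2 <| Ultrafilter.mem_map.2 (Eventually.of_forall fun m : ℕ => abs_le.1 (huB m x)))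
    exact ⟨l, hl⟩
  choose v hv using hlim
  have hv0 : ∀ x, 0 ≤ v x := fun x => ge_of_tendsto' (hv x) fun m => hu0 m x
  have hvo : ∀ x ∉ Ω, v x = 0 := fun x hx => by
    refine tendsto_nhds_unique (hv x) ?_
    simp [huo _ x hx]
  have hvl : ∀ x y, v x - v y ≤ 2 * R * ‖x - y‖ := by
    intro x y
    have h1 : Tendsto (fun m => (2 * R + 2 * ε m) * (‖x - y‖ + ε m)) (hyperfilter ℕ)
        (𝓝 ((2 * R + 2 * 0) * (‖x - y‖ + 0))) :=
      ((hεt.const_mul 2).const_add _).mul (hεt.const_add _)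
    have := le_of_tendsto_of_tendsto' ((hv x).sub (hv y)) h1 fun m => hul m x y
    simpa using this
  have hvL : ∀ x y, |v x - v y| ≤ 2 * R * ‖x - y‖ := fun x y =>
    abs_le.2 ⟨by have := hvl y x; rw [norm_sub_rev] at this; linarith, hvl x y⟩
  have hvc : Continuous v := by
    refine (LipschitzWith.of_dist_le_mul (K := ⟨2 * R, by positivity⟩) fun x y => ?_).continuous
    rw [Real.dist_eq, dist_eq_norm]; exact hvL x y
  have hunif : ∀ δ > 0, ∀ᶠ m in (hyperfilter ℕ : Filter ℕ), ∀ x, |u m x - v x| ≤ δ := by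
    intro δ hδ
    set s : ℝ := δ / (4 * (2 * R + 2)) with hs_def
    have hs : 0 < s := by positivity
    obtain ⟨t, -, htf, ht⟩ := (isCompact_closedBall (0 : Euc n) R).finite_cover_balls hs
    have h1 : ∀ᶠ m in (hyperfilter ℕ : Filter ℕ), ∀ z ∈ t, |u m z - v z| < δ / 4 := by
      rw [eventually_all_finite htf]
      intro z _
      have := (hv z).eventually (Metric.ball_mem_nhds _ (by positivity : 0 < δ / 4))
      simpa [Real.dist_eq] using this
    have h2 : ∀ᶠ m in (hyperfilter ℕ : Filter ℕ), ε m < s :=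
      hεt.eventually (Iio_mem_nhds hs)
    filter_upwards [h1, h2] with m hm1 hm2 x
    by_cases hx : x ∈ Ω
    swap
    · rw [huo m x hx, hvo x hx]; simpa using hδ.le
    obtain ⟨z, hz, hxz⟩ := mem_iUnion₂.1 (ht (hb hx))
    rw [mem_ball, dist_eq_norm] at hxz
    have hA : (2 * R + 2) * s = δ / 4 := by rw [hs_def]; field_simp
    have a1 : ∀ a b : Euc n, ‖a - b‖ < s → u m a - u m b ≤ δ / 2 := by
      intro a b hab
      refine (hul m a b).trans ?_
      have : (2 * R + 2 * ε m) * (‖a - b‖ + ε m) ≤ (2 * R + 2) * (s + s) :=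
        mul_le_mul (by linarith [hε1 m]) (by linarith) (by have := hε0 m; positivity)
          (by positivity)
      linarith
    have a2 : |v x - v z| ≤ δ / 4 := by
      refine (hvL x z).trans ?_
      have : 2 * R * ‖x - z‖ ≤ (2 * R + 2) * s :=
        mul_le_mul (by linarith) hxz.le (norm_nonneg _) (by positivity)
      linarith
    have a3 := a1 x z hxz
    have a4 := a1 z x (by rwa [norm_sub_rev])
    have a5 := abs_lt.1 (hm1 z hz)
    have a6 := abs_le.1 a2
    rw [abs_le]
    constructor <;> linarith
  have hweak : ∀ φ : Euc n → ℝ, ContDiff ℝ ∞ φ → HasCompactSupport φ →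
      tsupport φ ⊆ Ω → ∫ x, v x * lapl φ x = -2 * ∫ x, φ x := by
    intro φ hφ hcφ hs
    obtain ⟨K, hK⟩ := exists_discrete_weak hb hR hB0 hφ hcφ hs
    have hL := (lapl_contDiff hφ).continuous
    have hLi : Integrable (lapl φ) := hL.integrable_of_hasCompactSupport hcφ.lapl
    have h1 : Tendsto (fun m => ∫ x, u m x * lapl φ x) (hyperfilter ℕ)
        (𝓝 (∫ x, v x * lapl φ x)) := by
      rw [Metric.tendsto_nhds]
      intro δ hδ
      set I := ∫ x, |lapl φ x|
      have hI : 0 ≤ I := integral_nonneg fun x => abs_nonneg _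
      filter_upwards [hunif (δ / (2 * (I + 1))) (by positivity)] with m hm
      have i1 : Integrable fun x => u m x * lapl φ x :=
        hLi.bdd_mul (c := B) (hum m).aestronglyMeasurable (Eventually.of_forall (huB m))
      have i2 : Integrable fun x => v x * lapl φ x :=
        (hvc.mul hL).integrable_of_hasCompactSupport hcφ.lapl.mul_left
      rw [Real.dist_eq, ← integral_sub i1 i2]
      have h6 : |∫ x, (u m x * lapl φ x - v x * lapl φ x)| ≤ ∫ x, δ / (2 * (I + 1)) * |lapl φ x| :=
        norm_integral_le_of_norm_le (f := fun x => u m x * lapl φ x - v x * lapl φ x)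
          (hLi.abs.const_mul (δ / (2 * (I + 1)))) (Eventually.of_forall fun x => by
            rw [← sub_mul, Real.norm_eq_abs, abs_mul]
            exact mul_le_mul_of_nonneg_right (hm x) (abs_nonneg _))
      rw [integral_const_mul] at h6
      refine h6.trans_lt ?_
      rw [div_mul_eq_mul_div, div_lt_iff₀ (by positivity)]
      nlinarith
    have h2 : Tendsto (fun m => K * ε m) (hyperfilter ℕ) (𝓝 0) := by
      simpa using hεt.const_mul K
    have h3 := squeeze_zero_norm (f := fun m => (∫ x, u m x * lapl φ x) + 2 * ∫ x, φ x) (fun m =>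
      hK (ε m) (hε0 m) (u m) (hum m) (huB m) (huo m) (hueq m)) h2
    have h4 := tendsto_nhds_unique h3 (h1.add_const _)
    linarith
  obtain ⟨hsm, hlap⟩ := smooth_of_weak_torsion hΩ hvc hweak
  refine ⟨v, ⟨hvc.continuousOn, hsm, hlap, fun x hx => hvo x ?_⟩, hv0, hvo, hvL⟩
  rw [hΩ.frontier_eq] at hx
  exact hx.2

lemma IsTorsionFunction.unique [NeZero n] {Ω : Set (Euc n)} (hΩ : IsOpen Ω) (hb : IsBounded Ω)
    {u v : Euc n → ℝ} (hu : IsTorsionFunction Ω u) (hv : IsTorsionFunction Ω v) :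
    EqOn u v (closure Ω) := by
  have key : ∀ u v : Euc n → ℝ, IsTorsionFunction Ω u → IsTorsionFunction Ω v →
      ∀ x ∈ closure Ω, u x - v x ≤ 0 := by
    intro u v hu hv
    have h1 : ContDiffOn ℝ 2 u Ω := hu.smooth.of_le two_le_infty
    have h2 : ContDiffOn ℝ 2 v Ω := hv.smooth.of_le two_le_infty
    refine le_zero_of_lapl_nonneg hΩ hb (hu.continuousOn.sub hv.continuousOn) (h1.sub h2)
      (fun x hx => ?_) (fun x hx => ?_)
    · have := lapl_sub (h1.contDiffAt (hΩ.mem_nhds hx)) (h2.contDiffAt (hΩ.mem_nhds hx))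
      rw [hu.lapl_eq x hx, hv.lapl_eq x hx] at this
      exact (this.trans (by norm_num)).ge
    · simp [hu.boundary_zero x hx, hv.boundary_zero x hx]
  intro x hx
  linarith [key u v hu hv x hx, key v u hv hu x hx]

/-- An open convex set which lies between two balls centred at the origin. -/
structure ConvexBetween (r R : ℝ) (Ω : Set (Euc n)) : Prop where
  isOpen : IsOpen Ω
  convex : Convex ℝ Ω
  pos : 0 < r
  ball_subset : closedBall 0 r ⊆ Ω
  subset_ball : Ω ⊆ closedBall 0 R

/-- The radial projection onto the boundary of `Ω`. -/
def radProj (Ω : Set (Euc n)) (x : Euc n) : Euc n := (gauge Ω x)⁻¹ • x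

/-- The cone measure of `Ω`: the push-forward of Lebesgue measure on `Ω` under the radial
projection. -/
def coneMeasure (Ω : Set (Euc n)) : Measure (Euc n) := (volume.restrict Ω).map (radProj Ω)

lemma gauge_smul_nonneg (Ω : Set (Euc n)) {t : ℝ} (ht : 0 ≤ t) (x : Euc n) :
    gauge Ω (t • x) = t * gauge Ω x := by
  rw [gauge_smul_of_nonneg ht, smul_eq_mul]

lemma radProj_smul (Ω : Set (Euc n)) {t : ℝ} (ht : 0 < t) (x : Euc n) :
    radProj Ω (t • x) = radProj Ω x := by
  rw [radProj, radProj, gauge_smul_nonneg Ω ht.le, smul_smul, mul_inv, mul_right_comm,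
    inv_mul_cancel₀ ht.ne', one_mul]

lemma ae_ne_zero [NeZero n] (s : Set (Euc n)) : ∀ᵐ x ∂(volume.restrict s), x ≠ (0 : Euc n) :=
  ae_restrict_of_ae (by simp [ae_iff])

namespace ConvexBetween

variable {r R : ℝ} {Ω : Set (Euc n)} (h : ConvexBetween r R Ω)
include h

lemma zero_mem : (0 : Euc n) ∈ Ω := h.ball_subset (by simpa using h.pos.le)

lemma mem_nhds : Ω ∈ 𝓝 (0 : Euc n) := h.isOpen.mem_nhds h.zero_mem

lemma absorbent : Absorbent ℝ Ω := absorbent_nhds_zero h.mem_nhds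

lemma isBounded : IsBounded Ω := isBounded_closedBall.subset h.subset_ball

lemma le_radius [NeZero n] : r ≤ R := by
  have h1 := h.subset_ball (h.ball_subset (show r • stdVec (n := n) 0 ∈ closedBall 0 r by
    rw [mem_closedBall, dist_zero_right, norm_smul, PiLp.norm_single]
    simp [abs_of_pos h.pos]))
  rw [mem_closedBall, dist_zero_right, norm_smul, PiLp.norm_single] at h1
  simpa [abs_of_pos h.pos] using h1

lemma radius_pos [NeZero n] : 0 < R := h.pos.trans_le h.le_radius

lemma gauge_le (x : Euc n) : gauge Ω x ≤ ‖x‖ / r := by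
  rw [le_div_iff₀ h.pos, mul_comm]
  exact mul_gauge_le_norm (ball_subset_closedBall.trans h.ball_subset)

lemma norm_le [NeZero n] (x : Euc n) : ‖x‖ ≤ R * gauge Ω x := by
  have := le_gauge_of_subset_closedBall h.absorbent h.radius_pos.le h.subset_ball (x := x)
  rwa [div_le_iff₀' h.radius_pos] at this

lemma gauge_pos [NeZero n] {x : Euc n} (hx : x ≠ 0) : 0 < gauge Ω x := by
  have := h.norm_le x
  have h1 := norm_pos_iff.2 hx
  by_contra! h2
  nlinarith [h.radius_pos]

lemma abs_gauge_sub_le (x y : Euc n) : |gauge Ω x - gauge Ω y| ≤ ‖x - y‖ / r := by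
  have key : ∀ x y : Euc n, gauge Ω x - gauge Ω y ≤ ‖x - y‖ / r := fun x y => by
    have h1 := gauge_add_le h.convex h.absorbent (x - y) y
    rw [sub_add_cancel] at h1
    linarith [h.gauge_le (x - y)]
  rw [abs_le]
  exact ⟨by have := key y x; rw [norm_sub_rev] at this; linarith, key x y⟩

lemma mem_iff (x : Euc n) : x ∈ Ω ↔ gauge Ω x < 1 := by
  rw [gauge_lt_one_iff_mem_interior h.convex h.mem_nhds, h.isOpen.interior_eq]

lemma mem_frontier_iff (x : Euc n) : x ∈ frontier Ω ↔ gauge Ω x = 1 :=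
  (gauge_eq_one_iff_mem_frontier h.convex h.mem_nhds).symm

lemma mem_closure_iff (x : Euc n) : x ∈ closure Ω ↔ gauge Ω x ≤ 1 :=
  (gauge_le_one_iff_mem_closure h.convex h.mem_nhds).symm

lemma continuous_gauge : Continuous (gauge Ω) := _root_.continuous_gauge h.convex h.mem_nhds

lemma convexOn_gauge : ConvexOn ℝ univ (gauge Ω) := by
  refine ⟨convex_univ, fun x _ y _ a b ha hb _ => ?_⟩
  rw [smul_eq_mul, smul_eq_mul, ← gauge_smul_nonneg Ω ha, ← gauge_smul_nonneg Ω hb]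
  exact gauge_add_le h.convex h.absorbent _ _

lemma gauge_smul_radProj [NeZero n] (x : Euc n) : gauge Ω x • radProj Ω x = x := by
  rcases eq_or_ne x 0 with rfl | hx
  · simp [radProj]
  · rw [radProj, smul_smul, mul_inv_cancel₀ (h.gauge_pos hx).ne', one_smul]

lemma gauge_radProj [NeZero n] {x : Euc n} (hx : x ≠ 0) : gauge Ω (radProj Ω x) = 1 := by
  have := h.gauge_pos hx
  rw [radProj, gauge_smul_nonneg Ω (by positivity), inv_mul_cancel₀ this.ne']

lemma radProj_mem_frontier [NeZero n] {x : Euc n} (hx : x ≠ 0) : radProj Ω x ∈ frontier Ω :=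
  (h.mem_frontier_iff _).2 (h.gauge_radProj hx)

lemma radProj_of_mem_frontier {x : Euc n} (hx : x ∈ frontier Ω) : radProj Ω x = x := by
  rw [radProj, (h.mem_frontier_iff x).1 hx, inv_one, one_smul]

lemma norm_radProj_le [NeZero n] (x : Euc n) : ‖radProj Ω x‖ ≤ R := by
  rcases eq_or_ne x 0 with rfl | hx
  · simpa [radProj] using h.radius_pos.le
  · simpa [h.gauge_radProj hx] using h.norm_le (radProj Ω x)

lemma norm_sub_radProj_le [NeZero n] (x : Euc n) : ‖x - radProj Ω x‖ ≤ R * |gauge Ω x - 1| := by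
  have : x - radProj Ω x = (gauge Ω x - 1) • radProj Ω x := by
    rw [sub_smul, h.gauge_smul_radProj, one_smul]
  rw [this, norm_smul, Real.norm_eq_abs, mul_comm]
  exact mul_le_mul_of_nonneg_right (h.norm_radProj_le x) (abs_nonneg _)

lemma measurable_radProj : Measurable (radProj Ω) :=
  h.continuous_gauge.measurable.inv.smul measurable_id

lemma volume_lt_top : volume Ω < ⊤ := h.isBounded.measure_lt_top

lemma isFiniteMeasure_coneMeasure : IsFiniteMeasure (coneMeasure Ω) := by
  have : IsFiniteMeasure (volume.restrict Ω) := ⟨by simpa using h.volume_lt_top⟩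
  unfold coneMeasure
  infer_instance

lemma integral_coneMeasure {ψ : Euc n → ℝ} (hψ : AEStronglyMeasurable ψ (coneMeasure Ω)) :
    ∫ x, ψ x ∂coneMeasure Ω = ∫ x in Ω, ψ (radProj Ω x) :=
  integral_map h.measurable_radProj.aemeasurable hψ

lemma integrable_coneMeasure_iff {ψ : Euc n → ℝ}
    (hψ : AEStronglyMeasurable ψ (coneMeasure Ω)) :
    Integrable ψ (coneMeasure Ω) ↔ IntegrableOn (fun x => ψ (radProj Ω x)) Ω :=
  integrable_map_measure hψ h.measurable_radProj.aemeasurable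

lemma ae_coneMeasure_mem_frontier [NeZero n] : ∀ᵐ x ∂coneMeasure Ω, x ∈ frontier Ω := by
  rw [coneMeasure, ae_map_iff h.measurable_radProj.aemeasurable
    (p := fun x => x ∈ frontier Ω) isClosed_frontier.measurableSet]
  filter_upwards [ae_ne_zero Ω] with x hx using h.radProj_mem_frontier hx

lemma integrable_coneMeasure [NeZero n] {φ : Euc n → ℝ} (hφ : Continuous φ) :
    Integrable φ (coneMeasure Ω) := by
  have := h.isFiniteMeasure_coneMeasure
  obtain ⟨C, hC⟩ := (isCompact_closedBall (0 : Euc n) R).exists_bound_of_continuousOn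
    hφ.continuousOn
  refine Integrable.of_bound hφ.aestronglyMeasurable C ?_
  filter_upwards [h.ae_coneMeasure_mem_frontier] with x hx
  refine hC x ?_
  rw [← h.radProj_of_mem_frontier hx]
  simpa using h.norm_radProj_le x

lemma setOf_gauge_lt_eq {t : ℝ} (ht : 0 < t) : {x | gauge Ω x < t} = t • Ω := by
  ext x
  rw [mem_smul_set_iff_inv_smul_mem₀ ht.ne', h.mem_iff, gauge_smul_nonneg Ω (by positivity),
    inv_mul_lt_iff₀ ht, mul_one]
  rfl

lemma integral_gauge_lt {t : ℝ} (ht : 0 < t) (φ : Euc n → ℝ) :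
    ∫ x in {x | gauge Ω x < t}, φ x = t ^ n * ∫ x in Ω, φ (t • x) := by
  rw [h.setOf_gauge_lt_eq ht, Measure.setIntegral_comp_smul_of_pos volume φ Ω ht, smul_eq_mul,
    finrank_euclideanSpace, Fintype.card_fin, mul_inv_cancel_left₀ (by positivity)]

lemma integrableOn_gauge_lt_iff {t : ℝ} (ht : 0 < t) (φ : Euc n → ℝ) :
    IntegrableOn φ {x | gauge Ω x < t} ↔ IntegrableOn (fun x => φ (t • x)) Ω := by
  have hm : MeasurableSet {x | gauge Ω x < t} :=
    (isOpen_lt h.continuous_gauge continuous_const).measurableSet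
  rw [← integrable_indicator_iff hm, ← integrable_indicator_iff h.isOpen.measurableSet,
    ← integrable_comp_smul_iff volume _ ht.ne']
  refine integrable_congr (Eventually.of_forall fun x => ?_)
  have : gauge Ω (t • x) < t ↔ x ∈ Ω := by
    rw [h.mem_iff, gauge_smul_nonneg Ω ht.le, mul_lt_iff_lt_one_right ht]
  by_cases hx : x ∈ Ω
  · simp [hx, this.2 hx]
  · simp [hx, this]

lemma integrableOn_radProj {t : ℝ} (ht : 0 < t) {ψ : Euc n → ℝ}
    (hψ : Integrable ψ (coneMeasure Ω)) :
    IntegrableOn (fun x => ψ (radProj Ω x)) {x | gauge Ω x < t} := by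
  rw [h.integrableOn_gauge_lt_iff ht]
  simp only [radProj_smul Ω ht]
  exact (h.integrable_coneMeasure_iff hψ.1).1 hψ

lemma integral_radProj {t : ℝ} (ht : 0 < t) {ψ : Euc n → ℝ}
    (hψ : Integrable ψ (coneMeasure Ω)) :
    ∫ x in {x | gauge Ω x < t}, ψ (radProj Ω x) = t ^ n * ∫ x, ψ x ∂coneMeasure Ω := by
  rw [h.integral_gauge_lt ht, h.integral_coneMeasure hψ.1]
  simp only [radProj_smul Ω ht]

/-- Integration of a radially constant function over a shell. -/
lemma integral_shell {a b : ℝ} (ha : 0 < a) (hab : a ≤ b) {ψ : Euc n → ℝ}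
    (hψ : Integrable ψ (coneMeasure Ω)) :
    ∫ x in {x | a ≤ gauge Ω x ∧ gauge Ω x < b}, ψ (radProj Ω x)
      = (b ^ n - a ^ n) * ∫ x, ψ x ∂coneMeasure Ω := by
  have hb := ha.trans_le hab
  have e : {x | a ≤ gauge Ω x ∧ gauge Ω x < b}
      = {x | gauge Ω x < b} \ {x | gauge Ω x < a} := by
    ext x
    simp only [mem_ofPred_eq, Set.mem_sdiff, not_lt]
    exact and_comm
  rw [e, setIntegral_sdiff (isOpen_lt h.continuous_gauge continuous_const).measurableSet
    (h.integrableOn_radProj hb hψ) fun x hx => lt_of_lt_of_le hx hab,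
    h.integral_radProj ha hψ, h.integral_radProj hb hψ]
  ring

lemma coneMeasure_univ : (coneMeasure Ω).real univ = volume.real Ω := by
  rw [coneMeasure, measureReal_def, Measure.map_apply h.measurable_radProj MeasurableSet.univ]
  simp [measureReal_def]

lemma volume_real_shell {a b : ℝ} (ha : 0 < a) (hab : a ≤ b) :
    volume.real {x | a ≤ gauge Ω x ∧ gauge Ω x < b} = (b ^ n - a ^ n) * volume.real Ω := by
  have := h.isFiniteMeasure_coneMeasure
  have h1 := h.integral_shell ha hab (integrable_const (1 : ℝ))
  simpa [h.coneMeasure_univ] using h1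

/-- The divergence theorem for the radial field, in terms of the cone measure. -/
lemma integral_coneMeasure_eq [NeZero n] {φ : Euc n → ℝ} (hφ : ContDiff ℝ 1 φ) :
    n * ∫ x, φ x ∂coneMeasure Ω = ∫ x in Ω, (n * φ x + fderiv ℝ φ x x) := by
  have hR := h.radius_pos
  have hfd : Continuous (fderiv ℝ φ) := hφ.continuous_fderiv one_ne_zero
  have hdiff : Differentiable ℝ φ := hφ.differentiable one_ne_zero
  obtain ⟨M, hM⟩ := (isCompact_closedBall (0 : Euc n) (2 * R)).exists_bound_of_continuousOn
    hfd.continuousOn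
  have hM0 : 0 ≤ M := (norm_nonneg _).trans (hM 0 (by simpa using hR.le))
  have hfin : IsFiniteMeasure (volume.restrict Ω) := ⟨by simpa using h.volume_lt_top⟩
  have hintΩ : ∀ ψ : Euc n → ℝ, Continuous ψ → IntegrableOn ψ Ω := fun ψ hψ =>
    (hψ.continuousOn.integrableOn_compact (isCompact_closedBall (0 : Euc n) R)).mono_set
      h.subset_ball
  have hφV := h.integrable_coneMeasure hφ.continuous
  set I := ∫ x, φ x ∂coneMeasure Ω with hI
  let F : ℝ → ℝ := fun t => ∫ x in Ω, φ (t • x)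
  have hF : HasDerivAt F (∫ x in Ω, fderiv ℝ φ x x) 1 := by
    have := (hasDerivAt_integral_of_dominated_loc_of_deriv_le (μ := volume.restrict Ω)
      (F := fun (t : ℝ) x => φ (t • x)) (F' := fun (t : ℝ) x => fderiv ℝ φ (t • x) x)
      (x₀ := 1) (s := Ioo 0 2) (bound := fun _ => M * R)
      (Ioo_mem_nhds one_pos one_lt_two)
      (Eventually.of_forall fun t => (hφ.continuous.comp (by fun_prop)).aestronglyMeasurable)
      (hintΩ _ (hφ.continuous.comp (by fun_prop)))
      ((hfd.comp (by fun_prop)).clm_apply continuous_id).aestronglyMeasurable ?_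
      (integrable_const _) ?_).2
    · simpa only [one_smul] using this
    · filter_upwards [ae_restrict_mem h.isOpen.measurableSet] with x hx t ht
      have hx' : ‖x‖ ≤ R := by simpa using h.subset_ball hx
      refine (ContinuousLinearMap.le_opNorm _ _).trans (mul_le_mul (hM _ ?_) hx'
        (norm_nonneg _) hM0)
      rw [mem_closedBall, dist_zero_right, norm_smul, Real.norm_of_nonneg ht.1.le]
      exact mul_le_mul ht.2.le hx' (norm_nonneg _) (by norm_num)
    · refine Eventually.of_forall fun x t _ => ?_
      have h1 : HasDerivAt (fun t : ℝ => t • x) x t := by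
        simpa using (hasDerivAt_id t).smul_const x
      exact (hdiff (t • x)).hasFDerivAt.comp_hasDerivAt t h1
  let G : ℝ → ℝ := fun t => t ^ n * F t - t ^ n * I
  have hG : HasDerivAt G ((n : ℝ) * F 1 + (∫ x in Ω, fderiv ℝ φ x x) - n * I) 1 := by
    have hp : HasDerivAt (fun t : ℝ => t ^ n) (n : ℝ) 1 := by
      simpa using hasDerivAt_pow n (1 : ℝ)
    have := (hp.mul hF).sub (hp.mul_const I)
    rw [one_pow, one_mul] at this
    exact this
  have hpow : ∃ c : ℝ, 0 ≤ c ∧ ∀ t ∈ Icc (1 : ℝ) 2, t ^ n - 1 ≤ c * (t - 1) := by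
    refine ⟨n * 2 ^ n, by positivity, fun t ht => ?_⟩
    have h1 := one_add_mul_sub_le_pow (a := t⁻¹) (n := n) (by
      have := inv_pos.2 (one_pos.trans_le ht.1); linarith)
    have ht0 : 0 < t := one_pos.trans_le ht.1
    have h2 : t ^ n * (t⁻¹) ^ n = 1 := by rw [← mul_pow, mul_inv_cancel₀ ht0.ne', one_pow]
    have h3 : t ^ n ≤ 2 ^ n := pow_le_pow_left₀ ht0.le ht.2 n
    have h4 : t ^ n * (1 + n * (t⁻¹ - 1)) ≤ 1 := by
      exact (mul_le_mul_of_nonneg_left h1 (by positivity)).trans_eq h2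
    have h5 : 1 - t⁻¹ ≤ t - 1 := by
      have := inv_mul_cancel₀ ht0.ne'
      nlinarith [inv_pos.2 ht0, sq_nonneg (t - 1)]
    have h6 : 0 ≤ 1 - t⁻¹ := by
      rw [sub_nonneg]; exact inv_le_one_of_one_le₀ ht.1
    have h7 : t ^ n * (n * (1 - t⁻¹)) ≤ 2 ^ n * (n * (t - 1)) := by gcongr
    linarith
  obtain ⟨c, hc0, hc⟩ := hpow
  have hG2 : ∀ t ∈ Icc (1 : ℝ) 2, |G t - G 1| ≤ (M * R * c * volume.real Ω) * (t - 1) ^ 2 := by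
    intro t ht
    have ht0 : 0 < t := one_pos.trans_le ht.1
    set S := {x | (1 : ℝ) ≤ gauge Ω x ∧ gauge Ω x < t}
    have hS : MeasurableSet S :=
      ((isClosed_le continuous_const h.continuous_gauge).measurableSet.inter
        (isOpen_lt h.continuous_gauge continuous_const).measurableSet)
    have hSb : S ⊆ closedBall 0 (2 * R) := fun x hx => by
      rw [mem_closedBall, dist_zero_right]
      refine (h.norm_le x).trans ?_
      rw [mul_comm]
      exact mul_le_mul_of_nonneg_right (hx.2.le.trans ht.2) hR.le
    have hΩ1 : Ω = {x | gauge Ω x < 1} := by ext x; exact h.mem_iff x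
    have hts : ∀ s ∈ Icc (1 : ℝ) 2, IntegrableOn φ {x | gauge Ω x < s} := fun s hs =>
      (h.integrableOn_gauge_lt_iff (one_pos.trans_le hs.1) _).2
        (hintΩ _ (hφ.continuous.comp (by fun_prop)))
    have e1 : G t - G 1 = ∫ x in S, (φ x - φ (radProj Ω x)) := by
      have hd : S = {x | gauge Ω x < t} \ {x | gauge Ω x < 1} := by
        ext x
        simp only [S, mem_ofPred_eq, Set.mem_sdiff, not_lt]
        exact and_comm
      have i1 : IntegrableOn φ S := (hts t ht).mono_set fun x hx => hx.2
      have i2 : IntegrableOn (fun x => φ (radProj Ω x)) S :=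
        (h.integrableOn_radProj ht0 hφV).mono_set fun x hx => hx.2
      rw [integral_sub i1 i2, h.integral_shell one_pos ht.1 hφV]
      have : ∫ x in S, φ x = t ^ n * F t - 1 ^ n * F 1 := by
        rw [hd, setIntegral_sdiff (isOpen_lt h.continuous_gauge continuous_const).measurableSet
          (hts t ht) fun x hx => lt_of_lt_of_le hx ht.1, h.integral_gauge_lt ht0,
          h.integral_gauge_lt one_pos]
      rw [this]
      simp only [G, hI]
      ring
    have hvol : volume S < ⊤ :=
      (measure_mono hSb).trans_lt measure_closedBall_lt_top
    rw [e1]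
    have h8 := norm_setIntegral_le_of_norm_le_const (μ := volume) (s := S)
      (f := fun x => φ x - φ (radProj Ω x)) (C := M * (R * (t - 1))) hvol fun x hx => by
        have hp2 : radProj Ω x ∈ closedBall (0 : Euc n) (2 * R) := by
          rw [mem_closedBall, dist_zero_right]
          linarith [h.norm_radProj_le x]
        refine ((convex_closedBall (0 : Euc n) (2 * R)).norm_image_sub_le_of_norm_fderiv_le
          (fun y _ => hdiff y) hM hp2 (hSb hx)).trans ?_
        refine mul_le_mul_of_nonneg_left ((h.norm_sub_radProj_le x).trans ?_) hM0
        rw [abs_of_nonneg (sub_nonneg.2 hx.1)]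
        exact mul_le_mul_of_nonneg_left (by linarith [hx.2]) hR.le
    rw [h.volume_real_shell one_pos ht.1, one_pow] at h8
    refine h8.trans ?_
    have h9 := hc t ht
    have h10 : 0 ≤ t - 1 := sub_nonneg.2 ht.1
    have h11 : 0 ≤ volume.real Ω := measureReal_nonneg
    calc M * (R * (t - 1)) * ((t ^ n - 1) * volume.real Ω)
        ≤ M * (R * (t - 1)) * (c * (t - 1) * volume.real Ω) := by gcongr
      _ = _ := by ring
  have hG0 : HasDerivWithinAt G 0 (Ici 1) 1 := by
    rw [hasDerivWithinAt_iff_isLittleO]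
    have h1 : (fun t : ℝ => G t - G 1 - (t - 1) • (0 : ℝ)) =O[𝓝[Ici 1] 1]
        fun t => (t - 1) ^ 2 := by
      refine Asymptotics.IsBigO.of_bound (M * R * c * volume.real Ω) ?_
      have : Icc (1 : ℝ) 2 ∈ 𝓝[Ici 1] 1 := Icc_mem_nhdsGE one_lt_two
      filter_upwards [this] with t ht
      rw [smul_zero, sub_zero, Real.norm_eq_abs, Real.norm_of_nonneg (sq_nonneg _)]
      exact hG2 t ht
    refine h1.trans_isLittleO ?_
    have h2 : Tendsto (fun t : ℝ => t - 1) (𝓝[Ici 1] 1) (𝓝 0) := by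
      have : Tendsto (fun t : ℝ => t - 1) (𝓝 1) (𝓝 (1 - 1)) := (continuous_sub_right 1).tendsto 1
      rw [sub_self] at this
      exact this.mono_left nhdsWithin_le_nhds
    exact (Asymptotics.isLittleO_pow_id one_lt_two).comp_tendsto h2
  have huniq := (uniqueDiffWithinAt_Ici (1 : ℝ)).eq_deriv _ hG0 hG.hasDerivWithinAt
  rw [integral_add (by exact (hintΩ _ hφ.continuous).const_mul _)
    (by exact hintΩ _ (hfd.clm_apply continuous_id)), integral_const_mul]
  have hF1 : F 1 = ∫ x in Ω, φ x := by simp [F]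
  rw [← hF1]
  linarith

end ConvexBetween

/-- The submodule of smooth compactly supported functions. -/
def testFn (n : ℕ) : Submodule ℝ (Euc n → ℝ) where
  carrier := {φ | ContDiff ℝ ∞ φ ∧ HasCompactSupport φ}
  add_mem' h1 h2 := ⟨h1.1.add h2.1, h1.2.add h2.2⟩
  zero_mem' := ⟨contDiff_const, HasCompactSupport.zero⟩
  smul_mem' c _ h := ⟨contDiff_const.smul h.1, h.2.smul_left (f := fun _ => c)⟩

/-- A linear functional on test functions which is bounded in `L¹` has an `L²` density. -/
lemma exists_density (V : Measure (Euc n)) [IsFiniteMeasure V] (Λ : testFn n →ₗ[ℝ] ℝ) {K : ℝ}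
    (hK : ∀ φ : testFn n, |Λ φ| ≤ K * ∫ x, |φ.1 x| ∂V) :
    ∃ F : Euc n → ℝ, Measurable F ∧ MemLp F 2 V ∧ ∀ φ : testFn n, Λ φ = ∫ x, φ.1 x * F x ∂V := by
  have hmem : ∀ φ : testFn n, MemLp φ.1 2 V := fun φ =>
    φ.2.1.continuous.memLp_of_hasCompactSupport φ.2.2
  let e : testFn n →ₗ[ℝ] Lp ℝ 2 V :=
    { toFun := fun φ => (hmem φ).toLp
      map_add' := fun φ ψ => MemLp.toLp_add (hmem φ) (hmem ψ)
      map_smul' := fun c φ => MemLp.toLp_const_smul c (hmem φ) }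
  have hdense : DenseRange e := by
    refine (Lp.dense_hasCompactSupport_contDiff (F := ℝ) (μ := V) (p := 2) (by simp)).mono ?_
    rintro f ⟨g, hg, hc, hs⟩
    refine ⟨⟨g, hs, hc⟩, ?_⟩
    exact Lp.ext ((hmem ⟨g, hs, hc⟩).coeFn_toLp.trans hg.symm)
  have hb : ∀ φ : testFn n, ‖Λ φ‖ ≤ (|K| * Real.sqrt (V.real univ)) * ‖e φ‖ := by
    intro φ
    have h1 : ∫ x, |φ.1 x| ∂V ≤ Real.sqrt (V.real univ) * ‖e φ‖ := by
      refine abs_le_of_sq_le_sq' ?_ (by positivity) |>.2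
      have h2 : ‖e φ‖ ^ 2 = ∫ x, |φ.1 x| ^ 2 ∂V := by
        rw [← real_inner_self_eq_norm_sq, L2.inner_def]
        refine integral_congr_ae ?_
        filter_upwards [(hmem φ).coeFn_toLp] with x hx
        have : (e φ : Euc n → ℝ) x = φ.1 x := hx
        rw [this, real_inner_self_eq_norm_sq, Real.norm_eq_abs]
      rw [mul_pow, Real.sq_sqrt measureReal_nonneg, h2]
      have i1 : Integrable (fun x => |φ.1 x|) V :=
        (φ.2.1.continuous.integrable_of_hasCompactSupport φ.2.2).abs
      have i2 : Integrable (fun x => |φ.1 x| ^ 2) V := by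
        simpa using (hmem φ).integrable_sq
      set a := ∫ x, |φ.1 x| ∂V with ha
      set m := V.real univ with hm
      have h3 : 0 ≤ ∫ x, (m * |φ.1 x| - a) ^ 2 ∂V := integral_nonneg fun x => sq_nonneg _
      have h4 : ∫ x, (m * |φ.1 x| - a) ^ 2 ∂V
          = m ^ 2 * (∫ x, |φ.1 x| ^ 2 ∂V) - 2 * m * a * a + m * a ^ 2 := by
        have : ∀ x, (m * |φ.1 x| - a) ^ 2
            = m ^ 2 * |φ.1 x| ^ 2 - 2 * m * a * |φ.1 x| + a ^ 2 := fun x => by ring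
        simp only [this]
        rw [integral_add (by exact (i2.const_mul _).sub (i1.const_mul _)) (integrable_const _),
          integral_sub (i2.const_mul _) (i1.const_mul _), integral_const_mul, integral_const_mul,
          integral_const, smul_eq_mul]
      rw [h4] at h3
      rcases (measureReal_nonneg (μ := V) (s := univ)).eq_or_lt with h0 | h0
      · rw [← hm] at h0
        have hV : V = 0 := by
          rw [← Measure.measure_univ_eq_zero]
          exact (measureReal_eq_zero_iff).1 h0.symm
        have : a = 0 := by rw [ha, hV, integral_zero_measure]
        rw [this, ← h0]; simp
      · rw [← hm] at h0
        have : 0 ≤ m * (m * (∫ x, |φ.1 x| ^ 2 ∂V) - a ^ 2) := by linarith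
        have := nonneg_of_mul_nonneg_right this h0
        linarith
    rw [Real.norm_eq_abs, mul_assoc]
    exact (hK φ).trans (mul_le_mul (le_abs_self K) h1 (integral_nonneg fun x => abs_nonneg _)
      (abs_nonneg K))
  let T := Λ.extendOfNorm e
  have hT : ∀ φ, T (e φ) = Λ φ := LinearMap.extendOfNorm_eq hdense ⟨_, hb⟩
  let G : Lp ℝ 2 V := (InnerProductSpace.toDual ℝ (Lp ℝ 2 V)).symm T
  have hGm := Lp.aestronglyMeasurable G
  refine ⟨hGm.mk G, hGm.stronglyMeasurable_mk.measurable, (Lp.memLp G).ae_eq hGm.ae_eq_mk,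
    fun φ => ?_⟩
  have h5 : ⟪G, e φ⟫ = Λ φ := by rw [← hT, InnerProductSpace.toDual_symm_apply]
  rw [← h5, L2.inner_def]
  refine integral_congr_ae ?_
  filter_upwards [(hmem φ).coeFn_toLp, hGm.ae_eq_mk] with x hx hx2
  have h6 : (e φ : Euc n → ℝ) x = φ.1 x := hx
  rw [h6, hx2]
  rfl

/-- The torsion function of `Ω`, extended by zero, with Lipschitz constant `L`. -/
structure IsLipTorsion (L : ℝ) (Ω : Set (Euc n)) (u : Euc n → ℝ) : Prop where
  torsion : IsTorsionFunction Ω u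
  nonneg : ∀ x, 0 ≤ u x
  zero_outside : ∀ x ∉ Ω, u x = 0
  lip : ∀ x y, |u x - u y| ≤ L * ‖x - y‖

lemma ConvexBetween.exists_isLipTorsion [NeZero n] {r R : ℝ} {Ω : Set (Euc n)}
    (h : ConvexBetween r R Ω) : ∃ u, IsLipTorsion (2 * R) Ω u := by
  obtain ⟨u, h1, h2, h3, h4⟩ :=
    exists_torsionFunction h.radius_pos.le h.isOpen h.convex h.subset_ball
  exact ⟨u, h1, h2, h3, h4⟩

lemma exists_avg_norm_sq [NeZero n] {ε : ℝ} (hε : 0 < ε) :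
    ∃ c, ∀ y : Euc n, avg ε (fun z => ‖z‖ ^ 2) y = ‖y‖ ^ 2 + c := by
  have hc := avKer_hasCompactSupport (n := n) hε
  have hk := (avKer_contDiff (n := n) ε).continuous
  have i : ∀ f : Euc n → ℝ, Continuous f → Integrable fun s => f s * avKer ε s := fun f hf =>
    (hf.mul hk).integrable_of_hasCompactSupport hc.mul_left
  refine ⟨∫ s : Euc n, ‖s‖ ^ 2 * avKer ε s, fun y => ?_⟩
  have e1 : avg ε (fun z => ‖z‖ ^ 2) y = ∫ s, ‖y - s‖ ^ 2 * avKer ε s := by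
    rw [avg, ← integral_sub_left_eq_self (fun s => ‖y - s‖ ^ 2 * avKer ε s) volume y]
    simp
  have e2 : ∀ s, ‖y - s‖ ^ 2 * avKer ε s
      = (‖y‖ ^ 2 * avKer ε s - 2 * (⟪y, s⟫ * avKer ε s)) + ‖s‖ ^ 2 * avKer ε s := fun s => by
    rw [norm_sub_sq_real]; ring
  have e3 : ∫ s, ⟪y, s⟫ * avKer ε s = 0 := by
    have := integral_neg_eq_self (fun s => ⟪y, s⟫ * avKer ε s) volume
    simp only [inner_neg_right, avKer_neg, neg_mul, integral_neg] at this
    linarith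
  have i1 := i (fun _ => ‖y‖ ^ 2) continuous_const
  have i2 := (i (fun s => ⟪y, s⟫) (by fun_prop)).const_mul 2
  have i3 := i (fun s => ‖s‖ ^ 2) (by fun_prop)
  rw [e1]
  simp only [e2]
  rw [integral_add (by exact i1.sub i2) i3, integral_sub i1 i2, integral_const_mul,
    integral_const_mul, e3, avKer_integral hε]
  ring

lemma avg_translate (ε c : ℝ) [NeZero n] (hε : 0 < ε) {w : Euc n → ℝ} (hw : Continuous w)
    (y a : Euc n) : avg ε (fun z => w (y + z) - c) a = avg ε w (y + a) - c := by
  simp only [avg, sub_mul]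
  have e1 : ∫ z, w (y + z) * avKer ε (a - z) = ∫ z, w z * avKer ε (y + a - z) := by
    rw [← integral_add_left_eq_self (fun z => w z * avKer ε (y + a - z)) y]
    simp
  have i1 : Integrable fun z => w (y + z) * avKer ε (a - z) :=
    avg_integrable hε (w := fun z => w (y + z)) (by fun_prop) a
  have i2 : Integrable fun z : Euc n => c * avKer ε (a - z) :=
    avg_integrable hε (w := fun _ => c) continuous_const a
  rw [integral_sub i1 i2, e1, integral_const_mul, avKer_shift_integral hε, mul_one]

namespace IsLipTorsion

variable {L : ℝ} {Ω : Set (Euc n)} {u : Euc n → ℝ} (hu : IsLipTorsion L Ω u)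
include hu

lemma lip_nonneg [NeZero n] : 0 ≤ L := by
  have := (abs_nonneg _).trans (hu.lip (stdVec 0) 0)
  rwa [sub_zero, PiLp.norm_single, norm_one, mul_one] at this

lemma continuous [NeZero n] : Continuous u := by
  refine (LipschitzWith.of_dist_le_mul (K := ⟨L, hu.lip_nonneg⟩) fun x y => ?_).continuous
  rw [Real.dist_eq, dist_eq_norm]
  exact hu.lip x y

lemma integral_mul_lapl (hΩ : IsOpen Ω) {φ : Euc n → ℝ} (hφ : ContDiff ℝ ∞ φ)
    (hc : HasCompactSupport φ) (hs : tsupport φ ⊆ Ω) : ∫ x, u x * lapl φ x = -2 * ∫ x, φ x := by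
  rw [integral_mul_lapl_eq hΩ (hu.torsion.smooth.of_le two_le_infty) hφ hc hs,
    ← integral_const_mul]
  refine integral_congr_ae (Eventually.of_forall fun x => ?_)
  simp only
  by_cases hx : x ∈ Ω
  · rw [hu.torsion.lapl_eq x hx]
  · rw [image_eq_zero_of_notMem_tsupport fun h => hx (hs h), mul_zero, mul_zero]

lemma weaklyHarmonic_add [NeZero n] (hΩ : IsOpen Ω) :
    WeaklyHarmonic Ω fun x => u x + (n : ℝ)⁻¹ * ‖x‖ ^ 2 := by
  have hn := natCast_pos_of_neZero (n := n)
  intro φ hφ hc hs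
  have hq : ContDiff ℝ ∞ fun x : Euc n => ‖x‖ ^ 2 := contDiff_norm_sq ℝ
  have i : ∀ v : Euc n → ℝ, Continuous v → Integrable fun x => v x * lapl φ x := fun v hv =>
    (hv.mul (lapl_contDiff hφ).continuous).integrable_of_hasCompactSupport hc.lapl.mul_left
  simp only [add_mul, mul_assoc]
  rw [integral_add (i _ hu.continuous) (by exact (i _ hq.continuous).const_mul _),
    integral_const_mul, hu.integral_mul_lapl hΩ hφ hc hs,
    integral_mul_lapl_eq isOpen_univ (hq.contDiffOn.of_le two_le_infty) hφ hc (subset_univ _)]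
  simp only [lapl_norm_sq]
  rw [integral_const_mul]
  field_simp
  ring

lemma lapl_avg_of_subset [NeZero n] (hΩ : IsOpen Ω) {ε : ℝ} (hε : 0 < ε) {y : Euc n}
    (hy : ∀ᶠ z in 𝓝 y, closedBall z ε ⊆ Ω) : lapl (avg ε u) y = -2 := by
  have hn := natCast_pos_of_neZero (n := n)
  have hq : ContDiff ℝ ∞ fun x : Euc n => ‖x‖ ^ 2 := contDiff_norm_sq ℝ
  obtain ⟨c, hc⟩ := exists_avg_norm_sq (n := n) hε
  have hw : Continuous fun x => u x + (n : ℝ)⁻¹ * ‖x‖ ^ 2 :=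
    hu.continuous.add (hq.continuous.const_smul (n : ℝ)⁻¹)
  have e : avg ε u =ᶠ[𝓝 y] fun z => u z - (n : ℝ)⁻¹ * c := by
    filter_upwards [hy] with z hz
    have h1 := (hu.weaklyHarmonic_add hΩ).avg_eq hw hε hz
    have h2 : avg ε (fun x => u x + (n : ℝ)⁻¹ * ‖x‖ ^ 2) z
        = avg ε u z + (n : ℝ)⁻¹ * avg ε (fun x => ‖x‖ ^ 2) z := by
      simp only [avg, add_mul, mul_assoc]
      rw [integral_add (by exact avg_integrable hε hu.continuous z)
        (by exact (avg_integrable hε hq.continuous z).const_mul _), integral_const_mul]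
    rw [h2, hc] at h1
    linarith
  have hyΩ : y ∈ Ω := hy.self_of_nhds (mem_closedBall_self hε.le)
  rw [lapl_congr_nhds e, lapl_sub ((hu.torsion.smooth.contDiffAt (hΩ.mem_nhds hyΩ)).of_le
    two_le_infty) contDiffAt_const, hu.torsion.lapl_eq y hyΩ, lapl_eq_sum_fderiv]
  simp

lemma avg_eq_zero [NeZero n] {ε : ℝ} (hε : 0 < ε) {y : Euc n}
    (hy : ∀ z, ‖y - z‖ < ε → z ∉ Ω) : avg ε u y = 0 := by
  refine (integral_congr_ae (g := fun _ => (0 : ℝ)) (Eventually.of_forall fun z => ?_)).trans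
    (integral_zero _ _)
  rcases lt_or_ge ‖y - z‖ ε with h | h
  · simp [hu.zero_outside z (hy z h)]
  · simp [avKer_of_ge hε h]

lemma lapl_avg_of_disjoint [NeZero n] {ε : ℝ} (hε : 0 < ε) {y : Euc n}
    (hy : ∀ᶠ z in 𝓝 y, ∀ x, ‖z - x‖ < ε → x ∉ Ω) : lapl (avg ε u) y = 0 := by
  have e : avg ε u =ᶠ[𝓝 y] fun _ => 0 := by
    filter_upwards [hy] with z hz using hu.avg_eq_zero hε hz
  rw [lapl_congr_nhds e, lapl_eq_sum_fderiv]
  simp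

lemma avg_hasCompactSupport [NeZero n] {ε R : ℝ} (hε : 0 < ε) (hb : Ω ⊆ closedBall 0 R) :
    HasCompactSupport (avg ε u) := by
  refine HasCompactSupport.of_support_subset_isCompact (isCompact_closedBall 0 (R + ε))
    fun y hy => ?_
  by_contra h
  refine hy (hu.avg_eq_zero hε fun z hz hzΩ => h ?_)
  have h1 := hb hzΩ
  rw [mem_closedBall, dist_zero_right] at h1 ⊢
  linarith [norm_le_norm_add_norm_sub' y z]

end IsLipTorsion

lemma exists_lapl_avg_bound [NeZero n] : ∃ C : ℝ, 0 ≤ C ∧ ∀ (L R ε : ℝ) (Ω : Set (Euc n))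
    (u : Euc n → ℝ), IsLipTorsion L Ω u → Ω ⊆ closedBall 0 R → 0 < ε →
    ∀ y, |lapl (avg ε u) y| ≤ C * L / ε := by
  obtain ⟨C, hC0, hC⟩ := exists_avg_secondDiff (n := n)
  refine ⟨n * C, by positivity, fun L R ε Ω u hu hb hε y => ?_⟩
  have hL := hu.lip_nonneg
  have hsm := avg_contDiff hε hu.continuous
  obtain ⟨K, hK⟩ := exists_lipschitz_hessian hsm (hu.avg_hasCompactSupport hε hb)
  have key : ∀ i : Fin n,
      |fderiv ℝ (fderiv ℝ (avg ε u)) y (stdVec i) (stdVec i)| ≤ C * L / ε := by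
    intro i
    have hv : ‖stdVec (n := n) i‖ = 1 := by rw [PiLp.norm_single, norm_one]
    set D := fderiv ℝ (fderiv ℝ (avg ε u)) y (stdVec i) (stdVec i)
    have h1 : ∀ t, 0 < t → t ≤ ε → |D| ≤ C * L / ε + 2 * K * t := by
      intro t ht hte
      have h2 := abs_secondDiff_sub_le hsm hK hv ht.le y
      have h3 := hC (fun z => u (y + z) - u y) L ε (t • stdVec i)
        ((hu.continuous.comp (by fun_prop)).sub continuous_const)
        (fun z => by simpa using hu.lip (y + z) y) hL hε (by
          rw [norm_smul, hv, mul_one, Real.norm_of_nonneg ht.le]; exact hte)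
      rw [avg_translate ε _ hε hu.continuous, avg_translate ε _ hε hu.continuous,
        avg_translate ε _ hε hu.continuous, norm_smul, hv, mul_one, Real.norm_of_nonneg ht.le,
        add_zero, ← sub_eq_add_neg] at h3
      have h4 : t ^ 2 * |D| ≤ t ^ 2 * (C * L / ε + 2 * K * t) := by
        rw [← abs_of_nonneg (sq_nonneg t), ← abs_mul, abs_of_nonneg (sq_nonneg t)]
        have h5 := abs_le.1 h2
        have h6 := abs_le.1 h3
        have h7 : C * L * t ^ 2 / ε = t ^ 2 * (C * L / ε) := by ring
        rw [h7] at h6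
        rw [abs_le]
        constructor <;> nlinarith
      exact le_of_mul_le_mul_left h4 (by positivity)
    have h8 : Tendsto (fun t : ℝ => C * L / ε + 2 * K * t) (𝓝[>] 0) (𝓝 (C * L / ε)) := by
      have : Tendsto (fun t : ℝ => C * L / ε + 2 * K * t) (𝓝 0) (𝓝 (C * L / ε + 2 * K * 0)) :=
        (Continuous.tendsto (by fun_prop) 0)
      rw [mul_zero, add_zero] at this
      exact this.mono_left nhdsWithin_le_nhds
    refine ge_of_tendsto h8 ?_
    filter_upwards [Ioc_mem_nhdsGT hε] with t ht using h1 t ht.1 ht.2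
  rw [lapl_eq_sum_fderiv]
  refine (Finset.abs_sum_le_sum_abs _ _).trans ((Finset.sum_le_sum fun i _ => key i).trans_eq ?_)
  rw [Finset.sum_const, Finset.card_univ, Fintype.card_fin, nsmul_eq_mul]
  ring

/-- The functional whose density is the normal derivative of the torsion function. -/
def bdryFn (Ω : Set (Euc n)) (u φ : Euc n → ℝ) : ℝ :=
  (∫ x, u x * lapl φ x) + 2 * ∫ x in Ω, φ x

lemma abs_le_of_shell_bounds {a I₁ k I M v L : ℝ}
    {s : ℝ} (hs : 0 < s)
    (h : ∀ ε, 0 < ε → ε < s →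
      a ≤ L * ε * I₁ + (k / ε + 2) * (ε * (I + M * ε * v))) : a ≤ k * I := by
  have : Tendsto (fun ε : ℝ => L * ε * I₁ + (k + 2 * ε) * (I + M * ε * v)) (𝓝[>] 0)
      (𝓝 (k * I)) := by
    have : Tendsto (fun ε : ℝ => L * ε * I₁ + (k + 2 * ε) * (I + M * ε * v)) (𝓝 0)
        (𝓝 (L * 0 * I₁ + (k + 2 * 0) * (I + M * 0 * v))) := Continuous.tendsto (by fun_prop) 0
    have h2 := this.mono_left (nhdsWithin_le_nhds (s := Ioi 0))
    convert h2 using 2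
    ring
  refine ge_of_tendsto this ?_
  filter_upwards [Ioo_mem_nhdsGT hs] with ε hε
  refine (h ε hε.1 hε.2).trans_eq ?_
  have := hε.1.ne'
  field_simp

lemma exists_abs_bdryFn_le [NeZero n] : ∃ C : ℝ, 0 ≤ C ∧ ∀ (L r R : ℝ) (Ω : Set (Euc n))
    (u : Euc n → ℝ), ConvexBetween r R Ω → IsLipTorsion L Ω u → ∀ φ : Euc n → ℝ,
    ContDiff ℝ ∞ φ → HasCompactSupport φ →
    |bdryFn Ω u φ| ≤ C * L / r * ∫ x, |φ x| ∂coneMeasure Ω := by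
  obtain ⟨C, hC0, hC⟩ := exists_lapl_avg_bound (n := n)
  refine ⟨C * (n * 2 ^ (n - 1) * 3), by positivity, fun L r R Ω u h hu φ hφ hc => ?_⟩
  have hL := hu.lip_nonneg
  have hr := h.pos
  have hR := h.radius_pos
  set A : ℝ := n * 2 ^ (n - 1) * 3 with hA
  have hA0 : 0 ≤ A := by positivity
  have hΔ := (lapl_contDiff hφ).continuous
  have hΔi : Integrable (lapl φ) := hΔ.integrable_of_hasCompactSupport hc.lapl
  have hφi : Integrable φ := hφ.continuous.integrable_of_hasCompactSupport hc
  have hfin := h.isFiniteMeasure_coneMeasure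
  obtain ⟨M, hM⟩ := ContDiff.lipschitzWith_of_hasCompactSupport hc hφ (by simp)
  have hφV : Integrable (fun x => |φ x|) (coneMeasure Ω) := (h.integrable_coneMeasure hφ.continuous).abs
  set J := ∫ x, |φ x| ∂coneMeasure Ω with hJ
  have main : ∀ ε, 0 < ε → ε < r / 2 → |bdryFn Ω u φ| ≤ L * ε * (∫ x, |lapl φ x|)
      + (C * L / ε + 2) * (ε * (A / r * J + (M * (R * (2 / r)) * (A / r)) * ε * volume.real Ω)) := by
    intro ε hε hεr
    have hD : ∀ y, |lapl (avg ε u) y| ≤ C * L / ε := hC L R ε Ω u hu h.subset_ball hε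
    set t := ε / r with ht
    have ht0 : 0 < t := by positivity
    have ht1 : t < 1 / 2 := by rw [ht, div_lt_iff₀ hr]; linarith
    have hgc := h.continuous_gauge
    set S := {x | 1 - t ≤ gauge Ω x ∧ gauge Ω x < 1 + 2 * t}
    have hS : MeasurableSet S :=
      ((isClosed_le continuous_const hgc).measurableSet.inter
        (isOpen_lt hgc continuous_const).measurableSet)
    have hSvol : volume S < ⊤ := by
      refine (measure_mono (fun x hx => ?_)).trans_lt
        (measure_closedBall_lt_top (x := (0 : Euc n)) (r := R * 2))
      rw [mem_closedBall, dist_zero_right]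
      exact (h.norm_le x).trans (mul_le_mul_of_nonneg_left (by linarith [hx.2]) hR.le)
    let D : Euc n → ℝ := fun x => lapl (avg ε u) x + 2 * Ω.indicator 1 x
    have hDS : ∀ x, x ∉ S → D x = 0 := by
      intro x hx
      rcases lt_or_ge (gauge Ω x) (1 - t) with h1 | h1
      · have hxΩ : x ∈ Ω := (h.mem_iff x).2 (by linarith)
        have : lapl (avg ε u) x = -2 := by
          refine hu.lapl_avg_of_subset h.isOpen hε ?_
          filter_upwards [hgc.continuousAt.eventually (Iio_mem_nhds h1)] with z hz w hw
          rw [h.mem_iff]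
          have h2 := (abs_le.1 (h.abs_gauge_sub_le w z)).2
          have h3 : ‖w - z‖ / r ≤ t := by
            rw [ht]; gcongr; rwa [← dist_eq_norm]
          linarith
        simp [D, this, hxΩ]
      · have h2 : 1 + t < gauge Ω x := by
          by_contra! h3
          exact hx ⟨h1, by linarith⟩
        have hxΩ : x ∉ Ω := fun h3 => by
          have := (h.mem_iff x).1 h3
          linarith
        have : lapl (avg ε u) x = 0 := by
          refine hu.lapl_avg_of_disjoint hε ?_
          filter_upwards [hgc.continuousAt.eventually (Ioi_mem_nhds h2)] with z hz w hw
          rw [h.mem_iff, not_lt]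
          have h2 := (abs_le.1 (h.abs_gauge_sub_le z w)).2
          have h3 : ‖z - w‖ / r ≤ t := by rw [ht]; gcongr
          linarith
        simp [D, this, hxΩ]
    have hDb : ∀ x, |D x| ≤ C * L / ε + 2 := by
      intro x
      refine (abs_add_le _ _).trans (add_le_add (hD x) ?_)
      by_cases hx : x ∈ Ω <;> simp [hx]
    have e1 : ∫ x, avg ε u x * lapl φ x = ∫ x, lapl (avg ε u) x * φ x :=
      integral_mul_lapl_eq isOpen_univ ((avg_contDiff hε hu.continuous).contDiffOn.of_le
        two_le_infty) hφ hc (subset_univ _)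
    have i1 : Integrable fun x => lapl (avg ε u) x * φ x :=
      ((lapl_contDiff (avg_contDiff hε hu.continuous)).continuous.mul
        hφ.continuous).integrable_of_hasCompactSupport hc.mul_left
    have i2 : Integrable (Ω.indicator φ) := hφi.indicator h.isOpen.measurableSet
    have e2 : (∫ x, avg ε u x * lapl φ x) + 2 * ∫ x in Ω, φ x = ∫ x in S, D x * φ x := by
      rw [e1, ← integral_indicator h.isOpen.measurableSet, ← integral_const_mul,
        ← integral_add i1 (by exact i2.const_mul 2), ← integral_indicator hS]
      refine integral_congr_ae (Eventually.of_forall fun x => ?_)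
      have e3 : lapl (avg ε u) x * φ x + 2 * Ω.indicator φ x = D x * φ x := by
        by_cases hx : x ∈ Ω <;> simp [D, hx, add_mul]
      by_cases hx : x ∈ S
      · simp only [indicator_of_mem hx]; exact e3
      · simp only [indicator_of_notMem hx]; rw [e3, hDS x hx, zero_mul]
    have hpow : (1 + 2 * t) ^ n - (1 - t) ^ n ≤ A * t := by
      refine (le_abs_self _).trans ((abs_pow_sub_pow_le _ _ n).trans ?_)
      have h1 : |1 + 2 * t - (1 - t)| = 3 * t := by
        rw [abs_of_nonneg] <;> linarith
      have h2 : max |1 + 2 * t| |1 - t| ≤ 2 :=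
        max_le (abs_le.2 ⟨by linarith, by linarith⟩) (abs_le.2 ⟨by linarith, by linarith⟩)
      rw [h1]
      calc 3 * t * n * max |1 + 2 * t| |1 - t| ^ (n - 1) ≤ 3 * t * n * 2 ^ (n - 1) := by gcongr
        _ = A * t := by rw [hA]; ring
    have iS : IntegrableOn (fun x => |φ (radProj Ω x)|) S :=
      (h.integrableOn_radProj (t := 1 + 2 * t) (by linarith) hφV).mono_set fun x hx => hx.2
    have e4 : ∫ x in S, |φ x| ≤ ε * (A / r * J + (M * (R * (2 / r)) * (A / r)) * ε * volume.real Ω) := by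
      have h1 : ∫ x in S, |φ x| ≤ ∫ x in S, (|φ (radProj Ω x)| + M * (R * (2 * t))) := by
        refine setIntegral_mono_on hφi.abs.integrableOn
          (iS.add (integrableOn_const hSvol.ne)) hS fun x hx => ?_
        have h2 := hM.dist_le_mul x (radProj Ω x)
        rw [Real.dist_eq, dist_eq_norm] at h2
        have h3 : |gauge Ω x - 1| ≤ 2 * t := abs_le.2 ⟨by linarith [hx.1], by linarith [hx.2]⟩
        have h4 : ‖x - radProj Ω x‖ ≤ R * (2 * t) :=
          (h.norm_sub_radProj_le x).trans (mul_le_mul_of_nonneg_left h3 hR.le)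
        have h5 : |φ x| ≤ |φ (radProj Ω x)| + |φ x - φ (radProj Ω x)| := by
          have := abs_add_le (φ (radProj Ω x)) (φ x - φ (radProj Ω x))
          rwa [add_sub_cancel] at this
        have h6 : (M : ℝ) * ‖x - radProj Ω x‖ ≤ M * (R * (2 * t)) := by gcongr
        linarith
      rw [integral_add iS (integrableOn_const hSvol.ne),
        h.integral_shell (ψ := fun x => |φ x|) (by linarith) (by linarith) hφV,
        setIntegral_const, h.volume_real_shell (by linarith) (by linarith), smul_eq_mul] at h1
      have hJ0 : 0 ≤ J := integral_nonneg fun x => abs_nonneg _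
      have hv0 : 0 ≤ volume.real Ω := measureReal_nonneg
      refine h1.trans ?_
      calc _ ≤ A * t * J + A * t * volume.real Ω * (M * (R * (2 * t))) := by gcongr
        _ = _ := by rw [ht]; ring
    have e5 : |∫ x in S, D x * φ x| ≤ (C * L / ε + 2) * ∫ x in S, |φ x| := by
      rw [← integral_const_mul]
      refine norm_integral_le_of_norm_le (f := fun x => D x * φ x)
        (hφi.abs.integrableOn.const_mul _) (Eventually.of_forall fun x => ?_)
      rw [Real.norm_eq_abs, abs_mul]
      exact mul_le_mul_of_nonneg_right (hDb x) (abs_nonneg _)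
    have e6 : |(∫ x, u x * lapl φ x) - ∫ x, avg ε u x * lapl φ x|
        ≤ L * ε * ∫ x, |lapl φ x| := by
      have j : ∀ v : Euc n → ℝ, Continuous v → Integrable fun x => v x * lapl φ x := fun v hv =>
        (hv.mul hΔ).integrable_of_hasCompactSupport hc.lapl.mul_left
      rw [← integral_sub (j u hu.continuous) (j _ (avg_contDiff hε hu.continuous).continuous),
        ← integral_const_mul]
      refine norm_integral_le_of_norm_le (f := fun x => u x * lapl φ x - avg ε u x * lapl φ x)
        (hΔi.abs.const_mul _) (Eventually.of_forall fun x => ?_)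
      rw [← sub_mul, Real.norm_eq_abs, abs_mul, abs_sub_comm]
      exact mul_le_mul_of_nonneg_right
        (abs_avg_sub_le_of_lipschitz hε hu.lip hu.continuous hL x) (abs_nonneg _)
    have e7 : bdryFn Ω u φ = ((∫ x, u x * lapl φ x) - ∫ x, avg ε u x * lapl φ x)
        + ∫ x in S, D x * φ x := by
      rw [← e2, bdryFn]; ring
    rw [e7]
    refine (abs_add_le _ _).trans (add_le_add e6 (e5.trans ?_))
    exact mul_le_mul_of_nonneg_left e4 (by positivity)
  have := abs_le_of_shell_bounds (k := C * L) (half_pos hr) main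
  refine this.trans_eq ?_
  ring

/-- The density of the boundary functional with respect to cone measure. -/
lemma ConvexBetween.exists_bdryDensity [NeZero n] {L r R : ℝ} {Ω : Set (Euc n)} {u : Euc n → ℝ}
    (h : ConvexBetween r R Ω) (hu : IsLipTorsion L Ω u) :
    ∃ F : Euc n → ℝ, Measurable F ∧ MemLp F 2 (coneMeasure Ω) ∧ ∀ φ : Euc n → ℝ,
      ContDiff ℝ ∞ φ → HasCompactSupport φ →
      bdryFn Ω u φ = ∫ x, φ x * F x ∂coneMeasure Ω := by
  have hfin := h.isFiniteMeasure_coneMeasure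
  obtain ⟨C, -, hC⟩ := exists_abs_bdryFn_le (n := n)
  have i : ∀ φ : testFn n, Integrable fun x => u x * lapl φ.1 x := fun φ =>
    (hu.continuous.mul (lapl_contDiff φ.2.1).continuous).integrable_of_hasCompactSupport
      φ.2.2.lapl.mul_left
  have j : ∀ φ : testFn n, IntegrableOn φ.1 Ω := fun φ =>
    (φ.2.1.continuous.integrable_of_hasCompactSupport φ.2.2).integrableOn
  let Λ : testFn n →ₗ[ℝ] ℝ :=
    { toFun := fun φ => bdryFn Ω u φ.1
      map_add' := fun φ ψ => by
        have e1 : ∀ x, lapl (φ + ψ).1 x = lapl φ.1 x + lapl ψ.1 x := fun x =>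
          lapl_add (φ.2.1.contDiffAt.of_le two_le_infty) (ψ.2.1.contDiffAt.of_le two_le_infty)
        have e2 : ∀ x, (φ + ψ).1 x = φ.1 x + ψ.1 x := fun x => rfl
        simp only [bdryFn, e1, e2, mul_add]
        rw [integral_add (i φ) (i ψ), integral_add (j φ) (j ψ)]
        ring
      map_smul' := fun c φ => by
        have e1 : ∀ x, lapl (c • φ).1 x = c * lapl φ.1 x := fun x =>
          lapl_const_mul c (φ.2.1.contDiffAt.of_le two_le_infty)
        have e2 : ∀ x, (c • φ).1 x = c * φ.1 x := fun x => rfl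
        simp only [bdryFn, e1, e2, mul_left_comm _ c]
        rw [integral_const_mul, integral_const_mul]
        simp only [RingHom.id_apply, smul_eq_mul]
        ring }
  obtain ⟨F, h1, h2, h3⟩ := exists_density (coneMeasure Ω) Λ fun φ =>
    hC L r R Ω u h hu φ.1 φ.2.1 φ.2.2
  exact ⟨F, h1, h2, fun φ hφ hc => h3 ⟨φ, hφ, hc⟩⟩

set_option linter.unusedSectionVars false

/-- The gradient of the gauge of `Ω`. -/
def gaugeGrad (Ω : Set (Euc n)) (x : Euc n) : Euc n := gradient (gauge Ω) x

lemma inner_gaugeGrad (Ω : Set (Euc n)) (x v : Euc n) :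
    ⟪gaugeGrad Ω x, v⟫ = fderiv ℝ (gauge Ω) x v := inner_gradient_left

lemma measurable_gaugeGrad (Ω : Set (Euc n)) : Measurable (gaugeGrad Ω) :=
  (LinearIsometryEquiv.continuous _).measurable.comp (measurable_fderiv ℝ _)

lemma hasFDerivAt_gauge_smul {Ω : Set (Euc n)} {x : Euc n}
    (hd : DifferentiableAt ℝ (gauge Ω) x) {t : ℝ} (ht : 0 < t) :
    HasFDerivAt (gauge Ω) (fderiv ℝ (gauge Ω) x) (t • x) := by
  have e : gauge Ω = fun z => t * gauge Ω (t⁻¹ • z) := by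
    ext z
    rw [gauge_smul_nonneg Ω (inv_pos.2 ht).le, mul_inv_cancel_left₀ ht.ne']
  have hx : t⁻¹ • t • x = x := by rw [smul_smul, inv_mul_cancel₀ ht.ne', one_smul]
  have h1 : HasFDerivAt (fun z : Euc n => t⁻¹ • z)
      (t⁻¹ • ContinuousLinearMap.id ℝ (Euc n)) (t • x) := (hasFDerivAt_id (𝕜 := ℝ) (t • x)).const_smul t⁻¹
  have h2 : HasFDerivAt (gauge Ω) (fderiv ℝ (gauge Ω) x) (t⁻¹ • t • x) := by
    rw [hx]; exact hd.hasFDerivAt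
  have h3 := (h2.comp (t • x) h1).const_mul t
  have h4 : HasFDerivAt (fun z => t * gauge Ω (t⁻¹ • z)) (fderiv ℝ (gauge Ω) x) (t • x) := by
    refine h3.congr_fderiv ?_
    ext v
    simp [ht.ne']
  rw [← e] at h4
  exact h4

lemma differentiableAt_gauge_smul_iff {Ω : Set (Euc n)} {x : Euc n} {t : ℝ} (ht : 0 < t) :
    DifferentiableAt ℝ (gauge Ω) (t • x) ↔ DifferentiableAt ℝ (gauge Ω) x := by
  refine ⟨fun h => ?_, fun h => (hasFDerivAt_gauge_smul h ht).differentiableAt⟩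
  have := (hasFDerivAt_gauge_smul h (inv_pos.2 ht)).differentiableAt
  rwa [smul_smul, inv_mul_cancel₀ ht.ne', one_smul] at this

lemma gaugeGrad_smul (Ω : Set (Euc n)) (x : Euc n) {t : ℝ} (ht : 0 < t) :
    gaugeGrad Ω (t • x) = gaugeGrad Ω x := by
  by_cases hd : DifferentiableAt ℝ (gauge Ω) x
  · refine ext_inner_right ℝ fun v => ?_
    rw [inner_gaugeGrad, inner_gaugeGrad, (hasFDerivAt_gauge_smul hd ht).fderiv]
  · rw [gaugeGrad, gaugeGrad, gradient_eq_zero_of_not_differentiableAt hd,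
      gradient_eq_zero_of_not_differentiableAt (mt (differentiableAt_gauge_smul_iff ht).1 hd)]

namespace ConvexBetween

variable [NeZero n] {r R : ℝ} {Ω : Set (Euc n)} (h : ConvexBetween r R Ω)
include h

lemma gaugeGrad_radProj {x : Euc n} (hx : x ≠ 0) :
    gaugeGrad Ω (radProj Ω x) = gaugeGrad Ω x :=
  gaugeGrad_smul Ω x (inv_pos.2 (h.gauge_pos hx))

lemma lipschitzWith_gauge : LipschitzWith ⟨r⁻¹, (inv_pos.2 h.pos).le⟩ (gauge Ω) := by
  refine LipschitzWith.of_dist_le_mul fun x y => ?_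
  rw [Real.dist_eq, dist_eq_norm]
  refine (h.abs_gauge_sub_le x y).trans_eq ?_
  rw [div_eq_inv_mul]
  rfl

lemma ae_differentiableAt_gauge : ∀ᵐ x : Euc n, DifferentiableAt ℝ (gauge Ω) x :=
  h.lipschitzWith_gauge.ae_differentiableAt_of_real

lemma ae_coneMeasure_differentiableAt :
    ∀ᵐ x ∂coneMeasure Ω, DifferentiableAt ℝ (gauge Ω) x := by
  rw [coneMeasure, ae_map_iff h.measurable_radProj.aemeasurable
    (measurableSet_of_differentiableAt ℝ (gauge Ω))]
  filter_upwards [ae_restrict_of_ae h.ae_differentiableAt_gauge, ae_ne_zero Ω] with x hx hx0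
  exact (differentiableAt_gauge_smul_iff (inv_pos.2 (h.gauge_pos hx0))).2 hx

lemma norm_gaugeGrad_le (x : Euc n) : ‖gaugeGrad Ω x‖ ≤ r⁻¹ := by
  rw [gaugeGrad, gradient, LinearIsometryEquiv.norm_map]
  exact norm_fderiv_le_of_lipschitz ℝ h.lipschitzWith_gauge

lemma gauge_add_inner_le {x : Euc n} (hd : DifferentiableAt ℝ (gauge Ω) x) (y : Euc n) :
    gauge Ω x + ⟪gaugeGrad Ω x, y - x⟫ ≤ gauge Ω y := by
  rw [inner_gaugeGrad]
  have h1 : HasDerivAt (fun t : ℝ => gauge Ω (x + t • (y - x)))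
      (fderiv ℝ (gauge Ω) x (y - x)) 0 := by
    have h2 : HasFDerivAt (gauge Ω) (fderiv ℝ (gauge Ω) x) (x + (0 : ℝ) • (y - x)) := by
      rw [zero_smul, add_zero]; exact hd.hasFDerivAt
    exact h2.comp_hasDerivAt (0 : ℝ) (hasDerivAt_add_smul x (y - x) 0)
  have h2 : Tendsto (fun t : ℝ => t⁻¹ * (gauge Ω (x + t • (y - x)) - gauge Ω x)) (𝓝[>] 0)
      (𝓝 (fderiv ℝ (gauge Ω) x (y - x))) := by
    have := (hasDerivAt_iff_tendsto_slope.1 h1).mono_left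
      (nhdsWithin_mono (0 : ℝ) fun t (ht : 0 < t) => ht.ne')
    refine this.congr fun t => ?_
    simp [slope_def_module]
  refine le_sub_iff_add_le'.1 (le_of_tendsto h2 ?_)
  filter_upwards [Ioo_mem_nhdsGT (zero_lt_one' ℝ)] with t ht
  have := h.convexOn_gauge.2 (mem_univ x) (mem_univ y) (sub_nonneg.2 ht.2.le) ht.1.le (by ring)
  rw [show (1 - t) • x + t • y = x + t • (y - x) by module, smul_eq_mul, smul_eq_mul] at this
  rw [inv_mul_le_iff₀ ht.1]
  linarith

lemma inner_gaugeGrad_self {x : Euc n} (hd : DifferentiableAt ℝ (gauge Ω) x) :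
    ⟪gaugeGrad Ω x, x⟫ = gauge Ω x := by
  have h1 := h.gauge_add_inner_le hd ((2 : ℝ) • x)
  have h2 := h.gauge_add_inner_le hd (0 : Euc n)
  rw [gauge_smul_nonneg Ω zero_le_two, show (2 : ℝ) • x - x = x by module] at h1
  rw [gauge_zero, zero_sub, inner_neg_right] at h2
  linarith

lemma inner_gaugeGrad_le {x : Euc n} (hd : DifferentiableAt ℝ (gauge Ω) x) (y : Euc n) :
    ⟪gaugeGrad Ω x, y⟫ ≤ gauge Ω y := by
  have h1 := h.gauge_add_inner_le hd y
  rw [inner_sub_right, h.inner_gaugeGrad_self hd] at h1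
  linarith

lemma le_norm_gaugeGrad {x : Euc n} (hd : DifferentiableAt ℝ (gauge Ω) x) (hx : x ≠ 0) :
    1 ≤ R * ‖gaugeGrad Ω x‖ := by
  have h1 := h.inner_gaugeGrad_self hd
  have h2 := real_inner_le_norm (gaugeGrad Ω x) x
  have h3 := h.norm_le x
  have h4 := h.gauge_pos hx
  have h5 : gauge Ω x ≤ gauge Ω x * (R * ‖gaugeGrad Ω x‖) := by
    nlinarith [norm_nonneg (gaugeGrad Ω x)]
  nlinarith

lemma ne_zero_of_mem_frontier {x : Euc n} (hx : x ∈ frontier Ω) : x ≠ 0 := by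
  rintro rfl
  have := (h.mem_frontier_iff _).1 hx
  rw [gauge_zero] at this
  exact zero_ne_one this

lemma norm_gaugeGrad_pos {x : Euc n} (hd : DifferentiableAt ℝ (gauge Ω) x) (hx : x ≠ 0) :
    0 < ‖gaugeGrad Ω x‖ := by
  by_contra h0
  have h1 := h.le_norm_gaugeGrad hd hx
  rw [le_antisymm (not_lt.1 h0) (norm_nonneg _), mul_zero] at h1
  linarith

lemma gaugeGrad_eq_of_isOuterNormalAt {x X : Euc n} (hd : DifferentiableAt ℝ (gauge Ω) x)
    (hx : x ∈ frontier Ω) (hX : IsOuterNormalAt (closure Ω) x X) :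
    0 < ⟪x, X⟫ ∧ X = ⟪x, X⟫ • gaugeGrad Ω x := by
  obtain ⟨hX1, hX2⟩ := hX
  have hgx := (h.mem_frontier_iff _).1 hx
  have hpos : 0 < ⟪x, X⟫ := by
    have := hX2 (r • X) (subset_closure (h.ball_subset (by
      rw [mem_closedBall, dist_zero_right, norm_smul, hX1, mul_one, Real.norm_of_nonneg h.pos.le])))
    rw [real_inner_smul_left, real_inner_self_eq_norm_sq, hX1] at this
    linarith [h.pos]
  refine ⟨hpos, ?_⟩
  have hle : ∀ y, ⟪y, X⟫ ≤ ⟪x, X⟫ * gauge Ω y := by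
    intro y
    rcases eq_or_ne y 0 with rfl | hy
    · simp
    have h1 := hX2 _ (frontier_subset_closure (h.radProj_mem_frontier hy))
    rw [radProj, real_inner_smul_left, inv_mul_le_iff₀ (h.gauge_pos hy)] at h1
    linarith
  have hmin : IsLocalMin (fun y => ⟪x, X⟫ * gauge Ω y - ⟪X, y⟫) x := by
    refine Eventually.of_forall fun y => ?_
    simp only [hgx, real_inner_comm]
    linarith [hle y, real_inner_comm X y]
  have hder : HasFDerivAt (fun y => ⟪x, X⟫ * gauge Ω y - ⟪X, y⟫)
      (⟪x, X⟫ • fderiv ℝ (gauge Ω) x - innerSL ℝ X) x :=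
    (hd.hasFDerivAt.const_mul _).sub (innerSL ℝ X).hasFDerivAt
  have h0 := hmin.hasFDerivAt_eq_zero hder
  refine ext_inner_right ℝ fun v => ?_
  have := DFunLike.congr_fun h0 v
  simp only [sub_apply, smul_apply, innerSL_apply_apply, zero_apply, smul_eq_mul] at this
  rw [real_inner_smul_left, inner_gaugeGrad]
  linarith

lemma isOuterNormalAt_gaugeGrad {x : Euc n} (hd : DifferentiableAt ℝ (gauge Ω) x)
    (hx : x ∈ frontier Ω) :
    IsOuterNormalAt (closure Ω) x (‖gaugeGrad Ω x‖⁻¹ • gaugeGrad Ω x) := by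
  have hpos := h.norm_gaugeGrad_pos hd (h.ne_zero_of_mem_frontier hx)
  refine ⟨?_, fun y hy => ?_⟩
  · rw [norm_smul, norm_inv, norm_norm, inv_mul_cancel₀ hpos.ne']
  · rw [inner_smul_right, inner_smul_right]
    refine mul_le_mul_of_nonneg_left ?_ (inv_pos.2 hpos).le
    rw [real_inner_comm, real_inner_comm (gaugeGrad Ω x), h.inner_gaugeGrad_self hd,
      (h.mem_frontier_iff _).1 hx]
    exact (h.inner_gaugeGrad_le hd y).trans ((h.mem_closure_iff _).1 hy)

lemma gaussMap_eq {x : Euc n} (hd : DifferentiableAt ℝ (gauge Ω) x) (hx : x ∈ frontier Ω) :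
    gaussMap (closure Ω) x = ‖gaugeGrad Ω x‖⁻¹ • gaugeGrad Ω x := by
  have huniq : ∀ X, IsOuterNormalAt (closure Ω) x X →
      X = ‖gaugeGrad Ω x‖⁻¹ • gaugeGrad Ω x := by
    intro X hX
    obtain ⟨hpos, hE⟩ := h.gaugeGrad_eq_of_isOuterNormalAt hd hx hX
    have h1 := hX.1
    rw [hE, norm_smul, Real.norm_of_nonneg hpos.le] at h1
    rw [hE]
    congr 1
    exact eq_inv_of_mul_eq_one_left h1
  have hex : ∃! X, IsOuterNormalAt (closure Ω) x X :=
    ⟨_, h.isOuterNormalAt_gaugeGrad hd hx, huniq⟩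
  rw [gaussMap, dif_pos hex]
  exact huniq _ hex.choose_spec.1

lemma exists_abs_gauge_sub_inner_le {x : Euc n} (hd : DifferentiableAt ℝ (gauge Ω) x) {ε : ℝ}
    (hε : 0 < ε) : ∃ ρ > 0, ∀ y ∈ ball x ρ, ∀ z ∈ ball x ρ,
      |gauge Ω y - gauge Ω z - ⟪gaugeGrad Ω x, y - z⟫| ≤ ε * ‖y - z‖ := by
  have h1 := hd.hasFDerivAt.isLittleO.def (show (0 : ℝ) < ε / 4 by positivity)
  obtain ⟨s, hs, hball⟩ := Metric.eventually_nhds_iff_ball.1 h1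
  set k : Euc n → ℝ := fun y => gauge Ω y + -(gauge Ω x + ⟪gaugeGrad Ω x, y - x⟫) with hk
  have hconv : ConvexOn ℝ (ball x s) k := by
    refine (h.convexOn_gauge.subset (subset_univ _) (convex_ball _ _)).add ?_
    refine ⟨convex_ball _ _, fun a _ b _ p q _ _ hpq => le_of_eq ?_⟩
    have : p • a + q • b - x = p • (a - x) + q • (b - x) := by
      obtain rfl : q = 1 - p := by linarith
      module
    simp only [this, inner_add_right, inner_smul_right, smul_eq_mul]
    linear_combination gauge Ω x * hpq
  have hM : ∀ a, dist a x < s → |k a| ≤ ε / 4 * s := by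
    intro a ha
    have := hball a ha
    rw [← inner_gaugeGrad, Real.norm_eq_abs] at this
    rw [show k a = gauge Ω a - gauge Ω x - ⟪gaugeGrad Ω x, a - x⟫ by rw [hk]; ring]
    refine this.trans (mul_le_mul_of_nonneg_left ?_ (by positivity))
    rw [← dist_eq_norm]; exact ha.le
  have hL := hconv.lipschitzOnWith_of_abs_le (half_pos hs) hM
  refine ⟨s - s / 2, by linarith, fun y hy z hz => ?_⟩
  have h2 := hL.dist_le_mul y hy z hz
  rw [show 2 * (ε / 4 * s) / (s / 2) = ε by field_simp; ring, Real.coe_toNNReal _ hε.le,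
    Real.dist_eq, dist_eq_norm] at h2
  refine le_trans (le_of_eq ?_) h2
  congr 1
  rw [hk]
  simp only [inner_sub_right]
  ring

end ConvexBetween

/-- The open half-space with outer normal `G`. -/
def halfSpace (G : Euc n) : Set (Euc n) := {z | ⟪G, z⟫ < 0}

/-- The function `z ↦ max (-⟪G, z⟫) 0`, a positive linear profile on `halfSpace G`. -/
def halfProfile (G z : Euc n) : ℝ := max (-⟪G, z⟫) 0

lemma isOpen_halfSpace (G : Euc n) : IsOpen (halfSpace G) :=
  isOpen_lt (by fun_prop) continuous_const

lemma ae_inner_ne_zero {G : Euc n} (hG : G ≠ 0) : ∀ᵐ z : Euc n, ⟪G, z⟫ ≠ 0 := by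
  have h := Measure.addHaar_submodule (volume : Measure (Euc n)) (innerSL ℝ G).ker (by
    intro h
    have : G ∈ (innerSL ℝ G).ker := h ▸ Submodule.mem_top
    rw [LinearMap.mem_ker] at this
    exact hG (by simpa using this))
  rw [ae_iff]
  refine (congrArg volume ?_).trans h
  ext z
  simp

lemma halfProfile_of_neg {G z : Euc n} (h : ⟪G, z⟫ ≤ 0) : halfProfile G z = -⟪G, z⟫ :=
  max_eq_left (by linarith)

lemma halfProfile_of_nonneg {G z : Euc n} (h : 0 ≤ ⟪G, z⟫) : halfProfile G z = 0 :=
  max_eq_right (by linarith)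

lemma abs_halfProfile_sub_le (G y z : Euc n) :
    |halfProfile G y - halfProfile G z| ≤ ‖G‖ * ‖y - z‖ := by
  refine (abs_max_sub_max_le_abs _ _ _).trans ?_
  rw [show -⟪G, y⟫ - -⟪G, z⟫ = -⟪G, y - z⟫ by rw [inner_sub_right]; ring, abs_neg]
  exact abs_real_inner_le_norm _ _

lemma lipschitzWith_halfProfile (G : Euc n) : LipschitzWith ‖G‖₊ (halfProfile G) :=
  LipschitzWith.of_dist_le_mul fun y z => by
    rw [Real.dist_eq, dist_eq_norm]
    exact abs_halfProfile_sub_le G y z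

lemma lineDeriv_halfProfile {G z : Euc n} (hz : ⟪G, z⟫ ≠ 0) (v : Euc n) :
    lineDeriv ℝ (halfProfile G) z v = -⟪G, v⟫ * (halfSpace G).indicator (fun _ => 1) z := by
  have hc : Continuous fun y : Euc n => ⟪G, y⟫ := by fun_prop
  rcases hz.lt_or_gt with h | h
  · have e : halfProfile G =ᶠ[𝓝 z] fun y => -innerSL ℝ G y := by
      filter_upwards [hc.continuousAt.eventually_lt continuousAt_const h] with y hy
      exact halfProfile_of_neg hy.le
    have h1 : HasFDerivAt (halfProfile G) (-innerSL ℝ G) z :=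
      ((innerSL ℝ G).hasFDerivAt.neg).congr_of_eventuallyEq e
    rw [h1.differentiableAt.lineDeriv_eq_fderiv, h1.fderiv,
      indicator_of_mem (show z ∈ halfSpace G from h)]
    simp
  · have e : halfProfile G =ᶠ[𝓝 z] fun _ => 0 := by
      filter_upwards [continuousAt_const.eventually_lt hc.continuousAt h] with y hy
      exact halfProfile_of_nonneg hy.le
    have h1 : HasFDerivAt (halfProfile G) (0 : Euc n →L[ℝ] ℝ) z :=
      (hasFDerivAt_const 0 z).congr_of_eventuallyEq e
    rw [h1.differentiableAt.lineDeriv_eq_fderiv, h1.fderiv,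
      indicator_of_notMem (show z ∉ halfSpace G from not_lt.2 h.le)]
    simp

lemma integral_halfProfile_mul_fderiv {G : Euc n} (hG : G ≠ 0) {ψ : Euc n → ℝ}
    (hψ : ContDiff ℝ ∞ ψ) (hc : HasCompactSupport ψ) (v : Euc n) :
    ∫ z, halfProfile G z * fderiv ℝ ψ z v = ⟪G, v⟫ * ∫ z in halfSpace G, ψ z := by
  obtain ⟨D, hD⟩ := ContDiff.lipschitzWith_of_hasCompactSupport hc hψ (by simp)
  have h1 := (lipschitzWith_halfProfile G).integral_lineDeriv_mul_eq (μ := volume) hD hc v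
  have h2 : ∫ z, lineDeriv ℝ ψ z (-v) * halfProfile G z
      = -∫ z, halfProfile G z * fderiv ℝ ψ z v := by
    rw [← integral_neg]
    refine integral_congr_ae (Eventually.of_forall fun z => ?_)
    have := (hψ.differentiable (by simp)).differentiableAt (x := z)
    simp only [this.lineDeriv_eq_fderiv, map_neg]
    ring
  have h3 : ∫ z, lineDeriv ℝ (halfProfile G) z v * ψ z
      = -⟪G, v⟫ * ∫ z in halfSpace G, ψ z := by
    rw [← integral_indicator (isOpen_halfSpace G).measurableSet, ← integral_const_mul]
    refine integral_congr_ae ?_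
    filter_upwards [ae_inner_ne_zero hG] with z hz
    rw [lineDeriv_halfProfile hz]
    by_cases hz' : z ∈ halfSpace G <;> simp [hz']
  linarith

lemma integral_halfProfile_mul_lapl {G v : Euc n} (hv : ⟪G, v⟫ = 1) {Φ : Euc n → ℝ}
    (hΦ : ContDiff ℝ ∞ Φ) (hc : HasCompactSupport Φ) :
    ∫ z, halfProfile G z * lapl Φ z = ‖G‖ ^ 2 * ∫ z in halfSpace G, fderiv ℝ Φ z v := by
  have hG : G ≠ 0 := by
    rintro rfl
    simp at hv
  have hs : ∀ w, ContDiff ℝ ∞ fun z => fderiv ℝ Φ z w := fun w =>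
    (hΦ.fderiv_right (m := ∞) (by simp)).clm_apply contDiff_const
  have hcs : ∀ w, HasCompactSupport fun z => fderiv ℝ Φ z w := fun w => hc.fderiv_apply ℝ w
  have hat : ∀ z, ContDiffAt ℝ 2 Φ z := fun z => hΦ.contDiffAt.of_le two_le_infty
  have hsym : ∀ w, ∫ z in halfSpace G, fderiv ℝ Φ z w
      = ⟪G, w⟫ * ∫ z in halfSpace G, fderiv ℝ Φ z v := by
    intro w
    rw [← integral_halfProfile_mul_fderiv hG (hs v) (hcs v), ← one_mul (∫ z in _, _), ← hv,
      ← integral_halfProfile_mul_fderiv hG (hs w) (hcs w)]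
    refine integral_congr_ae (Eventually.of_forall fun z => ?_)
    simp only [fderiv_fderiv_apply (hat z)]
    rw [((hat z).isSymmSndFDerivAt (by simp)).eq]
  have hli : ∀ i : Fin n, Integrable fun z =>
      halfProfile G z * fderiv ℝ (fun y => fderiv ℝ Φ y (stdVec i)) z (stdVec i) := fun i =>
    ((lipschitzWith_halfProfile G).continuous.mul (((hs _).fderiv_right (m := ∞)
      (by simp)).clm_apply contDiff_const).continuous).integrable_of_hasCompactSupport
      ((hcs _).fderiv_apply ℝ _).mul_left
  have hnorm : ∑ i : Fin n, ⟪G, stdVec i⟫ * ⟪G, stdVec i⟫ = ‖G‖ ^ 2 := by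
    rw [EuclideanSpace.norm_sq_eq]
    refine Finset.sum_congr rfl fun i _ => ?_
    rw [EuclideanSpace.inner_single_right]
    simp [sq]
  simp only [lapl_eq_sum (hat _), Finset.mul_sum]
  rw [integral_finsetSum _ fun i _ => hli i, ← hnorm, Finset.sum_mul]
  refine Finset.sum_congr rfl fun i _ => ?_
  rw [integral_halfProfile_mul_fderiv hG (hs _) (hcs _), hsym, mul_assoc]

lemma integral_comp_add_smul {t : ℝ} (ht : 0 < t) (p : Euc n) (f : Euc n → ℝ) :
    t ^ n * ∫ z, f (p + t • z) = ∫ x, f x := by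
  have h := Measure.integral_comp_smul (volume : Measure (Euc n)) (fun y => f (p + y)) t
  rw [h, integral_add_left_eq_self (fun y => f y) p, finrank_euclideanSpace_fin,
    abs_of_nonneg (by positivity), smul_eq_mul, mul_inv_cancel_left₀ (by positivity)]

/-- The function `Φ` transplanted to the scale `t` at the point `p`. -/
def rescale (p : Euc n) (t : ℝ) (Φ : Euc n → ℝ) (x : Euc n) : ℝ := Φ (t⁻¹ • (x - p))

lemma rescale_add_smul (p : Euc n) {t : ℝ} (ht : 0 < t) (Φ : Euc n → ℝ) (z : Euc n) :
    rescale p t Φ (p + t • z) = Φ z := by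
  rw [rescale, add_sub_cancel_left, smul_smul, inv_mul_cancel₀ ht.ne', one_smul]

lemma rescale_eq (p : Euc n) (t : ℝ) (Φ : Euc n → ℝ) :
    rescale p t Φ = fun x => Φ (-(t⁻¹ • p) + t⁻¹ • x) := by
  ext x
  rw [rescale]
  congr 1
  module

lemma rescale_contDiff (p : Euc n) (t : ℝ) {Φ : Euc n → ℝ} (hΦ : ContDiff ℝ ∞ Φ) :
    ContDiff ℝ ∞ (rescale p t Φ) := hΦ.comp (by fun_prop)

lemma rescale_eq_zero {p : Euc n} {t ρ : ℝ} (ht : 0 < t) {Φ : Euc n → ℝ}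
    (hΦ : ∀ z, z ∉ closedBall (0 : Euc n) ρ → Φ z = 0) {x : Euc n}
    (hx : x ∉ closedBall p (ρ * t)) : rescale p t Φ x = 0 := by
  refine hΦ _ fun h => hx ?_
  rw [mem_closedBall, dist_zero_right, norm_smul, norm_inv, Real.norm_of_nonneg ht.le,
    inv_mul_le_iff₀ ht] at h
  rw [mem_closedBall, dist_eq_norm]
  linarith

lemma rescale_hasCompactSupport (p : Euc n) {t ρ : ℝ} (ht : 0 < t) {Φ : Euc n → ℝ}
    (hΦ : ∀ z, z ∉ closedBall (0 : Euc n) ρ → Φ z = 0) : HasCompactSupport (rescale p t Φ) :=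
  HasCompactSupport.intro (isCompact_closedBall p (ρ * t)) fun _ hx => rescale_eq_zero ht hΦ hx

lemma fderiv_rescale_add_smul (p : Euc n) {t : ℝ} (ht : 0 < t) {Φ : Euc n → ℝ}
    (hΦ : ContDiff ℝ ∞ Φ) (z v : Euc n) :
    fderiv ℝ (rescale p t Φ) (p + t • z) v = t⁻¹ * fderiv ℝ Φ z v := by
  have h1 : HasFDerivAt (fun x : Euc n => t⁻¹ • (x - p))
      (t⁻¹ • ContinuousLinearMap.id ℝ (Euc n)) (p + t • z) :=
    ((hasFDerivAt_id (𝕜 := ℝ) (p + t • z)).sub_const p).const_smul t⁻¹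
  have e : t⁻¹ • (p + t • z - p) = z := by
    rw [add_sub_cancel_left, smul_smul, inv_mul_cancel₀ ht.ne', one_smul]
  have h2 : HasFDerivAt Φ (fderiv ℝ Φ z) (t⁻¹ • (p + t • z - p)) := by
    rw [e]
    exact ((hΦ.differentiable (by simp)) z).hasFDerivAt
  have h3 : HasFDerivAt (rescale p t Φ) _ (p + t • z) := h2.comp (p + t • z) h1
  rw [h3.fderiv]
  simp

lemma lapl_rescale_add_smul (p : Euc n) {t : ℝ} (ht : 0 < t) {Φ : Euc n → ℝ}
    (hΦ : ContDiff ℝ ∞ Φ) (z : Euc n) :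
    lapl (rescale p t Φ) (p + t • z) = (t⁻¹) ^ 2 * lapl Φ z := by
  have e : -(t⁻¹ • p) + t⁻¹ • (p + t • z) = z := by
    rw [smul_add, smul_smul, inv_mul_cancel₀ ht.ne', one_smul]
    abel
  rw [rescale_eq, lapl_comp_affine _ _ _ (hΦ.contDiffAt.of_le two_le_infty), e]

/-- The set `Ω` seen at scale `t` from the point `p`. -/
def zoomSet (Ω : Set (Euc n)) (p : Euc n) (t : ℝ) : Set (Euc n) := {z | p + t • z ∈ Ω}

lemma measurableSet_zoomSet {Ω : Set (Euc n)} (hΩ : IsOpen Ω) (p : Euc n) (t : ℝ) :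
    MeasurableSet (zoomSet Ω p t) :=
  (hΩ.preimage (f := fun z => p + t • z) (by fun_prop)).measurableSet

lemma setIntegral_eq_zoomSet {Ω : Set (Euc n)} (hΩ : IsOpen Ω) (p : Euc n) {t : ℝ} (ht : 0 < t)
    (f : Euc n → ℝ) : ∫ x in Ω, f x = t ^ n * ∫ z in zoomSet Ω p t, f (p + t • z) := by
  rw [← integral_indicator hΩ.measurableSet,
    ← integral_indicator (measurableSet_zoomSet hΩ p t), ← integral_comp_add_smul ht p]
  rfl

namespace ConvexBetween

variable [NeZero n] {r R : ℝ} {Ω : Set (Euc n)} (h : ConvexBetween r R Ω)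
include h

lemma integral_rescale_coneMeasure (p : Euc n) {t : ℝ} (ht : 0 < t) {Φ : Euc n → ℝ}
    (hΦ : ContDiff ℝ ∞ Φ) :
    t * (n * ∫ x, rescale p t Φ x ∂coneMeasure Ω)
      = t ^ n * ∫ z in zoomSet Ω p t, (n * t * Φ z + fderiv ℝ Φ z (p + t • z)) := by
  rw [h.integral_coneMeasure_eq ((rescale_contDiff p t hΦ).of_le (by simp)),
    setIntegral_eq_zoomSet h.isOpen p ht, mul_left_comm, ← integral_const_mul t]
  simp only [rescale_add_smul p ht, fderiv_rescale_add_smul p ht hΦ, mul_add,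
    mul_inv_cancel_left₀ ht.ne']
  congr 2
  ext z
  ring

lemma norm_le_of_mem_frontier {p : Euc n} (hp : p ∈ frontier Ω) : ‖p‖ ≤ R := by
  rw [← h.radProj_of_mem_frontier hp]
  exact h.norm_radProj_le p

lemma exists_coneMeasure_closedBall_le : ∃ C, 0 ≤ C ∧ ∀ p ∈ frontier Ω, ∀ t, 0 < t → t ≤ 1 →
    t * (coneMeasure Ω).real (closedBall p t) ≤ C * t ^ n := by
  have := h.isFiniteMeasure_coneMeasure
  have hn := natCast_pos_of_neZero (n := n)
  have hR := h.radius_pos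
  let f : ContDiffBump (0 : Euc n) := ⟨1, 2, one_pos, one_lt_two⟩
  have hf : ContDiff ℝ ∞ f := f.contDiff
  obtain ⟨D, hD⟩ := ContDiff.lipschitzWith_of_hasCompactSupport f.hasCompactSupport hf (by simp)
  have hf0 : ∀ z, z ∉ closedBall (0 : Euc n) 2 → f z = 0 := fun z hz =>
    f.zero_of_le_dist (by rw [mem_closedBall, not_le] at hz; exact hz.le)
  have hdf0 : ∀ z, z ∉ closedBall (0 : Euc n) 2 → fderiv ℝ f z = 0 := fun z hz => by
    have : f =ᶠ[𝓝 z] fun _ => (0 : ℝ) := by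
      filter_upwards [isClosed_closedBall.isOpen_compl.mem_nhds hz] with y hy using hf0 y hy
    rw [this.fderiv_eq, fderiv_const_apply]
  refine ⟨(n : ℝ)⁻¹ * ((n + D * (R + 2)) * (2 ^ n * ballVol n)),
    by have := ballVol_nonneg (n := n); positivity, fun p hp t ht ht1 => ?_⟩
  have hball : (coneMeasure Ω).real (closedBall p t) ≤ ∫ x, rescale p t f x ∂coneMeasure Ω := by
    rw [← integral_indicator_one measurableSet_closedBall]
    refine integral_mono ((integrable_const (1 : ℝ)).indicator measurableSet_closedBall)
      (h.integrable_coneMeasure (rescale_contDiff p t hf).continuous) fun x => ?_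
    by_cases hx : x ∈ closedBall p t
    · rw [indicator_of_mem hx, Pi.one_apply, rescale, f.one_of_mem_closedBall]
      rw [mem_closedBall, dist_zero_right, norm_smul, norm_inv, Real.norm_of_nonneg ht.le,
        inv_mul_le_iff₀ ht, ← dist_eq_norm]
      exact (mem_closedBall.1 hx).trans_eq (mul_one t).symm
    · rw [indicator_of_notMem hx]
      exact f.nonneg
  have hI := h.integral_rescale_coneMeasure p ht hf
  have hbd : |∫ z in zoomSet Ω p t, (n * t * f z + fderiv ℝ f z (p + t • z))|
      ≤ (n + D * (R + 2)) * (2 ^ n * ballVol n) := by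
    rw [← integral_indicator (measurableSet_zoomSet h.isOpen p t)]
    refine abs_integral_le_of_supp (a := 0) zero_le_two (fun z hz => ?_) fun z hz => ?_
    · refine indicator_apply_eq_zero.2 fun _ => ?_
      rw [hf0 z hz, hdf0 z hz]
      simp
    · have hpz : ‖p + t • z‖ ≤ R + 2 := by
        refine (norm_add_le _ _).trans (add_le_add (h.norm_le_of_mem_frontier hp) ?_)
        rw [mem_closedBall, dist_zero_right] at hz
        rw [norm_smul, Real.norm_of_nonneg ht.le]
        nlinarith [norm_nonneg z]
      have h1 : |fderiv ℝ f z (p + t • z)| ≤ D * (R + 2) :=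
        ((fderiv ℝ f z).le_of_opNorm_le (norm_fderiv_le_of_lipschitz ℝ hD) _).trans
          (mul_le_mul_of_nonneg_left hpz D.2)
      have h2 : |n * t * f z| ≤ n := by
        rw [abs_of_nonneg (by have := f.nonneg (x := z); positivity), mul_assoc]
        exact mul_le_of_le_one_right hn.le (mul_le_one₀ ht1 f.nonneg f.le_one)
      have h3 : (0 : ℝ) ≤ n + D * (R + 2) := by positivity
      by_cases hz' : z ∈ zoomSet Ω p t
      · rw [indicator_of_mem hz']
        exact (abs_add_le _ _).trans (add_le_add h2 h1)
      · rw [indicator_of_notMem hz', abs_zero]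
        exact h3
  have h5 : t * (n * (coneMeasure Ω).real (closedBall p t)) ≤
      t ^ n * ((n + D * (R + 2)) * (2 ^ n * ballVol n)) := by
    refine le_trans (mul_le_mul_of_nonneg_left (mul_le_mul_of_nonneg_left hball hn.le) ht.le) ?_
    rw [hI]
    exact mul_le_mul_of_nonneg_left ((le_abs_self _).trans hbd) (by positivity)
  rw [mul_assoc, ← div_eq_inv_mul, le_div_iff₀ hn]
  linarith

lemma eventually_mem_zoomSet_iff {p z : Euc n} (hd : DifferentiableAt ℝ (gauge Ω) p)
    (hp : p ∈ frontier Ω) (hz : ⟪gaugeGrad Ω p, z⟫ ≠ 0) :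
    ∀ᶠ t in 𝓝[>] (0 : ℝ), (z ∈ zoomSet Ω p t ↔ z ∈ halfSpace (gaugeGrad Ω p)) := by
  have hgp := (h.mem_frontier_iff p).1 hp
  rcases hz.lt_or_gt with hneg | hpos
  · have h1 : HasDerivAt (fun t : ℝ => gauge Ω (p + t • z)) (⟪gaugeGrad Ω p, z⟫) 0 := by
      have h2 : HasFDerivAt (gauge Ω) (fderiv ℝ (gauge Ω) p) (p + (0 : ℝ) • z) := by
        rw [zero_smul, add_zero]; exact hd.hasFDerivAt
      rw [inner_gaugeGrad]
      exact h2.comp_hasDerivAt (0 : ℝ) (hasDerivAt_add_smul p z 0)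
    have h2 := (hasDerivAt_iff_tendsto_slope.1 h1).mono_left
      (nhdsWithin_mono (0 : ℝ) fun t (ht : 0 < t) => ht.ne')
    filter_upwards [h2.eventually_lt_const hneg, self_mem_nhdsWithin] with t ht (ht0 : 0 < t)
    refine iff_of_true ?_ hneg
    rw [slope_def_field, zero_smul, add_zero, hgp, sub_zero, div_neg_iff] at ht
    exact (h.mem_iff _).2 (by rcases ht with ht | ht <;> linarith)
  · filter_upwards [self_mem_nhdsWithin] with t (ht0 : 0 < t)
    refine iff_of_false (fun hmem => ?_) (not_lt.2 hpos.le)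
    have h1 := (h.mem_iff _).1 hmem
    have h2 := h.inner_gaugeGrad_le hd (p + t • z)
    rw [inner_add_right, inner_smul_right, h.inner_gaugeGrad_self hd, hgp] at h2
    nlinarith

lemma tendsto_integral_zoomSet {p : Euc n} (hd : DifferentiableAt ℝ (gauge Ω) p)
    (hp : p ∈ frontier Ω) {Φ : Euc n → ℝ} (hΦ : ContDiff ℝ ∞ Φ) (hc : HasCompactSupport Φ) :
    Tendsto (fun t : ℝ => ∫ z in zoomSet Ω p t, (n * t * Φ z + fderiv ℝ Φ z (p + t • z)))
      (𝓝[>] 0) (𝓝 (∫ z in halfSpace (gaugeGrad Ω p), fderiv ℝ Φ z p)) := by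
  have hn := natCast_pos_of_neZero (n := n)
  have hG : gaugeGrad Ω p ≠ 0 :=
    norm_pos_iff.1 (h.norm_gaugeGrad_pos hd (h.ne_zero_of_mem_frontier hp))
  have hfd : Continuous (fderiv ℝ Φ) := hΦ.continuous_fderiv (by simp)
  simp_rw [← integral_indicator (measurableSet_zoomSet h.isOpen p _),
    ← integral_indicator (isOpen_halfSpace (gaugeGrad Ω p)).measurableSet]
  refine tendsto_integral_filter_of_dominated_convergence
    (fun z => n * |Φ z| + ‖fderiv ℝ Φ z‖ * (‖p‖ + ‖z‖)) ?_ ?_ ?_ ?_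
  · refine Eventually.of_forall fun t => ?_
    exact (Continuous.aestronglyMeasurable (by fun_prop)).indicator
      (measurableSet_zoomSet h.isOpen p t)
  · filter_upwards [Ioo_mem_nhdsGT (zero_lt_one' ℝ)] with t ht
    refine Eventually.of_forall fun z => (norm_indicator_le_norm_self _ _).trans ?_
    refine (norm_add_le _ _).trans (add_le_add ?_ ?_)
    · rw [norm_mul, norm_mul, Real.norm_of_nonneg hn.le, Real.norm_of_nonneg ht.1.le,
        Real.norm_eq_abs]
      exact mul_le_mul_of_nonneg_right (mul_le_of_le_one_right hn.le ht.2.le) (abs_nonneg _)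
    · refine ((fderiv ℝ Φ z).le_opNorm _).trans (mul_le_mul_of_nonneg_left ?_ (norm_nonneg _))
      refine (norm_add_le _ _).trans (add_le_add le_rfl ?_)
      rw [norm_smul, Real.norm_of_nonneg ht.1.le]
      exact mul_le_of_le_one_left (norm_nonneg _) ht.2.le
  · refine (Continuous.integrable_of_hasCompactSupport (by fun_prop) ?_)
    refine HasCompactSupport.add ?_ ?_
    · exact (hc.comp_left (g := fun s : ℝ => |s|) abs_zero).mul_left
    · exact ((hc.fderiv ℝ).comp_left (g := fun s => ‖s‖) norm_zero).mul_right
  · filter_upwards [ae_inner_ne_zero hG] with z hz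
    have h1 : Tendsto (fun t : ℝ => n * t * Φ z + fderiv ℝ Φ z (p + t • z)) (𝓝[>] 0)
        (𝓝 (fderiv ℝ Φ z p)) := by
      have : Tendsto (fun t : ℝ => n * t * Φ z + fderiv ℝ Φ z (p + t • z)) (𝓝 0)
          (𝓝 (n * 0 * Φ z + fderiv ℝ Φ z (p + (0 : ℝ) • z))) :=
        Continuous.tendsto (by fun_prop) 0
      simpa using this.mono_left nhdsWithin_le_nhds
    by_cases hz' : z ∈ halfSpace (gaugeGrad Ω p)
    · rw [indicator_of_mem hz']
      refine h1.congr' ?_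
      filter_upwards [h.eventually_mem_zoomSet_iff hd hp hz] with t ht
      rw [indicator_of_mem (ht.2 hz')]
    · rw [indicator_of_notMem hz']
      refine tendsto_const_nhds.congr' ?_
      filter_upwards [h.eventually_mem_zoomSet_iff hd hp hz] with t ht
      rw [indicator_of_notMem (mt ht.1 hz')]

end ConvexBetween

/-- `p` is a Lebesgue point of `F` with respect to the cone measure of `Ω`, with the averages
normalised by the surface area of the balls. -/
def IsBdryLebesguePt (Ω : Set (Euc n)) (F : Euc n → ℝ) (p : Euc n) : Prop :=
  Tendsto (fun t : ℝ => t / t ^ n * ∫ x in closedBall p t, |F x - F p| ∂coneMeasure Ω)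
    (𝓝[>] 0) (𝓝 0)

/-- The torsion function seen at scale `t` from `p`. -/
def blowup (u : Euc n → ℝ) (p : Euc n) (t : ℝ) (z : Euc n) : ℝ := t⁻¹ * u (p + t • z)

section

variable [NeZero n] {L r R : ℝ} {Ω : Set (Euc n)} (h : ConvexBetween r R Ω) {u F : Euc n → ℝ}
  (hu : IsLipTorsion L Ω u) (hFm : Measurable F) (hF : MemLp F 2 (coneMeasure Ω))
  (hrep : ∀ φ : Euc n → ℝ, ContDiff ℝ ∞ φ → HasCompactSupport φ →
    bdryFn Ω u φ = ∫ x, φ x * F x ∂coneMeasure Ω)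

include h

lemma ConvexBetween.ae_isBdryLebesguePt (hF : MemLp F 2 (coneMeasure Ω)) :
    ∀ᵐ p ∂coneMeasure Ω, IsBdryLebesguePt Ω F p := by
  have := h.isFiniteMeasure_coneMeasure
  have hFi : Integrable F (coneMeasure Ω) := hF.integrable one_le_two
  obtain ⟨C, hC0, hC⟩ := h.exists_coneMeasure_closedBall_le
  filter_upwards [(Besicovitch.vitaliFamily (coneMeasure Ω)).ae_tendsto_average_norm_sub
    hFi.locallyIntegrable, h.ae_coneMeasure_mem_frontier] with p hp hpf
  have h1 := (hp.comp (Besicovitch.tendsto_filterAt (coneMeasure Ω) p)).const_mul C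
  rw [mul_zero] at h1
  refine squeeze_zero' ?_ ?_ h1
  · filter_upwards [self_mem_nhdsWithin] with t (ht : 0 < t)
    have : 0 ≤ ∫ x in closedBall p t, |F x - F p| ∂coneMeasure Ω :=
      integral_nonneg fun _ => abs_nonneg _
    positivity
  · filter_upwards [Ioo_mem_nhdsGT (zero_lt_one' ℝ)] with t ht
    have hb := hC p hpf t ht.1 ht.2.le
    have hA : 0 ≤ ⨍ x in closedBall p t, ‖F x - F p‖ ∂coneMeasure Ω :=
      integral_nonneg fun _ => norm_nonneg _
    have e : ∫ x in closedBall p t, |F x - F p| ∂coneMeasure Ω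
        = (coneMeasure Ω).real (closedBall p t) *
          ⨍ x in closedBall p t, ‖F x - F p‖ ∂coneMeasure Ω := by
      rw [← smul_eq_mul, measure_smul_setAverage _ (measure_lt_top _ _).ne]
      rfl
    rw [e, Function.comp_apply, ← mul_assoc]
    refine mul_le_mul_of_nonneg_right ?_ hA
    rw [div_mul_eq_mul_div, div_le_iff₀ (pow_pos ht.1 n)]
    exact hb

omit [NeZero n] h in
lemma integral_mul_lapl_rescale (p : Euc n) {t : ℝ} (ht : 0 < t) {Φ : Euc n → ℝ}
    (hΦ : ContDiff ℝ ∞ Φ) :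
    ∫ x, u x * lapl (rescale p t Φ) x = t ^ n / t * ∫ z, blowup u p t z * lapl Φ z := by
  rw [← integral_comp_add_smul ht p, div_eq_mul_inv, mul_assoc, ← integral_const_mul t⁻¹]
  congr 1
  refine integral_congr_ae (Eventually.of_forall fun z => ?_)
  simp only [lapl_rescale_add_smul p ht hΦ, blowup]
  field_simp

omit [NeZero n] h in
lemma blowup_zero (hu : IsLipTorsion L Ω u) {p : Euc n} (hp : p ∉ Ω) (t : ℝ) :
    blowup u p t 0 = 0 := by
  rw [blowup, smul_zero, add_zero, hu.zero_outside p hp, mul_zero]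

omit [NeZero n] h in
lemma abs_blowup_sub_le (hu : IsLipTorsion L Ω u) (p : Euc n) {t : ℝ} (ht : 0 < t) (y z : Euc n) :
    |blowup u p t y - blowup u p t z| ≤ L * ‖y - z‖ := by
  have h1 := hu.lip (p + t • y) (p + t • z)
  rw [add_sub_add_left_eq_sub, ← smul_sub, norm_smul, Real.norm_of_nonneg ht.le] at h1
  rw [blowup, blowup, ← mul_sub, abs_mul, abs_inv, abs_of_pos ht, inv_mul_le_iff₀ ht]
  linarith

include hF hrep

lemma ConvexBetween.tendsto_integral_blowup {p : Euc n} (hd : DifferentiableAt ℝ (gauge Ω) p)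
    (hp : p ∈ frontier Ω) (hL : IsBdryLebesguePt Ω F p) {Φ : Euc n → ℝ} (hΦ : ContDiff ℝ ∞ Φ)
    (hc : HasCompactSupport Φ) :
    Tendsto (fun t => ∫ z, blowup u p t z * lapl Φ z) (𝓝[>] 0)
      (𝓝 (F p / (n * ‖gaugeGrad Ω p‖ ^ 2) * ∫ z, halfProfile (gaugeGrad Ω p) z * lapl Φ z)) := by
  have := h.isFiniteMeasure_coneMeasure
  have hn := natCast_pos_of_neZero (n := n)
  have hFi : Integrable F (coneMeasure Ω) := hF.integrable one_le_two
  have hb := h.norm_gaugeGrad_pos hd (h.ne_zero_of_mem_frontier hp)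
  obtain ⟨B, hB0, hB⟩ := exists_abs_le_of_hasCompactSupport hΦ.continuous hc
  obtain ⟨ρ', hρ'⟩ := (isBounded_iff_subset_closedBall (0 : Euc n)).1 hc.isCompact.isBounded
  set ρ := max ρ' 1 with hρdef
  have hρ : 0 < ρ := lt_max_of_lt_right one_pos
  have hΦ0 : ∀ z, z ∉ closedBall (0 : Euc n) ρ → Φ z = 0 := fun z hz =>
    image_eq_zero_of_notMem_tsupport fun hz' => hz
      (closedBall_subset_closedBall (le_max_left _ _) (hρ' hz'))
  have hJ := h.tendsto_integral_zoomSet hd hp hΦ hc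
  have hv : ⟪gaugeGrad Ω p, p⟫ = 1 := by
    rw [h.inner_gaugeGrad_self hd, (h.mem_frontier_iff p).1 hp]
  rw [integral_halfProfile_mul_lapl hv hΦ hc]
  set J : ℝ → ℝ := fun t => ∫ z in zoomSet Ω p t, (n * t * Φ z + fderiv ℝ Φ z (p + t • z))
  set J0 := ∫ z in halfSpace (gaugeGrad Ω p), fderiv ℝ Φ z p
  set err : ℝ → ℝ := fun t => t / t ^ n * ∫ x, rescale p t Φ x * (F x - F p) ∂coneMeasure Ω
  set vol : ℝ → ℝ := fun t => 2 * t * ∫ z in zoomSet Ω p t, Φ z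
  have hvol : Tendsto vol (𝓝[>] 0) (𝓝 0) := by
    have hI : Integrable Φ := hΦ.continuous.integrable_of_hasCompactSupport hc
    refine squeeze_zero_norm' (a := fun t : ℝ => 2 * t * ∫ z, |Φ z|) ?_ ?_
    · filter_upwards [self_mem_nhdsWithin] with t (ht : 0 < t)
      rw [norm_mul, Real.norm_of_nonneg (by positivity)]
      refine mul_le_mul_of_nonneg_left ?_ (by positivity)
      exact (norm_integral_le_integral_norm _).trans
        (setIntegral_le_integral hI.norm (Eventually.of_forall fun _ => norm_nonneg _))
    · have : Tendsto (fun t : ℝ => 2 * t * ∫ z, |Φ z|) (𝓝 0) (𝓝 (2 * 0 * ∫ z, |Φ z|)) :=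
        Continuous.tendsto (by fun_prop) 0
      simpa using this.mono_left nhdsWithin_le_nhds
  have herr : Tendsto err (𝓝[>] 0) (𝓝 0) := by
    have hs : Tendsto (fun t : ℝ => ρ * t) (𝓝[>] 0) (𝓝[>] 0) := by
      refine tendsto_nhdsWithin_iff.2 ⟨?_, ?_⟩
      · have : Tendsto (fun t : ℝ => ρ * t) (𝓝 0) (𝓝 (ρ * 0)) := Continuous.tendsto (by fun_prop) 0
        simpa using this.mono_left nhdsWithin_le_nhds
      · filter_upwards [self_mem_nhdsWithin] with t (ht : 0 < t)
        exact mul_pos hρ ht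
    have h1 := (hL.comp hs).const_mul (B * (ρ ^ n / ρ))
    rw [mul_zero] at h1
    refine squeeze_zero_norm' ?_ h1
    filter_upwards [self_mem_nhdsWithin] with t (ht : 0 < t)
    have h2 : ‖∫ x, rescale p t Φ x * (F x - F p) ∂coneMeasure Ω‖
        ≤ B * ∫ x in closedBall p (ρ * t), |F x - F p| ∂coneMeasure Ω := by
      rw [← setIntegral_eq_integral_of_forall_compl_eq_zero (s := closedBall p (ρ * t))
        (fun x hx => by rw [rescale_eq_zero ht hΦ0 hx, zero_mul]), ← integral_const_mul]
      refine norm_integral_le_of_norm_le ?_ (Eventually.of_forall fun x => ?_)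
      · exact ((hFi.sub (integrable_const _)).norm.const_mul B).integrableOn
      · rw [norm_mul]
        exact mul_le_mul_of_nonneg_right (hB _) (norm_nonneg _)
    rw [norm_mul, Real.norm_of_nonneg (by positivity)]
    refine (mul_le_mul_of_nonneg_left h2 (by positivity)).trans_eq ?_
    rw [Function.comp_apply, mul_pow]
    field_simp
  have key : ∀ᶠ t in 𝓝[>] (0 : ℝ), F p / n * J t + err t - vol t
      = ∫ z, blowup u p t z * lapl Φ z := by
    filter_upwards [self_mem_nhdsWithin] with t (ht : 0 < t)
    have hsm := rescale_contDiff p t hΦ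
    have e1 := hrep _ hsm (rescale_hasCompactSupport p ht hΦ0)
    rw [bdryFn, integral_mul_lapl_rescale p ht hΦ, setIntegral_eq_zoomSet h.isOpen p ht] at e1
    simp only [rescale_add_smul p ht] at e1
    have e2 := h.integral_rescale_coneMeasure p ht hΦ
    have i1 := h.integrable_coneMeasure hsm.continuous
    have e3 : ∫ x, rescale p t Φ x * (F x - F p) ∂coneMeasure Ω
        = (∫ x, rescale p t Φ x * F x ∂coneMeasure Ω)
          - F p * ∫ x, rescale p t Φ x ∂coneMeasure Ω := by
      rw [← integral_const_mul, ← integral_sub _ (i1.const_mul _)]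
      · congr 1
        ext x
        ring
      · exact hFi.bdd_mul (c := B) hsm.continuous.aestronglyMeasurable
          (Eventually.of_forall fun x => hB _)
    change F p / n * J t + t / t ^ n * _ - 2 * t * _ = _
    rw [e3, ← e1]
    have ht' := ht.ne'
    change t * (n * _) = t ^ n * J t at e2
    generalize ∫ x, rescale p t Φ x ∂coneMeasure Ω = A at *
    generalize ∫ z, blowup u p t z * lapl Φ z = A' at *
    generalize ∫ z in zoomSet Ω p t, Φ z = A'' at *
    have e4 : J t = t * (n * A) / t ^ n := by rw [e2]; field_simp
    rw [e4]
    field_simp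
    ring
  have hlim := ((hJ.const_mul (F p / n)).add herr).sub hvol
  rw [add_zero, sub_zero] at hlim
  refine (hlim.congr' key).trans (le_of_eq ?_)
  congr 1
  field_simp

end

/-- A family of equi-Lipschitz functions vanishing at the origin and whose Laplacians tend to zero
in the sense of distributions tends to zero wherever it vanishes at the opposite point. -/
lemma tendsto_zero_of_lapl [NeZero n] {ι : Type*} {l : Filter ι} {w : ι → Euc n → ℝ} {M : ℝ}
    (hM : 0 ≤ M) (hlip : ∀ᶠ t in l, ∀ y z, |w t y - w t z| ≤ M * ‖y - z‖)
    (h0 : ∀ᶠ t in l, w t 0 = 0)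
    (hlap : ∀ Φ : Euc n → ℝ, ContDiff ℝ ∞ Φ → HasCompactSupport Φ →
      Tendsto (fun t => ∫ z, w t z * lapl Φ z) l (𝓝 0))
    {a : Euc n} (ha : ∀ᶠ t in l, w t (-a) = 0) : Tendsto (fun t => w t a) l (𝓝 0) := by
  obtain ⟨C, hC0, hC⟩ := exists_avg_secondDiff (n := n)
  rw [Metric.tendsto_nhds]
  intro ε hε
  obtain ⟨δ, hδ, hδε⟩ : ∃ δ : ℝ, 0 < δ ∧ 4 * (M * δ) < ε / 4 := by
    refine ⟨ε / (16 * (M + 1)) / 2, by positivity, ?_⟩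
    have e : 4 * (M * (ε / (16 * (M + 1)) / 2)) = ε / 8 * (M / (M + 1)) := by
      field_simp
      ring
    have h1 : M / (M + 1) ≤ 1 := (div_le_one (by positivity)).2 (by linarith)
    rw [e]
    nlinarith
  obtain ⟨R, hRδ, hRa, hRε⟩ : ∃ R : ℝ, δ ≤ R ∧ ‖a‖ ≤ R ∧ C * M * ‖a‖ ^ 2 / R < ε / 4 := by
    have h1 : Tendsto (fun R : ℝ => C * M * ‖a‖ ^ 2 / R) atTop (𝓝 0) :=
      tendsto_const_nhds.div_atTop tendsto_id
    obtain ⟨R, ⟨h1, h2⟩, h3⟩ := ((eventually_ge_atTop δ).and (eventually_ge_atTop ‖a‖)).and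
      (h1.eventually (gt_mem_nhds (by positivity : (0 : ℝ) < ε / 4))) |>.exists
    exact ⟨R, h1, h2, h3⟩
  have hR : 0 < R := hδ.trans_le hRδ
  obtain ⟨Ψ, hΨ, hΨ0, hΨl⟩ := exists_lapl_eq_avKer_sub (n := n) hδ hRδ
  have hD : ∀ y : Euc n, ∀ᶠ t in l, |avg R (w t) y - avg δ (w t) y| < ε / 16 := by
    intro y
    have hs : ContDiff ℝ ∞ fun z : Euc n => Ψ (y + (-1 : ℝ) • z) :=
      hΨ.comp (by fun_prop : ContDiff ℝ ∞ fun z : Euc n => y + (-1 : ℝ) • z)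
    have hc : HasCompactSupport fun z : Euc n => Ψ (y + (-1 : ℝ) • z) := by
      refine HasCompactSupport.intro (isCompact_closedBall y R) fun z hz => hΨ0 _ ?_
      rw [mem_closedBall, dist_eq_norm, norm_sub_rev] at hz
      rw [neg_one_smul, ← sub_eq_add_neg]
      linarith
    have h1 := (hlap _ hs hc).eventually (Metric.ball_mem_nhds _ (by positivity : 0 < ε / 16))
    filter_upwards [h1, hlip] with t ht hl
    have hw : Continuous (w t) := (LipschitzWith.of_dist_le_mul (K := ⟨M, hM⟩)
      fun y z => by rw [Real.dist_eq, dist_eq_norm]; exact hl y z).continuous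
    rw [Real.dist_eq, sub_zero] at ht
    convert ht using 2
    rw [avg, avg, ← integral_sub (avg_integrable hR hw y) (avg_integrable hδ hw y)]
    congr 1
    ext z
    rw [lapl_comp_affine y (-1) z (hΨ.contDiffAt.of_le two_le_infty), hΨl, neg_one_smul,
      ← sub_eq_add_neg]
    ring
  filter_upwards [hlip, h0, ha, hD a, hD (-a), hD 0] with t hl h0 ha d1 d2 d3
  have hw : Continuous (w t) := (LipschitzWith.of_dist_le_mul (K := ⟨M, hM⟩)
    fun y z => by rw [Real.dist_eq, dist_eq_norm]; exact hl y z).continuous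
  have hb : ∀ z, |w t z| ≤ M * ‖z‖ := fun z => by simpa [h0] using hl z 0
  have k := hC (w t) M R a hw hb hM hR hRa
  have k1 := abs_avg_sub_le_of_lipschitz hδ hl hw hM a
  have k2 := abs_avg_sub_le_of_lipschitz hδ hl hw hM (-a)
  have k3 := abs_avg_sub_le_of_lipschitz hδ hl hw hM 0
  rw [Real.dist_eq, sub_zero]
  rw [h0] at k3
  rw [ha] at k2
  rw [abs_lt] at *
  rw [abs_le] at *
  constructor <;> linarith [k.1, k.2, k1.1, k1.2, k2.1, k2.2, k3.1, k3.2, d1.1, d1.2, d2.1, d2.2,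
    d3.1, d3.2]

lemma eventually_abs_le_of_isCompact {ι : Type*} {l : Filter ι} {w : ι → Euc n → ℝ} {M : ℝ}
    (hM : 0 ≤ M) (hlip : ∀ᶠ t in l, ∀ y z, |w t y - w t z| ≤ M * ‖y - z‖) {K : Set (Euc n)}
    (hK : IsCompact K) (hw : ∀ a ∈ K, Tendsto (fun t => w t a) l (𝓝 0)) {ε : ℝ} (hε : 0 < ε) :
    ∀ᶠ t in l, ∀ a ∈ K, |w t a| ≤ ε := by
  obtain ⟨s, hsK, hsf, hcov⟩ := hK.finite_cover_balls (e := ε / 2 / (M + 1)) (by positivity)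
  have h1 : ∀ᶠ t in l, ∀ a ∈ s, |w t a| < ε / 2 := by
    refine (eventually_all_finite hsf).2 fun a ha => ?_
    have := (hw a (hsK ha)).eventually (Metric.ball_mem_nhds _ (by positivity : 0 < ε / 2))
    simpa [Real.dist_eq] using this
  filter_upwards [h1, hlip] with t ht hl a ha
  obtain ⟨b, hb, hab⟩ := mem_iUnion₂.1 (hcov ha)
  rw [Metric.mem_ball, dist_eq_norm, lt_div_iff₀ (by positivity)] at hab
  have k1 := ht b hb
  have k2 := hl a b
  have k3 : |w t a| ≤ |w t a - w t b| + |w t b| := by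
    simpa using abs_add_le (w t a - w t b) (w t b)
  nlinarith [norm_nonneg (a - b)]

namespace ConvexBetween

variable [NeZero n] {L r R : ℝ} {Ω : Set (Euc n)} (h : ConvexBetween r R Ω) {u F : Euc n → ℝ}
  (hu : IsLipTorsion L Ω u) (hF : MemLp F 2 (coneMeasure Ω))
  (hrep : ∀ φ : Euc n → ℝ, ContDiff ℝ ∞ φ → HasCompactSupport φ →
    bdryFn Ω u φ = ∫ x, φ x * F x ∂coneMeasure Ω)
  {p : Euc n} (hd : DifferentiableAt ℝ (gauge Ω) p) (hp : p ∈ frontier Ω)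

include h hd hp

lemma notMem_of_inner_nonneg {x : Euc n} (hx : 0 ≤ ⟪gaugeGrad Ω p, x - p⟫) : x ∉ Ω := by
  rw [h.mem_iff, not_lt]
  have := h.gauge_add_inner_le hd x
  rw [(h.mem_frontier_iff p).1 hp] at this
  linarith

lemma notMem_self : p ∉ Ω :=
  h.notMem_of_inner_nonneg hd hp (by rw [sub_self, inner_zero_right])

include hu

lemma abs_blowup_sub_halfProfile_sub_le (m : ℝ) {t : ℝ} (ht : 0 < t) (y z : Euc n) :
    |blowup u p t y - m * halfProfile (gaugeGrad Ω p) y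
      - (blowup u p t z - m * halfProfile (gaugeGrad Ω p) z)|
      ≤ (L + |m| * ‖gaugeGrad Ω p‖) * ‖y - z‖ := by
  have h1 := abs_blowup_sub_le hu p ht y z
  have h2 := mul_le_mul_of_nonneg_left (abs_halfProfile_sub_le (gaugeGrad Ω p) y z) (abs_nonneg m)
  rw [← abs_mul] at h2
  have h3 := abs_sub (blowup u p t y - blowup u p t z)
    (m * (halfProfile (gaugeGrad Ω p) y - halfProfile (gaugeGrad Ω p) z))
  calc _ = |(blowup u p t y - blowup u p t z)
      - m * (halfProfile (gaugeGrad Ω p) y - halfProfile (gaugeGrad Ω p) z)| := by congr 1; ring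
    _ ≤ _ := by linarith

include hF hrep

/-- At a boundary Lebesgue point, the blow-ups of the torsion function converge to a multiple of
the profile of the supporting half-space. -/
lemma tendsto_blowup (hL : IsBdryLebesguePt Ω F p) {a : Euc n} (ha : ⟪gaugeGrad Ω p, a⟫ < 0) :
    Tendsto (fun t => blowup u p t a) (𝓝[>] 0)
      (𝓝 (F p / (n * ‖gaugeGrad Ω p‖ ^ 2) * halfProfile (gaugeGrad Ω p) a)) := by
  set G := gaugeGrad Ω p
  set m := F p / (n * ‖G‖ ^ 2)
  have hL0 : 0 ≤ L := hu.lip_nonneg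
  rw [← tendsto_sub_nhds_zero_iff]
  refine tendsto_zero_of_lapl (w := fun t z => blowup u p t z - m * halfProfile G z)
    (M := L + |m| * ‖G‖) (by positivity) ?_ ?_ ?_ ?_
  · filter_upwards [self_mem_nhdsWithin] with t (ht : 0 < t) y z
    exact h.abs_blowup_sub_halfProfile_sub_le hu hd hp m ht y z
  · refine Eventually.of_forall fun t => ?_
    rw [blowup_zero hu (h.notMem_self hd hp), halfProfile_of_nonneg (by rw [inner_zero_right]),
      mul_zero, sub_zero]
  · intro Φ hΦ hc
    have h1 := h.tendsto_integral_blowup hF hrep hd hp hL hΦ hc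
    rw [← tendsto_sub_nhds_zero_iff] at h1
    refine h1.congr' ?_
    filter_upwards [self_mem_nhdsWithin] with t (ht : 0 < t)
    have hlc : Continuous (lapl Φ) := (lapl_contDiff hΦ).continuous
    have hbc : Continuous (blowup u p t) := by
      have := hu.continuous
      unfold blowup
      fun_prop
    rw [← integral_const_mul, ← integral_sub]
    · congr 1
      ext z
      ring
    · exact (hbc.mul hlc).integrable_of_hasCompactSupport hc.lapl.mul_left
    · exact (((lipschitzWith_halfProfile G).continuous.mul hlc).integrable_of_hasCompactSupport
        hc.lapl.mul_left).const_mul m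
  · filter_upwards [self_mem_nhdsWithin] with t (ht : 0 < t)
    rw [halfProfile_of_nonneg (by rw [inner_neg_right]; linarith), mul_zero, sub_zero, blowup,
      hu.zero_outside, mul_zero]
    refine h.notMem_of_inner_nonneg hd hp ?_
    rw [add_sub_cancel_left, inner_smul_right, inner_neg_right]
    exact mul_nonneg ht.le (by linarith)

end ConvexBetween

lemma WeaklyHarmonic.add_affine {U : Set (Euc n)} (hU : IsOpen U) {w : Euc n → ℝ}
    (hw : Continuous w) (h : WeaklyHarmonic U w) (v : Euc n) (c : ℝ) :
    WeaklyHarmonic U fun x => w x + (⟪x, v⟫ + c) := by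
  intro φ hφ hc hs
  have h1 : ContDiff ℝ 2 fun x : Euc n => ⟪x, v⟫ + c :=
    (contDiff_id.inner ℝ contDiff_const).add contDiff_const
  have hlc : Continuous (lapl φ) := (lapl_contDiff hφ).continuous
  have h2 := integral_mul_lapl_eq hU h1.contDiffOn hφ hc hs
  simp only [lapl_inner, zero_mul, integral_zero] at h2
  have h3 := h φ hφ hc hs
  simp only [add_mul (w _)]
  have i1 : Integrable fun x => w x * lapl φ x :=
    (hw.mul hlc).integrable_of_hasCompactSupport hc.lapl.mul_left
  have i2 : Integrable fun x : Euc n => (⟪x, v⟫ + c) * lapl φ x :=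
    (h1.continuous.mul hlc).integrable_of_hasCompactSupport hc.lapl.mul_left
  rw [integral_add i1 i2, h2, h3, add_zero]

namespace ConvexBetween

section

variable [NeZero n] {r R : ℝ} {Ω : Set (Euc n)} (h : ConvexBetween r R Ω)
include h

lemma ball_infDist_frontier_subset {y : Euc n} (hy : y ∈ Ω) :
    ball y (infDist y (frontier Ω)) ⊆ Ω := by
  intro z hz
  by_contra hzΩ
  rw [h.mem_iff, not_lt] at hzΩ
  have hpos : 0 < infDist y (frontier Ω) := dist_nonneg.trans_lt hz
  obtain ⟨x, hx, hx1⟩ := (convex_ball y (infDist y (frontier Ω))).isPreconnected.intermediate_value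
    (mem_ball_self hpos) hz h.continuous_gauge.continuousOn ⟨((h.mem_iff y).1 hy).le, hzΩ⟩
  have := infDist_le_dist_of_mem (x := y) ((h.mem_frontier_iff x).2 hx1)
  rw [mem_ball, dist_comm] at hx
  linarith

lemma smul_mem_ntCone {p : Euc n} (hp : p ∈ frontier Ω) {s : ℝ} (hs0 : 0 < s) (hs1 : s < 1) :
    s • p ∈ ntCone Ω p (R / r) := by
  have hr := h.pos
  have hg : gauge Ω (s • p) = s := by
    rw [gauge_smul_nonneg Ω hs0.le, (h.mem_frontier_iff p).1 hp, mul_one]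
  refine ⟨(h.mem_iff _).2 (hg.trans_lt hs1), ?_⟩
  have h1 : dist (s • p) p ≤ (1 - s) * R := by
    have : s • p - p = (s - 1) • p := by module
    rw [dist_eq_norm, this, norm_smul, Real.norm_eq_abs, abs_sub_comm, abs_of_pos (by linarith)]
    exact mul_le_mul_of_nonneg_left (h.norm_le_of_mem_frontier hp) (by linarith)
  have h2 : (1 - s) * r ≤ infDist (s • p) (frontier Ω) := by
    refine (le_infDist ⟨p, hp⟩).2 fun q hq => ?_
    have := h.abs_gauge_sub_le q (s • p)
    rw [(h.mem_frontier_iff q).1 hq, hg, abs_of_pos (by linarith), le_div_iff₀ hr] at this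
    rwa [dist_comm, dist_eq_norm]
  have hR := h.radius_pos
  calc dist (s • p) p ≤ (1 - s) * R := h1
    _ ≤ (1 + R / r) * ((1 - s) * r) := by
      field_simp
      nlinarith
    _ ≤ _ := mul_le_mul_of_nonneg_left h2 (by positivity)

lemma neBot_ntCone {p : Euc n} (hp : p ∈ frontier Ω) :
    (𝓝[ntCone Ω p (R / r)] p).NeBot := by
  have h1 : Tendsto (fun s : ℝ => s • p) (𝓝[<] 1) (𝓝[ntCone Ω p (R / r)] p) := by
    refine tendsto_nhdsWithin_iff.2 ⟨?_, ?_⟩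
    · have : Tendsto (fun s : ℝ => s • p) (𝓝 1) (𝓝 ((1 : ℝ) • p)) :=
        Continuous.tendsto (by fun_prop) 1
      rw [one_smul] at this
      exact this.mono_left nhdsWithin_le_nhds
    · filter_upwards [Ioo_mem_nhdsLT (zero_lt_one' ℝ)] with s hs
      exact h.smul_mem_ntCone hp hs.1 hs.2
  exact NeBot.of_map (NeBot.mono inferInstance h1)

end

variable [NeZero n] {L r R : ℝ} {Ω : Set (Euc n)} (h : ConvexBetween r R Ω) {u F : Euc n → ℝ}
  (hu : IsLipTorsion L Ω u) (hF : MemLp F 2 (coneMeasure Ω))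
  (hrep : ∀ φ : Euc n → ℝ, ContDiff ℝ ∞ φ → HasCompactSupport φ →
    bdryFn Ω u φ = ∫ x, φ x * F x ∂coneMeasure Ω)
  {p : Euc n} (hd : DifferentiableAt ℝ (gauge Ω) p) (hp : p ∈ frontier Ω)

include h hd hp

/-- In a nontangential cone at scale `t`, a ball of radius comparable to `t` stays well inside the
supporting half-space. -/
lemma inner_le_of_mem_ntCone {α : ℝ} (hα : 0 < α) {y : Euc n} (hy : y ∈ ntCone Ω p α)
    {x : Euc n} (hx : ‖x - y‖ ≤ dist y p / (2 * (1 + α))) :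
    ⟪gaugeGrad Ω p, x - p⟫ ≤ -(‖gaugeGrad Ω p‖ / (4 * (1 + α))) * dist y p := by
  set G := gaugeGrad Ω p
  have hb : 0 < ‖G‖ := h.norm_gaugeGrad_pos hd (h.ne_zero_of_mem_frontier hp)
  set D := infDist y (frontier Ω)
  have hyd : dist y p / (1 + α) ≤ D := (div_le_iff₀' (by positivity)).2 hy.2
  have hyp : 0 < dist y p := dist_pos.2 fun e => h.notMem_self hd hp (e ▸ hy.1)
  have hD : 0 < D := lt_of_lt_of_le (by positivity) hyd
  have h1 : y + (3 / 4 * D / ‖G‖) • G ∈ Ω := by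
    refine h.ball_infDist_frontier_subset hy.1 ?_
    rw [mem_ball, dist_eq_norm, add_sub_cancel_left, norm_smul, Real.norm_of_nonneg (by positivity),
      div_mul_cancel₀ _ hb.ne']
    change 3 / 4 * D < D
    linarith
  have h2 : ⟪G, y + (3 / 4 * D / ‖G‖) • G - p⟫ < 0 := by
    by_contra! h3
    exact h.notMem_of_inner_nonneg hd hp h3 h1
  have e1 : ⟪G, y + (3 / 4 * D / ‖G‖) • G - p⟫ = ⟪G, y - p⟫ + 3 / 4 * D * ‖G‖ := by
    rw [add_sub_right_comm, inner_add_right, inner_smul_right, real_inner_self_eq_norm_sq]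
    field_simp
  have e2 : ⟪G, x - p⟫ = ⟪G, x - y⟫ + ⟪G, y - p⟫ := by
    rw [← inner_add_right, sub_add_sub_cancel]
  have h3 := real_inner_le_norm G (x - y)
  have h4 : dist y p / (2 * (1 + α)) = dist y p / (1 + α) / 2 := by
    field_simp
  have h5 : ‖G‖ / (4 * (1 + α)) * dist y p = ‖G‖ * (dist y p / (1 + α) / 4) := by
    field_simp
  rw [neg_mul, h5, e2]
  rw [e1] at h2
  rw [h4] at hx
  nlinarith

include hu hF hrep

theorem hasNTLimitAt_gradient (hL : IsBdryLebesguePt Ω F p) :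
    HasNTLimitAt Ω (gradient u) p
      (-(F p / (n * ‖gaugeGrad Ω p‖ ^ 2)) • gaugeGrad Ω p) := by
  intro α hα
  have hn := natCast_pos_of_neZero (n := n)
  have hL0 : 0 ≤ L := hu.lip_nonneg
  obtain ⟨C, hC0, hC⟩ := exists_gradient_estimate (n := n)
  have hbl := fun a => h.tendsto_blowup hu hF hrep hd hp hL (a := a)
  have hlip := h.abs_blowup_sub_halfProfile_sub_le hu hd hp (p := p)
  have hcone := fun y hy x => h.inner_le_of_mem_ntCone hd hp hα (y := y) hy (x := x)
  have hb : 0 < ‖gaugeGrad Ω p‖ := h.norm_gaugeGrad_pos hd (h.ne_zero_of_mem_frontier hp)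
  set G := gaugeGrad Ω p
  set m := F p / (n * ‖G‖ ^ 2)
  set K : Set (Euc n) := closedBall 0 2 ∩ {z | ⟪G, z⟫ ≤ -(‖G‖ / (4 * (1 + α)))}
  have hK : IsCompact K := (isCompact_closedBall _ _).inter_right
    (isClosed_le (by fun_prop) continuous_const)
  have hKw : ∀ ε > 0, ∀ᶠ t in 𝓝[>] (0 : ℝ), ∀ a ∈ K,
      |blowup u p t a - m * halfProfile G a| ≤ ε := by
    intro ε hε
    refine eventually_abs_le_of_isCompact (w := fun t a => blowup u p t a - m * halfProfile G a)
      (M := L + |m| * ‖G‖) (by positivity) ?_ hK ?_ hε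
    · filter_upwards [self_mem_nhdsWithin] with t (ht : 0 < t) y z
      exact hlip m ht y z
    · intro a ha
      rw [tendsto_sub_nhds_zero_iff]
      refine hbl a (lt_of_le_of_lt ha.2 ?_)
      rw [neg_lt_zero]
      positivity
  rw [Metric.tendsto_nhds]
  intro ε₀ hε₀
  set ρ : ℝ := (4 * (1 + α))⁻¹ with hρdef
  have hρ : 0 < ρ := by positivity
  obtain ⟨ε, hε, hεε⟩ : ∃ ε : ℝ, 0 < ε ∧ C * ε / ρ < ε₀ / 2 := by
    refine ⟨ρ * ε₀ / (4 * (C + 1)), by positivity, ?_⟩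
    have e : C * (ρ * ε₀ / (4 * (C + 1))) / ρ = ε₀ / 4 * (C / (C + 1)) := by field_simp
    have h1 : C / (C + 1) ≤ 1 := (div_le_one (by positivity)).2 (by linarith)
    rw [e]
    nlinarith
  obtain ⟨t₀, ht₀, hT⟩ := mem_nhdsGT_iff_exists_Ioo_subset.1 (hKw ε hε)
  obtain ⟨t₁, ht₁, ht₁'⟩ : ∃ t₁ : ℝ, 0 < t₁ ∧ (4 * C / (n * ρ) + 2 / n) * t₁ < ε₀ / 2 := by
    refine ⟨ε₀ / 4 / (4 * C / (n * ρ) + 2 / n), by positivity, ?_⟩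
    rw [mul_div_cancel₀ _ (by positivity)]
    linarith
  filter_upwards [inter_mem_nhdsWithin _ (ball_mem_nhds p (lt_min ht₀ ht₁))] with y hy
  set t := dist y p
  have htlt : t < min t₀ t₁ := hy.2
  have ht : 0 < t := dist_pos.2 fun e => h.notMem_self hd hp (e ▸ hy.1.1)
  have htn : ‖y - p‖ = t := (dist_eq_norm y p).symm
  have hρt : 2 * (ρ * t) = t / (2 * (1 + α)) := by
    rw [hρdef]
    field_simp
    norm_num
  have hin : ∀ x ∈ closedBall y (2 * (ρ * t)),
      ⟪G, x - p⟫ ≤ -(‖G‖ / (4 * (1 + α))) * t := by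
    intro x hx
    rw [mem_closedBall, dist_eq_norm, hρt] at hx
    exact hcone y hy.1 x hx
  have hxp : ∀ x ∈ closedBall y (2 * (ρ * t)), ‖x - p‖ ≤ 2 * t := by
    intro x hx
    rw [mem_closedBall, dist_eq_norm, hρt] at hx
    have h1 : t / (2 * (1 + α)) ≤ t := div_le_self ht.le (by linarith)
    have h2 := norm_add_le (x - y) (y - p)
    rw [sub_add_sub_cancel] at h2
    linarith
  have hsub : closedBall y (2 * (ρ * t)) ⊆ Ω := by
    refine (closedBall_subset_ball ?_).trans (h.ball_infDist_frontier_subset hy.1.1)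
    have h1 : t / (1 + α) ≤ infDist y (frontier Ω) := (div_le_iff₀' (by positivity)).2 hy.1.2
    have h2 : t / (2 * (1 + α)) < t / (1 + α) :=
      div_lt_div_of_pos_left ht (by positivity) (by linarith)
    linarith
  have hbd : ∀ x ∈ closedBall y (2 * (ρ * t)), |u x + m * ⟪G, x - p⟫| ≤ ε * t := by
    intro x hx
    have hz : t⁻¹ • (x - p) ∈ K := by
      refine ⟨?_, ?_⟩
      · rw [mem_closedBall_zero_iff, norm_smul, norm_inv, Real.norm_of_nonneg ht.le,
          inv_mul_le_iff₀ ht]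
        linarith [hxp x hx]
      · rw [mem_ofPred_eq, inner_smul_right, inv_mul_le_iff₀ ht]
        linarith [hin x hx]
    have h1 := hT ⟨ht, htlt.trans_le (min_le_left _ _)⟩ _ hz
    have h2 : ⟪G, t⁻¹ • (x - p)⟫ ≤ 0 := hz.2.trans (by rw [neg_nonpos]; positivity)
    rw [halfProfile_of_neg h2, blowup, smul_inv_smul₀ ht.ne', add_sub_cancel,
      inner_smul_right] at h1
    have e : t⁻¹ * u x - m * -(t⁻¹ * ⟪G, x - p⟫) = t⁻¹ * (u x + m * ⟪G, x - p⟫) := by ring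
    rw [e, abs_mul, abs_inv, abs_of_pos ht, inv_mul_le_iff₀ ht] at h1
    linarith
  set W : Euc n → ℝ := fun x => u x + (n : ℝ)⁻¹ * ‖x‖ ^ 2
    + (⟪x, m • G - (2 * (n : ℝ)⁻¹) • p⟫ + ((n : ℝ)⁻¹ * ‖p‖ ^ 2 - m * ⟪G, p⟫)) with hW
  have hWe : ∀ x, W x = u x + (n : ℝ)⁻¹ * ‖x - p‖ ^ 2 + m * ⟪G, x - p⟫ := by
    intro x
    rw [hW]
    simp only
    rw [norm_sub_sq_real, inner_sub_right, inner_sub_right, inner_smul_right, inner_smul_right,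
      real_inner_comm G x]
    ring
  have hcu := hu.continuous
  have hWc : Continuous W := by fun_prop
  have hWh : WeaklyHarmonic Ω W :=
    (hu.weaklyHarmonic_add h.isOpen).add_affine h.isOpen (by fun_prop) _ _
  have hWb : ∀ x ∈ closedBall y (2 * (ρ * t)), |W x| ≤ ε * t + 4 * t ^ 2 / n := by
    intro x hx
    rw [hWe, add_right_comm]
    refine (abs_add_le _ _).trans (add_le_add (hbd x hx) ?_)
    rw [abs_of_nonneg (by positivity), inv_mul_le_iff₀ hn, mul_div_cancel₀ _ hn.ne']
    nlinarith [hxp x hx, norm_nonneg (x - p)]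
  have hfin := hC W Ω y (ρ * t) (ε * t + 4 * t ^ 2 / n) hWc hWh (by positivity) (by positivity)
    hsub hWb
  have hud : DifferentiableAt ℝ u y :=
    ((hu.torsion.smooth.contDiffAt (h.isOpen.mem_nhds hy.1.1)).differentiableAt (by simp))
  have hWd : HasGradientAt W (gradient u y + m • G + (2 * (n : ℝ)⁻¹) • (y - p)) y := by
    rw [hasGradientAt_iff_hasFDerivAt]
    have h1 := hud.hasGradientAt.hasFDerivAt
    have h2 := ((hasStrictFDerivAt_norm_sq (F := Euc n) y).hasFDerivAt).const_mul (n : ℝ)⁻¹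
    have h3 := ((innerSL ℝ (m • G - (2 * (n : ℝ)⁻¹) • p)).hasFDerivAt (x := y)).add_const
      ((n : ℝ)⁻¹ * ‖p‖ ^ 2 - m * ⟪G, p⟫)
    have h4 := (h1.add h2).add h3
    refine (h4.congr_of_eventuallyEq (Eventually.of_forall fun x => ?_)).congr_fderiv ?_
    · simp only [hW, Pi.add_apply, innerSL_apply_apply]
      rw [real_inner_comm x]
    · ext v
      simp
      ring
  have e3 : ‖gradient W y‖ = ‖fderiv ℝ W y‖ := by
    rw [gradient, LinearIsometryEquiv.norm_map]
  rw [← e3, hWd.gradient] at hfin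
  have e4 : C * (ε * t + 4 * t ^ 2 / n) / (ρ * t) = C * ε / ρ + 4 * C / (n * ρ) * t := by
    field_simp
  rw [e4] at hfin
  rw [dist_eq_norm]
  have e5 : gradient u y - -m • G = (gradient u y + m • G + (2 * (n : ℝ)⁻¹) • (y - p))
      - (2 * (n : ℝ)⁻¹) • (y - p) := by module
  have h6 := norm_sub_le (gradient u y + m • G + (2 * (n : ℝ)⁻¹) • (y - p))
    ((2 * (n : ℝ)⁻¹) • (y - p))
  rw [← e5, norm_smul (2 * (n : ℝ)⁻¹), htn, Real.norm_of_nonneg (by positivity)] at h6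
  have h7 : t < t₁ := htlt.trans_le (min_le_right _ _)
  have h8 : (4 * C / (n * ρ) + 2 / n) * t ≤ (4 * C / (n * ρ) + 2 / n) * t₁ :=
    mul_le_mul_of_nonneg_left h7.le (by positivity)
  have h9 : 2 * (n : ℝ)⁻¹ * t = 2 / n * t := by rw [div_eq_mul_inv]
  linarith

/-- The nontangential boundary values of the gradient of the torsion function. -/
theorem ntGradient_eq (hL : IsBdryLebesguePt Ω F p) {v : Euc n → ℝ} (hv : EqOn v u Ω) :
    ntGradient Ω v p = -(F p / (n * ‖gaugeGrad Ω p‖ ^ 2)) • gaugeGrad Ω p := by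
  have hg : EqOn (gradient v) (gradient u) Ω := by
    intro x hx
    rw [gradient, gradient, (hv.eventuallyEq_of_mem (h.isOpen.mem_nhds hx)).fderiv_eq]
  have h1 : HasNTLimitAt Ω (gradient v) p
      (-(F p / (n * ‖gaugeGrad Ω p‖ ^ 2)) • gaugeGrad Ω p) := by
    intro α hα
    refine (h.hasNTLimitAt_gradient hu hF hrep hd hp hL α hα).congr' ?_
    filter_upwards [self_mem_nhdsWithin] with y hy
    exact (hg hy.1).symm
  have h2 : ∃ L, HasNTLimitAt Ω (gradient v) p L := ⟨_, h1⟩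
  rw [ntGradient, dif_pos h2]
  have := h.neBot_ntCone hp
  have hα : 0 < R / r := div_pos h.radius_pos h.pos
  exact tendsto_nhds_unique (h2.choose_spec _ hα) (h1 _ hα)

end ConvexBetween

/-- A function that is smooth near a compact set agrees near that set with a test function. -/
lemma exists_testFn_eq_nhdsSet {K U : Set (Euc n)} (hK : IsCompact K) (hU : IsOpen U) (hKU : K ⊆ U)
    {v : Euc n → ℝ} (hv : ContDiffOn ℝ ∞ v U) :
    ∃ φ : Euc n → ℝ, ContDiff ℝ ∞ φ ∧ HasCompactSupport φ ∧ ∀ x ∈ K, φ =ᶠ[𝓝 x] v := by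
  obtain ⟨T, hT, hKT, hTU⟩ := exists_compact_between hK hU hKU
  obtain ⟨χ, hχ1, hχ0, -⟩ := exists_contMDiffMap_one_nhds_of_subset_interior
    (modelWithCornersSelf ℝ (Euc n)) (n := (⊤ : ℕ∞)) hK.isClosed hKT
  have hχ : ContDiff ℝ ∞ χ := χ.contMDiff.contDiff
  have hts : tsupport χ ⊆ T := closure_minimal (fun x hx => by
    by_contra hxT
    exact hx (hχ0 x hxT)) hT.isClosed
  refine ⟨fun x => χ x * v x, contDiff_iff_contDiffAt.2 fun x => ?_, ?_, fun x hx => ?_⟩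
  · by_cases hx : x ∈ tsupport χ
    · exact hχ.contDiffAt.mul (hv.contDiffAt (hU.mem_nhds (hTU (hts hx))))
    · refine contDiffAt_const (c := (0 : ℝ)) |>.congr_of_eventuallyEq ?_
      filter_upwards [(isClosed_tsupport χ).isOpen_compl.mem_nhds hx] with y hy
      rw [image_eq_zero_of_notMem_tsupport hy, zero_mul]
  · exact HasCompactSupport.mul_right (hT.of_isClosed_subset (isClosed_tsupport _) hts)
  · filter_upwards [mem_nhdsSet_iff_forall.1 hχ1 x hx] with y hy
    rw [hy, one_mul]

namespace ConvexBetween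

variable [NeZero n] {L r R : ℝ} {Ω : Set (Euc n)} (h : ConvexBetween r R Ω) {u F : Euc n → ℝ}
  (hu : IsLipTorsion L Ω u) (hF : MemLp F 2 (coneMeasure Ω))
  (hrep : ∀ φ : Euc n → ℝ, ContDiff ℝ ∞ φ → HasCompactSupport φ →
    bdryFn Ω u φ = ∫ x, φ x * F x ∂coneMeasure Ω)

include h

lemma isCompact_closure : IsCompact (closure Ω) := h.isBounded.isCompact_closure

include hu

lemma abs_le_of_gauge {x : Euc n} {s : ℝ} (hx : x ∈ Ω) (hs : s ≤ gauge Ω x) :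
    u x ≤ L * (R * (1 - s)) := by
  rcases eq_or_ne x 0 with rfl | hx0
  · have h1 := hu.lip 0 0
    rw [gauge_zero] at hs
    obtain ⟨v, hv⟩ := exists_norm_eq (Euc n) (zero_le_one (α := ℝ))
    have hv0 : v ≠ 0 := fun e => by simp [e] at hv
    have h2 := hu.lip 0 (radProj Ω v)
    rw [hu.zero_outside (radProj Ω v), sub_zero, zero_sub, norm_neg] at h2
    · have h3 := h.norm_radProj_le v
      have h4 := mul_le_mul_of_nonneg_left h3 hu.lip_nonneg
      have h5 := le_abs_self (u 0)
      have h6 := mul_nonneg hu.lip_nonneg (mul_nonneg h.radius_pos.le (neg_nonneg.2 hs))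
      nlinarith
    · rw [h.mem_iff, h.gauge_radProj hv0]
      exact lt_irrefl 1
  · have h2 := hu.lip x (radProj Ω x)
    have hq : radProj Ω x ∉ Ω := by
      rw [h.mem_iff, h.gauge_radProj hx0]
      exact lt_irrefl 1
    rw [hu.zero_outside _ hq, sub_zero] at h2
    have h3 := h.norm_sub_radProj_le x
    have h4 := (h.mem_iff x).1 hx
    rw [abs_of_neg (by linarith)] at h3
    have h5 : ‖x - radProj Ω x‖ ≤ R * (1 - s) :=
      h3.trans (mul_le_mul_of_nonneg_left (by linarith) h.radius_pos.le)
    exact (le_abs_self _).trans (h2.trans (mul_le_mul_of_nonneg_left h5 hu.lip_nonneg))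

include hrep

/-- Testing the boundary functional with a dilate of the torsion function itself. -/
lemma integral_dilate_mul_bdryDensity {s : ℝ} (hs0 : 0 < s) (hs1 : s < 1) :
    s ^ n * ∫ p, u (s • p) * F p ∂coneMeasure Ω
      = 2 * (1 - s ^ (n + 2)) * (∫ x in Ω, u x) - 2 * ∫ x in Ω \ s • Ω, u x := by
  have hsub : s • Ω ⊆ Ω := by
    rw [← h.setOf_gauge_lt_eq hs0]
    exact fun x hx => (h.mem_iff x).2 (lt_trans hx hs1)
  set U : Set (Euc n) := (fun x => s • x) ⁻¹' Ω
  have hU : IsOpen U := h.isOpen.preimage (continuous_const_smul s)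
  have hKU : closure Ω ⊆ U := by
    intro x hx
    change s • x ∈ Ω
    rw [h.mem_iff, gauge_smul_nonneg Ω hs0.le]
    have := (h.mem_closure_iff x).1 hx
    have h0 := gauge_nonneg (s := Ω) x
    nlinarith
  have hv : ContDiffOn ℝ ∞ (fun x => u (s • x)) U :=
    hu.torsion.smooth.comp (by fun_prop : ContDiff ℝ ∞ fun x : Euc n => s • x).contDiffOn
      fun x hx => hx
  obtain ⟨φ, hφ, hc, hφv⟩ := exists_testFn_eq_nhdsSet h.isCompact_closure hU hKU hv
  have h1 := hrep φ hφ hc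
  have e1 : ∫ x, φ x * F x ∂coneMeasure Ω = ∫ p, u (s • p) * F p ∂coneMeasure Ω := by
    refine integral_congr_ae ?_
    filter_upwards [h.ae_coneMeasure_mem_frontier] with p hp
    rw [(hφv p (frontier_subset_closure hp)).eq_of_nhds]
  have e2 : ∫ x, u x * lapl φ x = -(2 * s ^ 2) * ∫ x in Ω, u x := by
    rw [← setIntegral_eq_integral_of_forall_compl_eq_zero (s := Ω)
      (fun x hx => by rw [hu.zero_outside x hx, zero_mul]), ← integral_const_mul]
    refine setIntegral_congr_fun h.isOpen.measurableSet fun x hx => ?_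
    have h2 : lapl φ x = s ^ 2 * -2 := by
      have hx' : (0 : Euc n) + s • x ∈ Ω := by
        rw [zero_add]
        exact hKU (subset_closure hx)
      rw [lapl_congr_nhds (hφv x (subset_closure hx)), ← hu.torsion.lapl_eq _ hx',
        ← lapl_comp_affine (f := u) 0 s x
          ((hu.torsion.smooth.contDiffAt (h.isOpen.mem_nhds hx')).of_le two_le_infty)]
      simp only [zero_add]
    simp only [h2]
    ring
  have e3 : s ^ n * ∫ x in Ω, φ x = ∫ x in s • Ω, u x := by
    have h2 : ∫ x in Ω, φ x = ∫ x in Ω, u (s • x) :=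
      setIntegral_congr_fun h.isOpen.measurableSet fun x hx =>
        (hφv x (subset_closure hx)).eq_of_nhds
    rw [h2, Measure.setIntegral_comp_smul_of_pos volume u Ω hs0, smul_eq_mul,
      finrank_euclideanSpace_fin, mul_inv_cancel_left₀ (by positivity)]
  have hi : IntegrableOn u Ω :=
    (hu.continuous.continuousOn.integrableOn_compact h.isCompact_closure).mono_set subset_closure
  have hms : MeasurableSet (s • Ω) := (h.isOpen.smul₀ hs0.ne').measurableSet
  rw [setIntegral_sdiff hms hi hsub, ← e1, ← h1, bdryFn, e2, mul_add, mul_left_comm _ (2 : ℝ), e3]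
  ring

include hF

/-- The Rellich identity. -/
theorem integral_sq_bdryDensity :
    ∫ p, F p / (n * ‖gaugeGrad Ω p‖ ^ 2) * F p ∂coneMeasure Ω
      = 2 * (n + 2) * ∫ x in Ω, u x := by
  have := h.isFiniteMeasure_coneMeasure
  have hFi : Integrable F (coneMeasure Ω) := hF.integrable one_le_two
  have hL0 : 0 ≤ L := hu.lip_nonneg
  have hR0 := h.radius_pos
  have h1 : Tendsto (fun t : ℝ => (1 - t) ^ n *
      ∫ p, blowup u p t (-p) * F p ∂coneMeasure Ω) (𝓝[>] 0)
      (𝓝 ((1 - 0) ^ n * ∫ p, F p / (n * ‖gaugeGrad Ω p‖ ^ 2) * F p ∂coneMeasure Ω)) := by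
    refine Tendsto.mul ?_ ?_
    · exact (Continuous.tendsto (f := fun t : ℝ => (1 - t) ^ n) (by fun_prop) 0).mono_left
        nhdsWithin_le_nhds
    · refine tendsto_integral_filter_of_dominated_convergence (fun p => L * R * |F p|) ?_ ?_ ?_ ?_
      · filter_upwards [self_mem_nhdsWithin] with t (ht : 0 < t)
        have hcu := hu.continuous
        have : Continuous fun p => blowup u p t (-p) := by
          unfold blowup
          fun_prop
        exact this.aestronglyMeasurable.mul hF.1
      · filter_upwards [self_mem_nhdsWithin] with t (ht : 0 < t)
        filter_upwards [h.ae_coneMeasure_mem_frontier] with p hp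
        have hpn : p ∉ Ω := by
          rw [h.mem_iff, (h.mem_frontier_iff p).1 hp]
          exact lt_irrefl 1
        have k := abs_blowup_sub_le hu p ht (-p) 0
        rw [blowup_zero hu hpn, sub_zero, sub_zero, norm_neg] at k
        rw [norm_mul]
        exact mul_le_mul_of_nonneg_right (k.trans
          (mul_le_mul_of_nonneg_left (h.norm_le_of_mem_frontier hp) hL0)) (abs_nonneg _)
      · exact hFi.norm.const_mul _
      · filter_upwards [h.ae_coneMeasure_mem_frontier, h.ae_coneMeasure_differentiableAt,
          h.ae_isBdryLebesguePt hF] with p hp hd hL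
        have hg : ⟪gaugeGrad Ω p, -p⟫ = -1 := by
          rw [inner_neg_right, h.inner_gaugeGrad_self hd, (h.mem_frontier_iff p).1 hp]
        have k := h.tendsto_blowup hu hF hrep hd hp hL (a := -p) (by rw [hg]; norm_num)
        rw [halfProfile_of_neg (by rw [hg]; norm_num), hg, neg_neg, mul_one] at k
        exact k.mul_const _
  have h2 : Tendsto (fun t : ℝ => 2 * ((1 - (1 - t) ^ (n + 2)) / t) * (∫ x in Ω, u x)
      - 2 * (t⁻¹ * ∫ x in Ω \ (1 - t) • Ω, u x)) (𝓝[>] 0)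
      (𝓝 (2 * (n + 2) * (∫ x in Ω, u x) - 2 * 0)) := by
    refine Tendsto.sub (Tendsto.mul_const _ (Tendsto.const_mul _ ?_)) (Tendsto.const_mul _ ?_)
    · have hder : HasDerivAt (fun t : ℝ => -(1 - t) ^ (n + 2)) (n + 2) 0 := by
        have := (((hasDerivAt_id (0 : ℝ)).const_sub 1).pow (n + 2)).neg
        refine this.congr_deriv ?_
        simp
      refine ((hasDerivAt_iff_tendsto_slope.1 hder).mono_left
        (nhdsWithin_mono (0 : ℝ) fun t (ht : 0 < t) => ht.ne')).congr fun t => ?_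
      simp only [slope_def_field]
      simp
      ring
    · have hlim : Tendsto (fun t : ℝ => L * R * ((1 - (1 - t) ^ n) * volume.real Ω)) (𝓝[>] 0)
          (𝓝 0) := by
        have : Tendsto (fun t : ℝ => L * R * ((1 - (1 - t) ^ n) * volume.real Ω)) (𝓝 0)
            (𝓝 (L * R * ((1 - (1 - 0) ^ n) * volume.real Ω))) :=
          Continuous.tendsto (by fun_prop) 0
        simpa using this.mono_left nhdsWithin_le_nhds
      refine squeeze_zero_norm' ?_ hlim
      filter_upwards [Ioo_mem_nhdsGT (zero_lt_one' ℝ)] with t ht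
      have ht1 : 0 < 1 - t := by linarith [ht.2]
      have e : Ω \ (1 - t) • Ω = {x | 1 - t ≤ gauge Ω x ∧ gauge Ω x < 1} := by
        rw [← h.setOf_gauge_lt_eq ht1]
        ext x
        simp only [Set.mem_sdiff, mem_ofPred_eq, not_lt, h.mem_iff]
        exact and_comm
      have hv := h.volume_real_shell ht1 (by linarith [ht.1] : 1 - t ≤ 1)
      rw [← e, one_pow] at hv
      rw [norm_mul, norm_inv, Real.norm_of_nonneg ht.1.le, inv_mul_le_iff₀ ht.1]
      refine (norm_setIntegral_le_of_norm_le_const (f := u) (C := L * (R * t)) ?_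
        fun x hx => ?_).trans_eq ?_
      · exact (measure_mono sdiff_subset).trans_lt h.volume_lt_top
      · rw [Real.norm_of_nonneg (hu.nonneg x)]
        have hx2 : 1 - t ≤ gauge Ω x := by
          rw [e] at hx
          exact hx.1
        simpa using h.abs_le_of_gauge hu hx.1 hx2
      · rw [hv]
        ring
  have h3 : ∀ᶠ t in 𝓝[>] (0 : ℝ), (1 - t) ^ n * ∫ p, blowup u p t (-p) * F p ∂coneMeasure Ω
      = 2 * ((1 - (1 - t) ^ (n + 2)) / t) * (∫ x in Ω, u x)
        - 2 * (t⁻¹ * ∫ x in Ω \ (1 - t) • Ω, u x) := by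
    filter_upwards [Ioo_mem_nhdsGT (zero_lt_one' ℝ)] with t ht
    have k := h.integral_dilate_mul_bdryDensity hu hrep (s := 1 - t) (by linarith [ht.2])
      (by linarith [ht.1])
    have e : ∫ p, blowup u p t (-p) * F p ∂coneMeasure Ω
        = t⁻¹ * ∫ p, u ((1 - t) • p) * F p ∂coneMeasure Ω := by
      rw [← integral_const_mul]
      congr 1
      ext p
      have : p + t • -p = (1 - t) • p := by module
      rw [blowup, this, mul_assoc]
    rw [e, mul_left_comm, k]
    have := ht.1.ne'
    field_simp
  have h4 := tendsto_nhds_unique (h1.congr' h3) h2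
  simpa using h4

end ConvexBetween

/-- The open cone with apex at the origin spanned by a set. -/
def coneSet (A : Set (Euc n)) : Set (Euc n) := {x | ∃ s : ℝ, 0 < s ∧ s < 1 ∧ ∃ a ∈ A, s • a = x}

lemma coneSet_image {A : Set (Euc n)} {T : Euc n → Euc n}
    (hT : ∀ a ∈ A, ∀ s : ℝ, 0 < s → T (s • a) = s • T a) : coneSet (T '' A) = T '' coneSet A := by
  ext x
  constructor
  · rintro ⟨s, h0, h1, _, ⟨a, ha, rfl⟩, rfl⟩
    exact ⟨s • a, ⟨s, h0, h1, a, ha, rfl⟩, hT a ha s h0⟩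
  · rintro ⟨_, ⟨s, h0, h1, a, ha, rfl⟩, rfl⟩
    exact ⟨s, h0, h1, T a, ⟨a, ha, rfl⟩, (hT a ha s h0).symm⟩

section

variable (e : Euc n)

/-- The slab over which the cones based in the hyperplane `⟪e, x⟫ = 1` lie. -/
def unitSlab : Set (Euc n) := {x | 0 < ⟪e, x⟫ ∧ ⟪e, x⟫ < 1}

/-- Central projection to the hyperplane `⟪e, x⟫ = 1`, in terms of its direction. -/
def centralProj (x : Euc n) : (ℝ ∙ e)ᗮ := (ℝ ∙ e)ᗮ.orthogonalProjectionOnto ((⟪e, x⟫)⁻¹ • x)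

/-- The volume of cones, as a measure on the direction of their base hyperplane. -/
def flatConeMeasure : Measure (ℝ ∙ e)ᗮ := (volume.restrict (unitSlab e)).map (centralProj e)

lemma measurableSet_unitSlab : MeasurableSet (unitSlab e) :=
  (measurableSet_lt measurable_const (by fun_prop : Continuous fun x : Euc n => ⟪e, x⟫).measurable).inter
    (measurableSet_lt (by fun_prop : Continuous fun x : Euc n => ⟪e, x⟫).measurable measurable_const)

lemma measurable_centralProj : Measurable (centralProj e) :=
  (ContinuousLinearMap.continuous _).measurable.comp
    ((by fun_prop : Continuous fun x : Euc n => ⟪e, x⟫).measurable.inv.smul measurable_id)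

variable {e}

lemma inner_orthogonal_span (w : (ℝ ∙ e)ᗮ) : ⟪e, (w : Euc n)⟫ = 0 :=
  Submodule.mem_orthogonal_singleton_iff_inner_right.1 w.2

variable (he : ‖e‖ = 1)
include he

lemma add_orthogonalProjection_eq {y : Euc n} (hy : ⟪e, y⟫ = 1) :
    e + ((ℝ ∙ e)ᗮ.orthogonalProjectionOnto y : Euc n) = y := by
  have h1 : y - e ∈ (ℝ ∙ e)ᗮ := by
    rw [Submodule.mem_orthogonal_singleton_iff_inner_right, inner_sub_right, hy,
      real_inner_self_eq_norm_sq, he]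
    norm_num
  have h2 : (ℝ ∙ e)ᗮ.orthogonalProjectionOnto e = 0 := by
    rw [Submodule.orthogonalProjectionOnto_eq_zero_iff, Submodule.orthogonal_orthogonal]
    exact Submodule.mem_span_singleton_self e
  have h3 := Submodule.orthogonalProjectionOnto_mem_subspace_eq_self (K := (ℝ ∙ e)ᗮ) ⟨y - e, h1⟩
  have h4 : (ℝ ∙ e)ᗮ.orthogonalProjectionOnto y = ⟨y - e, h1⟩ := by
    rw [← h3]
    simp only
    rw [map_sub, h2, sub_zero]
  rw [h4]
  exact add_sub_cancel e y

lemma smul_centralProj {x : Euc n} (hx : 0 < ⟪e, x⟫) :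
    ⟪e, x⟫ • (e + (centralProj e x : Euc n)) = x := by
  rw [centralProj, add_orthogonalProjection_eq he, smul_inv_smul₀ hx.ne']
  rw [inner_smul_right, inv_mul_cancel₀ hx.ne']

lemma centralProj_smul {s : ℝ} (hs : 0 < s) (w : (ℝ ∙ e)ᗮ) :
    centralProj e (s • (e + (w : Euc n))) = w := by
  have h1 : ⟪e, s • (e + (w : Euc n))⟫ = s := by
    rw [inner_smul_right, inner_add_right, inner_orthogonal_span, real_inner_self_eq_norm_sq, he]
    norm_num
  have h2 := smul_centralProj he (x := s • (e + (w : Euc n))) (by rwa [h1])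
  rw [h1] at h2
  exact Subtype.ext (add_left_cancel (smul_right_injective _ hs.ne' h2))

lemma isAddLeftInvariant_flatConeMeasure : (flatConeMeasure e).IsAddLeftInvariant := by
  constructor
  intro v
  set f : Module.Dual ℝ (Euc n) := (innerSL ℝ e).toLinearMap
  set τ : Euc n →ₗ[ℝ] Euc n := LinearMap.transvection f (v : Euc n)
  have hfv : f (v : Euc n) = 0 := inner_orthogonal_span v
  have hτ : ∀ x, τ x = x + ⟪e, x⟫ • (v : Euc n) := fun x => LinearMap.transvection.apply f _ x
  have hτe : ∀ x, ⟪e, τ x⟫ = ⟪e, x⟫ := fun x => by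
    rw [hτ, inner_add_right, inner_smul_right, inner_orthogonal_span, mul_zero, add_zero]
  have hτm : Measurable τ := τ.continuous_of_finiteDimensional.measurable
  have hmp : MeasurePreserving τ (volume : Measure (Euc n)) volume := by
    refine ⟨hτm, ?_⟩
    have hdet : LinearMap.det τ = 1 := by
      rw [LinearMap.transvection.det, hfv, add_zero]
    rw [Measure.map_linearMap_addHaar_eq_smul_addHaar volume (by rw [hdet]; exact one_ne_zero),
      hdet]
    simp
  have hmp' := hmp.restrict_preimage (measurableSet_unitSlab e)
  have hpre : τ ⁻¹' unitSlab e = unitSlab e := by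
    ext x
    simp only [unitSlab, mem_preimage, mem_ofPred_eq, hτe]
  rw [hpre] at hmp'
  have hq := measurable_centralProj e
  rw [flatConeMeasure, Measure.map_map (measurable_const_add v) hq]
  have h1 : (fun x => v + x) ∘ centralProj e =ᵐ[volume.restrict (unitSlab e)]
      centralProj e ∘ τ := by
    filter_upwards [ae_restrict_mem (measurableSet_unitSlab e)] with x hx
    simp only [Function.comp_apply]
    have h2 : τ x = ⟪e, x⟫ • (e + ((v + centralProj e x : (ℝ ∙ e)ᗮ) : Euc n)) := by
      rw [hτ]
      nth_rw 1 [← smul_centralProj he hx.1]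
      rw [Submodule.coe_add]
      module
    rw [h2, centralProj_smul he hx.1]
  rw [Measure.map_congr h1, ← Measure.map_map hq hτm, hmp'.map_eq]

lemma isFiniteMeasureOnCompacts_flatConeMeasure :
    IsFiniteMeasureOnCompacts (flatConeMeasure e) := by
  constructor
  intro K hK
  obtain ⟨B, hB⟩ := (isBounded_iff_subset_closedBall (0 : (ℝ ∙ e)ᗮ)).1 hK.isBounded
  rw [flatConeMeasure, Measure.map_apply (measurable_centralProj e) hK.measurableSet,
    Measure.restrict_apply (measurable_centralProj e hK.measurableSet)]
  refine (measure_mono (t := closedBall (0 : Euc n) (1 + B)) ?_).trans_lt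
    measure_closedBall_lt_top
  rintro x ⟨hx, hx0, hx1⟩
  have h1 : ‖centralProj e x‖ ≤ B := mem_closedBall_zero_iff.1 (hB hx)
  have h2 : ‖e + (centralProj e x : Euc n)‖ ≤ 1 + B :=
    (norm_add_le _ _).trans (add_le_add he.le h1)
  rw [mem_closedBall_zero_iff, ← smul_centralProj he hx0, norm_smul, Real.norm_of_nonneg hx0.le]
  nlinarith [norm_nonneg (e + (centralProj e x : Euc n))]

lemma finrank_orthogonal_span [NeZero n] :
    (Module.finrank ℝ (ℝ ∙ e)ᗮ : ℝ) = (n : ℝ) - 1 := by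
  have h1 := Submodule.finrank_add_finrank_orthogonal (ℝ ∙ e)
  rw [finrank_span_singleton (by rintro rfl; simp at he), finrank_euclideanSpace_fin] at h1
  have h2 : (1 : ℝ) + Module.finrank ℝ (ℝ ∙ e)ᗮ = n := by exact_mod_cast h1
  linarith

lemma exists_volume_coneSet_eq_of_norm_eq_one [NeZero n] : ∃ c : ℝ≥0, c ≠ 0 ∧ ∀ E : Set (Euc n),
    MeasurableSet E → (∀ x ∈ E, ⟪e, x⟫ = 1) → volume (coneSet E) = c * μH[(n : ℝ) - 1] E := by
  have i1 := isAddLeftInvariant_flatConeMeasure he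
  have i2 := isFiniteMeasureOnCompacts_flatConeMeasure he
  have i3 : (μH[(n : ℝ) - 1] : Measure (ℝ ∙ e)ᗮ).IsAddHaarMeasure := by
    rw [← finrank_orthogonal_span he]
    exact isAddHaarMeasure_hausdorffMeasure
  have h1 := Measure.isAddLeftInvariant_eq_smul (flatConeMeasure e) (μH[(n : ℝ) - 1])
  set c := (flatConeMeasure e).addHaarScalarFactor (μH[(n : ℝ) - 1])
  have hq := measurable_centralProj e
  refine ⟨c, fun hc => ?_, fun E hE hE1 => ?_⟩
  · rw [hc, zero_smul] at h1
    have h2 : volume (unitSlab e) = 0 := by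
      have h3 : flatConeMeasure e univ = 0 := by rw [h1]; rfl
      rwa [flatConeMeasure, Measure.map_apply hq MeasurableSet.univ, preimage_univ,
        Measure.restrict_apply_univ] at h3
    have hce : Continuous fun x : Euc n => ⟪e, x⟫ := by fun_prop
    have ho : IsOpen ({x : Euc n | 0 < ⟪e, x⟫} ∩ {x | ⟪e, x⟫ < 1}) :=
      (isOpen_lt continuous_const hce).inter (isOpen_lt hce continuous_const)
    refine (ho.measure_pos volume ⟨(1 / 2 : ℝ) • e, ?_⟩).ne' h2
    have : ⟪e, (1 / 2 : ℝ) • e⟫ = 1 / 2 := by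
      rw [inner_smul_right, real_inner_self_eq_norm_sq, he]
      norm_num
    constructor <;> rw [mem_ofPred_eq, this] <;> norm_num
  · set E' : Set (ℝ ∙ e)ᗮ := (fun w : (ℝ ∙ e)ᗮ => e + (w : Euc n)) ⁻¹' E
    have hE' : MeasurableSet E' :=
      hE.preimage (by fun_prop : Continuous fun w : (ℝ ∙ e)ᗮ => e + (w : Euc n)).measurable
    have h2 : coneSet E = centralProj e ⁻¹' E' ∩ unitSlab e := by
      ext x
      constructor
      · rintro ⟨s, h0, h1, a, ha, rfl⟩
        have ha' := add_orthogonalProjection_eq he (hE1 a ha)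
        have h3 : ⟪e, s • a⟫ = s := by rw [inner_smul_right, hE1 a ha, mul_one]
        refine ⟨?_, ?_⟩
        · rw [mem_preimage, ← ha', centralProj_smul he h0, mem_preimage, ha']
          exact ha
        · rw [unitSlab, mem_ofPred_eq, h3]
          exact ⟨h0, h1⟩
      · rintro ⟨hx, hx0, hx1⟩
        exact ⟨⟪e, x⟫, hx0, hx1, _, hx, smul_centralProj he hx0⟩
    have hiso : Isometry fun w : (ℝ ∙ e)ᗮ => e + (w : Euc n) :=
      (IsometryEquiv.addLeft e).isometry.comp isometry_subtype_coe
    have h3 : (fun w : (ℝ ∙ e)ᗮ => e + (w : Euc n)) '' E' = E := by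
      rw [image_preimage_eq_iff]
      intro x hx
      exact ⟨_, add_orthogonalProjection_eq he (hE1 x hx)⟩
    have hd : 0 ≤ (n : ℝ) - 1 := by
      rw [← finrank_orthogonal_span he]
      exact Nat.cast_nonneg _
    have h4 := hiso.hausdorffMeasure_image (d := (n : ℝ) - 1) (Or.inl hd) E'
    rw [h3] at h4
    rw [h2, ← Measure.restrict_apply (hq hE'), ← Measure.map_apply hq hE', h4]
    change flatConeMeasure e E' = _
    rw [h1]
    rfl

end

lemma natCast_sub_one_nonneg [NeZero n] : 0 ≤ (n : ℝ) - 1 := by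
  have : 1 ≤ n := Nat.one_le_iff_ne_zero.2 (NeZero.ne n)
  have : (1 : ℝ) ≤ n := by exact_mod_cast this
  linarith

/-- The volume of a cone with flat base, in terms of the surface measure of its base. -/
theorem exists_volume_coneSet_eq [NeZero n] : ∃ c : ℝ≥0, c ≠ 0 ∧ ∀ G : Euc n, G ≠ 0 →
    ∀ E : Set (Euc n), MeasurableSet E → (∀ x ∈ E, ⟪G, x⟫ = 1) →
      ENNReal.ofReal ‖G‖ * volume (coneSet E) = c * μH[(n : ℝ) - 1] E := by
  obtain ⟨e, he⟩ := exists_norm_eq (Euc n) (zero_le_one (α := ℝ))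
  obtain ⟨c, hc, hcE⟩ := exists_volume_coneSet_eq_of_norm_eq_one he
  refine ⟨c, hc, fun G hG E hE hGE => ?_⟩
  have hG0 : 0 < ‖G‖ := norm_pos_iff.2 hG
  set v : Euc n := ‖G‖⁻¹ • G
  have hv : ‖v‖ = ‖e‖ := by
    rw [he, norm_smul, norm_inv, norm_norm, inv_mul_cancel₀ hG0.ne']
  set O := (ℝ ∙ (v - e))ᗮ.reflection
  have hO : O v = e := Submodule.reflection_sub hv
  have hE2 : MeasurableSet (‖G‖ • (O '' E)) :=
    MeasurableSet.const_smul₀ (O.toHomeomorph.measurableEmbedding.measurableSet_image.2 hE) _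
  have h1 := hcE (‖G‖ • (O '' E)) hE2 (by
    rintro _ ⟨_, ⟨x, hx, rfl⟩, rfl⟩
    simp only
    rw [inner_smul_right, ← hO, LinearIsometryEquiv.inner_map_map, inner_smul_left, hGE x hx]
    simp [hG0.ne'])
  have h2 : coneSet (‖G‖ • (O '' E)) = ‖G‖ • (O '' coneSet E) := by
    have := coneSet_image (A := E) (T := fun x => ‖G‖ • O x) fun a _ s _ => by
      simp only [map_smul]
      exact smul_comm _ _ _
    rw [← image_smul, ← image_smul, image_image, image_image]
    exact this
  have h3 : volume (O '' coneSet E) = volume (coneSet E) := by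
    rw [LinearIsometryEquiv.image_eq_preimage_symm]
    exact (O.symm.measurePreserving).measure_preimage_emb
      O.symm.toHomeomorph.measurableEmbedding _
  have h4 : μH[(n : ℝ) - 1] (O '' E) = μH[(n : ℝ) - 1] E :=
    O.isometry.hausdorffMeasure_image (Or.inl natCast_sub_one_nonneg) E
  rw [h2, Measure.addHaar_smul, h3, finrank_euclideanSpace_fin,
    Measure.hausdorffMeasure_smul₀ natCast_sub_one_nonneg hG0.ne', h4, abs_of_pos (by positivity),
    ENNReal.smul_def, smul_eq_mul] at h1
  have h5 : ((‖‖G‖‖₊ ^ ((n : ℝ) - 1) : ℝ≥0) : ℝ≥0∞) = ENNReal.ofReal (‖G‖ ^ (n - 1)) := by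
    have : ((n : ℝ) - 1) = ((n - 1 : ℕ) : ℝ) := by
      rw [Nat.cast_sub (Nat.one_le_iff_ne_zero.2 (NeZero.ne n)), Nat.cast_one]
    rw [this, NNReal.rpow_natCast, ENNReal.ofReal_pow hG0.le, nnnorm_norm, ENNReal.coe_pow,
      ofReal_norm]
    rfl
  have h6 : ‖G‖ ^ n = ‖G‖ ^ (n - 1) * ‖G‖ := by
    rw [← pow_succ, Nat.sub_add_cancel (Nat.one_le_iff_ne_zero.2 (NeZero.ne n))]
  rw [h5, h6, ENNReal.ofReal_mul (by positivity), mul_assoc, mul_left_comm (c : ℝ≥0∞)] at h1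
  exact (ENNReal.mul_right_inj (ENNReal.ofReal_pos.2 (pow_pos hG0 _)).ne' ENNReal.ofReal_ne_top).1 h1

section

variable {X Y : Type*} [MetricSpace X] [MeasurableSpace X] [BorelSpace X] [MetricSpace Y]
  [MeasurableSpace Y] [BorelSpace Y]

lemma hausdorffMeasure_le_of_dist_le {f : X → Y} {s : Set X} {K : ℝ≥0}
    (hf : ∀ x ∈ s, ∀ y ∈ s, dist x y ≤ K * dist (f x) (f y)) {d : ℝ} (hd : 0 ≤ d) :
    μH[d] s ≤ (K : ℝ≥0∞) ^ d * μH[d] (f '' s) := by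
  rcases s.eq_empty_or_nonempty with rfl | ⟨x₀, hx₀⟩
  · simp
  have : Nonempty X := ⟨x₀⟩
  have hinj : InjOn f s := fun x hx y hy hxy => by
    have := hf x hx y hy
    rw [hxy, dist_self, mul_zero] at this
    exact dist_le_zero.1 this
  have hl : LipschitzOnWith K (Function.invFunOn f s) (f '' s) := by
    refine LipschitzOnWith.of_dist_le_mul ?_
    rintro _ ⟨x, hx, rfl⟩ _ ⟨y, hy, rfl⟩
    rw [hinj.leftInvOn_invFunOn hx, hinj.leftInvOn_invFunOn hy]
    exact hf x hx y hy
  have h1 := hl.hausdorffMeasure_image_le hd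
  rwa [hinj.leftInvOn_invFunOn.image_image] at h1

end

lemma exists_hausdorffMeasure_eq_smul_volume :
    ∃ c : ℝ≥0, c ≠ 0 ∧ (μH[(n : ℝ)] : Measure (Euc n)) = c • volume := by
  have h0 : (μH[(n : ℝ)] : Measure (Euc n)).IsAddHaarMeasure := by
    have := isAddHaarMeasure_hausdorffMeasure (E := Euc n)
    rwa [finrank_euclideanSpace_fin] at this
  refine ⟨_, ?_, Measure.isAddLeftInvariant_eq_smul _ _⟩
  exact (Measure.addHaarScalarFactor_pos_of_isAddHaarMeasure _ _).ne'

lemma volume_image_le_of_dist_le {f : Euc n → Euc n} {s : Set (Euc n)} {K : ℝ≥0}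
    (hf : ∀ x ∈ s, ∀ y ∈ s, dist (f x) (f y) ≤ K * dist x y) :
    volume (f '' s) ≤ (K : ℝ≥0∞) ^ n * volume s := by
  obtain ⟨c, hc, hcv⟩ := exists_hausdorffMeasure_eq_smul_volume (n := n)
  have h1 := (LipschitzOnWith.of_dist_le_mul hf).hausdorffMeasure_image_le (Nat.cast_nonneg n)
  rw [hcv, ENNReal.rpow_natCast] at h1
  simp only [Measure.smul_apply, ENNReal.smul_def, smul_eq_mul] at h1
  rw [mul_left_comm] at h1
  exact (ENNReal.mul_le_mul_iff_right (by simpa using hc) ENNReal.coe_ne_top).1 h1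

lemma volume_le_of_dist_le {f : Euc n → Euc n} {s : Set (Euc n)} {K : ℝ≥0}
    (hf : ∀ x ∈ s, ∀ y ∈ s, dist x y ≤ K * dist (f x) (f y)) :
    volume s ≤ (K : ℝ≥0∞) ^ n * volume (f '' s) := by
  obtain ⟨c, hc, hcv⟩ := exists_hausdorffMeasure_eq_smul_volume (n := n)
  have h1 := hausdorffMeasure_le_of_dist_le hf (Nat.cast_nonneg n)
  rw [hcv, ENNReal.rpow_natCast] at h1
  simp only [Measure.smul_apply, ENNReal.smul_def, smul_eq_mul] at h1
  rw [mul_left_comm] at h1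
  exact (ENNReal.mul_le_mul_iff_right (by simpa using hc) ENNReal.coe_ne_top).1 h1

/-- Lipschitz bound for a radial rescaling `x ↦ (h x / g x) • x`. -/
lemma norm_div_smul_sub_le {h g : Euc n → ℝ} {x y : Euc n} {ε η L Q : ℝ} (hx : 0 < g x)
    (hy : 0 < g y) (hh : |h x - h y| ≤ ε * ‖x - y‖) (hg : |g x - g y| ≤ L * ‖x - y‖)
    (hη : |h x| ≤ η * g x) (hQ : ‖y‖ ≤ Q * g y) :
    ‖(h x / g x) • x - (h y / g y) • y‖ ≤ (η + Q * (ε + η * L)) * ‖x - y‖ := by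
  have hφ : |h x / g x| ≤ η := by
    rw [abs_div, abs_of_pos hx]
    exact (div_le_iff₀ hx).2 hη
  have hη0 : 0 ≤ η := (abs_nonneg _).trans hφ
  have e1 : (h x / g x) • x - (h y / g y) • y =
      (h x / g x) • (x - y) + (((h x - h y) + (h x / g x) * (g y - g x)) / g y) • y := by
    have : h y / g y = h x / g x - ((h x - h y) + (h x / g x) * (g y - g x)) / g y := by
      field_simp
      ring
    rw [this]
    module
  have h1 : |(h x - h y) + (h x / g x) * (g y - g x)| ≤ (ε + η * L) * ‖x - y‖ := by
    refine (abs_add_le _ _).trans ?_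
    rw [abs_mul, abs_sub_comm (g y)]
    have := mul_le_mul hφ hg (abs_nonneg _) hη0
    linarith
  have h2 : ‖(((h x - h y) + (h x / g x) * (g y - g x)) / g y) • y‖ ≤
      ((ε + η * L) * ‖x - y‖) * Q := by
    rw [norm_smul, Real.norm_eq_abs, abs_div, abs_of_pos hy, div_mul_eq_mul_div, div_le_iff₀ hy,
      mul_assoc]
    exact mul_le_mul h1 hQ (norm_nonneg _) ((abs_nonneg _).trans h1)
  rw [e1]
  refine (norm_add_le _ _).trans ?_
  rw [norm_smul, Real.norm_eq_abs]
  have h3 := mul_le_mul_of_nonneg_right hφ (norm_nonneg (x - y))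
  linarith

/-- The radial map taking the boundary of `Ω` to the hyperplane `⟪G, x⟫ = 1`. -/
def flatten (Ω : Set (Euc n)) (G x : Euc n) : Euc n := (gauge Ω x / ⟪G, x⟫) • x

lemma flatten_smul (Ω : Set (Euc n)) (G x : Euc n) {s : ℝ} (hs : 0 < s) :
    flatten Ω G (s • x) = s • flatten Ω G x := by
  rw [flatten, flatten, gauge_smul_nonneg Ω hs.le, inner_smul_right, mul_div_mul_left _ _ hs.ne',
    smul_comm]

/-- The infinite open cone spanned by a set. -/
def rayCone (A : Set (Euc n)) : Set (Euc n) := {x | ∃ s : ℝ, 0 < s ∧ ∃ a ∈ A, s • a = x}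

lemma subset_rayCone (A : Set (Euc n)) : A ⊆ rayCone A :=
  fun a ha => ⟨1, one_pos, a, ha, one_smul _ _⟩

lemma coneSet_subset_rayCone (A : Set (Euc n)) : coneSet A ⊆ rayCone A := by
  rintro _ ⟨s, h0, -, a, ha, rfl⟩
  exact ⟨s, h0, a, ha, rfl⟩

namespace ConvexBetween

variable {r R : ℝ} {Ω : Set (Euc n)} (h : ConvexBetween r R Ω)
include h

lemma coneMeasure_apply [NeZero n] {A : Set (Euc n)} (hA : MeasurableSet A)
    (hAf : A ⊆ frontier Ω) : coneMeasure Ω A = volume (coneSet A) := by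
  rw [coneMeasure, Measure.map_apply h.measurable_radProj hA,
    Measure.restrict_apply (h.measurable_radProj hA)]
  congr 1
  ext x
  constructor
  · rintro ⟨hx, hxΩ⟩
    have hx0 : x ≠ 0 := by
      rintro rfl
      refine h.ne_zero_of_mem_frontier (hAf hx) ?_
      rw [radProj, smul_zero]
    exact ⟨gauge Ω x, h.gauge_pos hx0, (h.mem_iff x).1 hxΩ, _, hx, h.gauge_smul_radProj x⟩
  · rintro ⟨s, h0, h1, a, ha, rfl⟩
    have hga := (h.mem_frontier_iff a).1 (hAf ha)
    refine ⟨?_, ?_⟩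
    · rw [mem_preimage, radProj_smul Ω h0, h.radProj_of_mem_frontier (hAf ha)]
      exact ha
    · rw [h.mem_iff, gauge_smul_nonneg Ω h0.le, hga, mul_one]
      exact h1

section

variable [NeZero n] {c : ℝ≥0} (hc : ∀ G : Euc n, G ≠ 0 → ∀ E : Set (Euc n), MeasurableSet E →
  (∀ x ∈ E, ⟪G, x⟫ = 1) → ENNReal.ofReal ‖G‖ * volume (coneSet E) = c * μH[(n : ℝ) - 1] E)
  {A : Set (Euc n)} (hA : MeasurableSet A) (hAf : A ⊆ frontier Ω) {G : Euc n} (hG : G ≠ 0)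
  (hGA : ∀ a ∈ A, 0 < ⟪G, a⟫) {K₁ K₂ : ℝ≥0}
  (h1 : ∀ x ∈ rayCone A, ∀ y ∈ rayCone A, dist (flatten Ω G x) (flatten Ω G y) ≤ K₁ * dist x y)
  (h2 : ∀ x ∈ rayCone A, ∀ y ∈ rayCone A, dist x y ≤ K₂ * dist (flatten Ω G x) (flatten Ω G y))
include hc hA hAf hG hGA h1 h2

lemma flatten_cone_eq : ENNReal.ofReal ‖G‖ * volume (flatten Ω G '' coneSet A) =
    c * μH[(n : ℝ) - 1] (flatten Ω G '' A) := by
  rw [← coneSet_image fun a _ s hs => flatten_smul Ω G a hs]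
  refine hc G hG _ ?_ ?_
  · refine hA.image_of_continuousOn_injOn ?_ ?_
    · exact (h.continuous_gauge.continuousOn.div (by fun_prop) fun a ha => (hGA a ha).ne').smul
        continuousOn_id
    · intro x hx y hy hxy
      have := h2 x (subset_rayCone A hx) y (subset_rayCone A hy)
      rw [hxy, dist_self, mul_zero] at this
      exact dist_le_zero.1 this
  · rintro _ ⟨a, ha, rfl⟩
    rw [flatten, inner_smul_right, (h.mem_frontier_iff a).1 (hAf ha),
      div_mul_cancel₀ _ (hGA a ha).ne']

lemma hausdorffMeasure_le_coneMeasure : c * μH[(n : ℝ) - 1] A ≤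
    (K₂ : ℝ≥0∞) ^ (n - 1) * (K₁ : ℝ≥0∞) ^ n * (ENNReal.ofReal ‖G‖ * coneMeasure Ω A) := by
  have e := h.flatten_cone_eq hc hA hAf hG hGA h1 h2
  have h3 := hausdorffMeasure_le_of_dist_le (s := A)
    (fun x hx y hy => h2 x (subset_rayCone A hx) y (subset_rayCone A hy))
    (natCast_sub_one_nonneg (n := n))
  have h4 := volume_image_le_of_dist_le (s := coneSet A)
    (fun x hx y hy => h1 x (coneSet_subset_rayCone A hx) y (coneSet_subset_rayCone A hy))
  have h5 : ((n : ℝ) - 1) = ((n - 1 : ℕ) : ℝ) := by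
    rw [Nat.cast_sub (Nat.one_le_iff_ne_zero.2 (NeZero.ne n)), Nat.cast_one]
  rw [h.coneMeasure_apply hA hAf]
  calc c * μH[(n : ℝ) - 1] A
      ≤ c * ((K₂ : ℝ≥0∞) ^ ((n : ℝ) - 1) * μH[(n : ℝ) - 1] (flatten Ω G '' A)) := by gcongr
    _ = (K₂ : ℝ≥0∞) ^ (n - 1) * (c * μH[(n : ℝ) - 1] (flatten Ω G '' A)) := by
        rw [mul_left_comm, h5, ENNReal.rpow_natCast]
    _ = (K₂ : ℝ≥0∞) ^ (n - 1) * (ENNReal.ofReal ‖G‖ * volume (flatten Ω G '' coneSet A)) := by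
        rw [e]
    _ ≤ (K₂ : ℝ≥0∞) ^ (n - 1) * (ENNReal.ofReal ‖G‖ * ((K₁ : ℝ≥0∞) ^ n * volume (coneSet A))) := by
        gcongr
    _ = _ := by ring

lemma coneMeasure_le_hausdorffMeasure : ENNReal.ofReal ‖G‖ * coneMeasure Ω A ≤
    (K₂ : ℝ≥0∞) ^ n * (K₁ : ℝ≥0∞) ^ (n - 1) * (c * μH[(n : ℝ) - 1] A) := by
  have e := h.flatten_cone_eq hc hA hAf hG hGA h1 h2
  have h3 := (LipschitzOnWith.of_dist_le_mul (s := A) (fun x hx y hy =>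
    h1 x (subset_rayCone A hx) y (subset_rayCone A hy))).hausdorffMeasure_image_le
    (natCast_sub_one_nonneg (n := n))
  have h4 := volume_le_of_dist_le (s := coneSet A)
    (fun x hx y hy => h2 x (coneSet_subset_rayCone A hx) y (coneSet_subset_rayCone A hy))
  have h5 : ((n : ℝ) - 1) = ((n - 1 : ℕ) : ℝ) := by
    rw [Nat.cast_sub (Nat.one_le_iff_ne_zero.2 (NeZero.ne n)), Nat.cast_one]
  rw [h.coneMeasure_apply hA hAf]
  calc ENNReal.ofReal ‖G‖ * volume (coneSet A)
      ≤ ENNReal.ofReal ‖G‖ * ((K₂ : ℝ≥0∞) ^ n * volume (flatten Ω G '' coneSet A)) := by gcongr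
    _ = (K₂ : ℝ≥0∞) ^ n * (c * μH[(n : ℝ) - 1] (flatten Ω G '' A)) := by
        rw [mul_left_comm, e]
    _ ≤ (K₂ : ℝ≥0∞) ^ n * (c * ((K₁ : ℝ≥0∞) ^ ((n : ℝ) - 1) * μH[(n : ℝ) - 1] A)) := by gcongr
    _ = _ := by
        rw [h5, ENNReal.rpow_natCast]
        ring

end

end ConvexBetween

namespace ConvexBetween

variable {r R : ℝ} {Ω : Set (Euc n)} (h : ConvexBetween r R Ω)
include h

lemma inner_le_mul_norm_mul_gauge [NeZero n] {p : Euc n} (hp : p ∈ frontier Ω) (x : Euc n) :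
    |⟪p, x⟫| ≤ R * R * gauge Ω x := by
  have h1 := h.norm_radProj_le p
  rw [h.radProj_of_mem_frontier hp] at h1
  calc |⟪p, x⟫| ≤ ‖p‖ * ‖x‖ := abs_real_inner_le_norm p x
    _ ≤ R * (R * gauge Ω x) :=
        mul_le_mul h1 (h.norm_le x) (norm_nonneg _) h.radius_pos.le
    _ = _ := by ring

/-- The boundary is locally bi-Lipschitz to a hyperplane. -/
lemma exists_flatten_bilipschitz [NeZero n] {p : Euc n} (hp : p ∈ frontier Ω) :
    ∃ ρ > 0, ∃ K₁ K₂ : ℝ≥0, ∀ A ⊆ frontier Ω ∩ ball p ρ, (∀ a ∈ A, 0 < ⟪p, a⟫) ∧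
      (∀ x ∈ rayCone A, ∀ y ∈ rayCone A, dist (flatten Ω p x) (flatten Ω p y) ≤ K₁ * dist x y) ∧
      ∀ x ∈ rayCone A, ∀ y ∈ rayCone A, dist x y ≤ K₂ * dist (flatten Ω p x) (flatten Ω p y) := by
  have hR := h.radius_pos
  have hr := h.pos
  have hpR := h.norm_radProj_le p
  rw [h.radProj_of_mem_frontier hp] at hpR
  have hp0 : 0 < ‖p‖ := norm_pos_iff.2 (h.ne_zero_of_mem_frontier hp)
  set Q : ℝ := 2 * R / ‖p‖ ^ 2
  have hQ : 0 < Q := by positivity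
  refine ⟨‖p‖ / 2, by positivity, ⟨r⁻¹ * Q + Q * (r⁻¹ + r⁻¹ * Q * R), by positivity⟩,
    ⟨R * R + R * (R + R * R * r⁻¹), by positivity⟩, fun A hA => ?_⟩
  have hpA : ∀ a ∈ A, ‖p‖ ^ 2 / 2 ≤ ⟪p, a⟫ := fun a ha => by
    have h1 := (hA ha).2
    rw [mem_ball_iff_norm] at h1
    have h2 := (abs_le.1 (abs_real_inner_le_norm p (a - p))).1
    rw [inner_sub_right, real_inner_self_eq_norm_sq] at h2
    nlinarith
  have hcone : ∀ x ∈ rayCone A, 0 < ⟪p, x⟫ ∧ 0 < gauge Ω x ∧ ‖x‖ ≤ Q * ⟪p, x⟫ := by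
    rintro _ ⟨s, hs, a, ha, rfl⟩
    have h1 := hpA a ha
    have h2 := h.norm_radProj_le a
    rw [h.radProj_of_mem_frontier (hA ha).1] at h2
    have h3 : 0 < ⟪p, a⟫ := lt_of_lt_of_le (by positivity) h1
    rw [inner_smul_right, gauge_smul_nonneg Ω hs.le, (h.mem_frontier_iff a).1 (hA ha).1]
    refine ⟨by positivity, by positivity, ?_⟩
    rw [norm_smul, Real.norm_of_nonneg hs.le, mul_left_comm]
    refine mul_le_mul_of_nonneg_left (h2.trans ?_) hs.le
    calc R = Q * (‖p‖ ^ 2 / 2) := by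
          simp only [Q]
          field_simp
      _ ≤ Q * ⟪p, a⟫ := mul_le_mul_of_nonneg_left h1 hQ.le
  have hinn : ∀ x y : Euc n, |⟪p, x⟫ - ⟪p, y⟫| ≤ R * ‖x - y‖ := fun x y => by
    rw [← inner_sub_right]
    exact (abs_real_inner_le_norm _ _).trans (mul_le_mul_of_nonneg_right hpR (norm_nonneg _))
  have hgau : ∀ x y : Euc n, |gauge Ω x - gauge Ω y| ≤ r⁻¹ * ‖x - y‖ := fun x y => by
    rw [inv_mul_eq_div]
    exact h.abs_gauge_sub_le x y
  refine ⟨fun a ha => lt_of_lt_of_le (by positivity) (hpA a ha), ?_, ?_⟩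
  · intro x hx y hy
    rw [dist_eq_norm, dist_eq_norm]
    refine norm_div_smul_sub_le (h := gauge Ω) (g := fun x => ⟪p, x⟫) (hcone x hx).1 (hcone y hy).1
      (hgau x y) (hinn x y) ?_ (hcone y hy).2.2
    rw [abs_of_pos (hcone x hx).2.1, mul_assoc]
    refine (h.gauge_le x).trans ?_
    rw [← inv_mul_eq_div]
    exact mul_le_mul_of_nonneg_left (hcone x hx).2.2 (inv_pos.2 hr).le
  · have hinv : ∀ x ∈ rayCone A, 0 < gauge Ω (flatten Ω p x) ∧
        (⟪p, flatten Ω p x⟫ / gauge Ω (flatten Ω p x)) • flatten Ω p x = x := fun x hx => by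
      obtain ⟨h1, h2, -⟩ := hcone x hx
      have h3 : 0 < gauge Ω x / ⟪p, x⟫ := by positivity
      have h4 : gauge Ω (flatten Ω p x) = gauge Ω x / ⟪p, x⟫ * gauge Ω x := by
        rw [flatten, gauge_smul_nonneg Ω h3.le]
      refine ⟨by rw [h4]; positivity, ?_⟩
      rw [h4, flatten, inner_smul_right, smul_smul]
      have : gauge Ω x / ⟪p, x⟫ * ⟪p, x⟫ / (gauge Ω x / ⟪p, x⟫ * gauge Ω x) *
          (gauge Ω x / ⟪p, x⟫) = 1 := by field_simp
      rw [this, one_smul]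
    intro x hx y hy
    rw [dist_eq_norm, dist_eq_norm]
    have := norm_div_smul_sub_le (h := fun x => ⟪p, x⟫) (g := gauge Ω) (hinv x hx).1 (hinv y hy).1
      (hinn _ _) (hgau _ _) (h.inner_le_mul_norm_mul_gauge hp _) (h.norm_le _)
    simp only [(hinv x hx).2, (hinv y hy).2] at this
    exact this

/-- Near a point of differentiability, the boundary is almost isometric to the tangent
hyperplane. -/
lemma exists_flatten_almost_isometry [NeZero n] {p : Euc n}
    (hd : DifferentiableAt ℝ (gauge Ω) p) {K : ℝ≥0} (hK : 1 < K) :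
    ∃ ρ > 0, ∀ A ⊆ frontier Ω ∩ ball p ρ, (∀ a ∈ A, 0 < ⟪gaugeGrad Ω p, a⟫) ∧
      (∀ x ∈ rayCone A, ∀ y ∈ rayCone A,
        dist (flatten Ω (gaugeGrad Ω p) x) (flatten Ω (gaugeGrad Ω p) y) ≤ K * dist x y) ∧
      ∀ x ∈ rayCone A, ∀ y ∈ rayCone A,
        dist x y ≤ K * dist (flatten Ω (gaugeGrad Ω p) x) (flatten Ω (gaugeGrad Ω p) y) := by
  have hR := h.radius_pos
  have hr := h.pos
  have hK1 : (1 : ℝ) < K := hK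
  set G := gaugeGrad Ω p
  set C : ℝ := 2 + 2 * R * ((1 + (1 + R) * r⁻¹) + 2 * r⁻¹) with hC
  have hC0 : 0 < C := by positivity
  set η : ℝ := 1 - (K : ℝ)⁻¹ with hη
  have hη0 : 0 < η := sub_pos.2 (inv_lt_one_of_one_lt₀ hK1)
  set ε : ℝ := min (1 / 2) (η / C)
  have hε0 : 0 < ε := lt_min (by norm_num) (by positivity)
  have hε1 : ε ≤ 1 / 2 := min_le_left _ _
  have hεC : ε * C ≤ η := (le_div_iff₀ hC0).1 (min_le_right _ _)
  obtain ⟨ρ, hρ, hball⟩ := h.exists_abs_gauge_sub_inner_le hd hε0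
  refine ⟨min ρ 1, lt_min hρ one_pos, fun A hA => ?_⟩
  set f : Euc n → ℝ := fun x => gauge Ω x - ⟪G, x⟫ with hf
  have hfp : f p = 0 := by
    simp only [hf]
    rw [h.inner_gaugeGrad_self hd, sub_self]
  have hff : ∀ a ∈ A, ∀ b ∈ A, |f a - f b| ≤ ε * ‖a - b‖ := fun a ha b hb => by
    have := hball a (ball_subset_ball (min_le_left _ _) (hA ha).2) b
      (ball_subset_ball (min_le_left _ _) (hA hb).2)
    rw [inner_sub_right] at this
    simp only [hf]
    rwa [show gauge Ω a - ⟪G, a⟫ - (gauge Ω b - ⟪G, b⟫) =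
      gauge Ω a - gauge Ω b - (⟪G, a⟫ - ⟪G, b⟫) by ring]
  have hfa : ∀ a ∈ A, |f a| ≤ ε := fun a ha => by
    have h1 := hball a (ball_subset_ball (min_le_left _ _) (hA ha).2) p (mem_ball_self hρ)
    have h2 := (hA ha).2
    rw [mem_ball_iff_norm] at h2
    rw [inner_sub_right, h.inner_gaugeGrad_self hd] at h1
    simp only [hf]
    rw [show gauge Ω a - ⟪G, a⟫ = gauge Ω a - gauge Ω p - (⟪G, a⟫ - gauge Ω p) by ring]
    refine h1.trans ?_
    have := h2.le.trans (min_le_right _ _)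
    nlinarith
  have hGa : ∀ a ∈ A, 1 / 2 ≤ ⟪G, a⟫ := fun a ha => by
    have h1 := (abs_le.1 (hfa a ha)).2
    simp only [hf] at h1
    rw [(h.mem_frontier_iff a).1 (hA ha).1] at h1
    linarith
  have haR : ∀ a ∈ A, ‖a‖ ≤ R := fun a ha => by
    have h2 := h.norm_radProj_le a
    rwa [h.radProj_of_mem_frontier (hA ha).1] at h2
  have hfs : ∀ s : ℝ, 0 < s → ∀ a, f (s • a) = s * f a := fun s hs a => by
    simp only [hf]
    rw [gauge_smul_nonneg Ω hs.le, inner_smul_right, mul_sub]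
  have hmain : ∀ x ∈ rayCone A, ∀ y ∈ rayCone A,
      ‖(flatten Ω G x - flatten Ω G y) - (x - y)‖ ≤ η * ‖x - y‖ := by
    rintro x ⟨s, hs, a, ha, rfl⟩ y ⟨t, ht, b, hb, rfl⟩
    have hga := (h.mem_frontier_iff a).1 (hA ha).1
    have hgb := (h.mem_frontier_iff b).1 (hA hb).1
    have hp1 : 0 < ⟪G, s • a⟫ := by
      rw [inner_smul_right]
      exact mul_pos hs (by linarith [hGa a ha])
    have hp2 : 0 < ⟪G, t • b⟫ := by
      rw [inner_smul_right]
      exact mul_pos ht (by linarith [hGa b hb])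
    have hst : |s - t| ≤ r⁻¹ * ‖s • a - t • b‖ := by
      have := h.abs_gauge_sub_le (s • a) (t • b)
      rwa [gauge_smul_nonneg Ω hs.le, gauge_smul_nonneg Ω ht.le, hga, hgb, mul_one, mul_one,
        ← inv_mul_eq_div] at this
    have htab : t * ‖a - b‖ ≤ (1 + R * r⁻¹) * ‖s • a - t • b‖ := by
      have e1 : t • (a - b) = (s • a - t • b) - (s - t) • a := by module
      have e2 : t * ‖a - b‖ = ‖t • (a - b)‖ := by rw [norm_smul, Real.norm_of_nonneg ht.le]
      rw [e2, e1]
      refine (norm_sub_le _ _).trans ?_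
      rw [norm_smul, Real.norm_eq_abs]
      have := mul_le_mul hst (haR a ha) (norm_nonneg _) (by positivity)
      linarith
    have k1 : |f (s • a) - f (t • b)| ≤ ε * (1 + (1 + R) * r⁻¹) * ‖s • a - t • b‖ := by
      rw [hfs s hs, hfs t ht, show s * f a - t * f b = (s - t) * f a + t * (f a - f b) by ring]
      refine (abs_add_le _ _).trans ?_
      rw [abs_mul, abs_mul, abs_of_pos ht]
      have q1 := mul_le_mul hst (hfa a ha) (abs_nonneg _) (by positivity)
      have q2 := mul_le_mul_of_nonneg_left (hff a ha b hb) ht.le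
      have q3 := mul_le_mul_of_nonneg_left htab hε0.le
      linarith
    have k2 : |⟪G, s • a⟫ - ⟪G, t • b⟫| ≤ r⁻¹ * ‖s • a - t • b‖ := by
      rw [← inner_sub_right]
      exact (abs_real_inner_le_norm _ _).trans
        (mul_le_mul_of_nonneg_right (h.norm_gaugeGrad_le p) (norm_nonneg _))
    have k3 : |f (s • a)| ≤ 2 * ε * ⟪G, s • a⟫ := by
      rw [hfs s hs, abs_mul, abs_of_pos hs, inner_smul_right]
      have := hfa a ha
      have := hGa a ha
      have : |f a| ≤ 2 * ε * ⟪G, a⟫ := by nlinarith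
      nlinarith
    have k4 : ‖t • b‖ ≤ 2 * R * ⟪G, t • b⟫ := by
      rw [norm_smul, Real.norm_of_nonneg ht.le, inner_smul_right]
      have := haR b hb
      have := hGa b hb
      have : ‖b‖ ≤ 2 * R * ⟪G, b⟫ := by nlinarith
      nlinarith
    have key := norm_div_smul_sub_le (h := f) (g := fun x => ⟪G, x⟫) hp1 hp2 k1 k2 k3 k4
    have hfl : ∀ x : Euc n, 0 < ⟪G, x⟫ → flatten Ω G x = x + (f x / ⟪G, x⟫) • x := fun x hx => by
      have : gauge Ω x / ⟪G, x⟫ = 1 + f x / ⟪G, x⟫ := by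
        simp only [hf]
        field_simp
        ring
      rw [flatten, this, add_smul, one_smul]
    rw [hfl _ hp1, hfl _ hp2]
    have e3 : ∀ x y u v : Euc n, x + u - (y + v) - (x - y) = u - v := fun x y u v => by abel
    rw [e3]
    refine key.trans (mul_le_mul_of_nonneg_right ?_ (norm_nonneg _))
    refine le_trans (le_of_eq ?_) hεC
    rw [hC]
    ring
  refine ⟨fun a ha => by linarith [hGa a ha], fun x hx y hy => ?_, fun x hx y hy => ?_⟩
  · rw [dist_eq_norm, dist_eq_norm]
    have h1 := hmain x hx y hy
    have h2 := norm_sub_norm_le (flatten Ω G x - flatten Ω G y) (x - y)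
    have h3 : 1 + η ≤ K := by
      rw [hη]
      have : 2 ≤ (K : ℝ) + (K : ℝ)⁻¹ := by
        have hK0 : (0 : ℝ) < K := by linarith
        have : (K : ℝ) * (K : ℝ)⁻¹ = 1 := mul_inv_cancel₀ hK0.ne'
        nlinarith [sq_nonneg ((K : ℝ) - (K : ℝ)⁻¹), inv_pos.2 hK0]
      linarith
    nlinarith [norm_nonneg (x - y)]
  · rw [dist_eq_norm, dist_eq_norm]
    have h1 := hmain x hx y hy
    have h2 := norm_sub_norm_le (x - y) (flatten Ω G x - flatten Ω G y)
    rw [norm_sub_rev (x - y)] at h2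
    have h3 : (K : ℝ)⁻¹ * ‖x - y‖ ≤ ‖flatten Ω G x - flatten Ω G y‖ := by
      rw [hη] at h1
      linarith
    rwa [inv_mul_le_iff₀ (by linarith)] at h3

lemma coneMeasure_closedBall_pos [NeZero n] {p : Euc n} (hp : p ∈ frontier Ω) {t : ℝ}
    (ht : 0 < t) : 0 < coneMeasure Ω (closedBall p t) := by
  have hR := h.radius_pos
  have hr := h.pos
  rw [coneMeasure, Measure.map_apply h.measurable_radProj isClosed_closedBall.measurableSet,
    Measure.restrict_apply (h.measurable_radProj isClosed_closedBall.measurableSet)]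
  set δ : ℝ := t / (1 + R / r)
  have hδ : 0 < δ := by positivity
  have hne : (ball p δ ∩ Ω).Nonempty :=
    mem_closure_iff_nhds.1 (frontier_subset_closure hp) _ (ball_mem_nhds p hδ)
  refine ((isOpen_ball.inter h.isOpen).measure_pos volume hne).trans_le (measure_mono ?_)
  rintro x ⟨hx, hxΩ⟩
  refine ⟨?_, hxΩ⟩
  rw [mem_ball_iff_norm] at hx
  rw [mem_preimage, mem_closedBall, dist_eq_norm]
  have h1 := h.norm_sub_radProj_le x
  have h2 := h.abs_gauge_sub_le x p
  rw [(h.mem_frontier_iff p).1 hp] at h2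
  have h3 : ‖radProj Ω x - p‖ ≤ ‖x - radProj Ω x‖ + ‖x - p‖ := by
    rw [norm_sub_rev x (radProj Ω x)]
    exact norm_sub_le_norm_sub_add_norm_sub _ _ _
  have h4 : ‖x - p‖ * (1 + R / r) ≤ t := (le_div_iff₀ (by positivity)).1 hx.le
  have h5 : R * |gauge Ω x - 1| ≤ R * (‖x - p‖ / r) := mul_le_mul_of_nonneg_left h2 hR.le
  have h6 : R * (‖x - p‖ / r) = ‖x - p‖ * (R / r) := by ring
  linarith

end ConvexBetween

namespace ConvexBetween

variable {r R : ℝ} {Ω : Set (Euc n)} (h : ConvexBetween r R Ω)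
include h

section

variable [NeZero n] {c : ℝ≥0} (hc0 : c ≠ 0) (hc : ∀ G : Euc n, G ≠ 0 → ∀ E : Set (Euc n),
  MeasurableSet E → (∀ x ∈ E, ⟪G, x⟫ = 1) →
    ENNReal.ofReal ‖G‖ * volume (coneSet E) = c * μH[(n : ℝ) - 1] E)
include hc0 hc

lemma exists_hausdorffMeasure_le {p : Euc n} (hp : p ∈ frontier Ω) : ∃ ρ > 0, ∃ K : ℝ≥0∞, K ≠ ⊤ ∧
    ∀ A ⊆ frontier Ω ∩ ball p ρ, MeasurableSet A → μH[(n : ℝ) - 1] A ≤ K * coneMeasure Ω A := by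
  obtain ⟨ρ, hρ, K₁, K₂, hA⟩ := h.exists_flatten_bilipschitz hp
  have hc0' : (c : ℝ≥0∞) ≠ 0 := by simpa using hc0
  refine ⟨ρ, hρ, (c : ℝ≥0∞)⁻¹ * ((K₂ : ℝ≥0∞) ^ (n - 1) * (K₁ : ℝ≥0∞) ^ n * ENNReal.ofReal ‖p‖),
    ?_, fun A hAf hAm => ?_⟩
  · refine ENNReal.mul_ne_top (ENNReal.inv_ne_top.2 hc0') (ENNReal.mul_ne_top (ENNReal.mul_ne_top
      ?_ ?_) ENNReal.ofReal_ne_top)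
    · exact ENNReal.pow_ne_top ENNReal.coe_ne_top
    · exact ENNReal.pow_ne_top ENNReal.coe_ne_top
  · obtain ⟨h1, h2, h3⟩ := hA A hAf
    have h4 := h.hausdorffMeasure_le_coneMeasure hc hAm (hAf.trans inter_subset_left)
      (h.ne_zero_of_mem_frontier hp) h1 h2 h3
    calc μH[(n : ℝ) - 1] A = (c : ℝ≥0∞)⁻¹ * (c * μH[(n : ℝ) - 1] A) := by
          rw [← mul_assoc, ENNReal.inv_mul_cancel hc0' ENNReal.coe_ne_top, one_mul]
      _ ≤ (c : ℝ≥0∞)⁻¹ * _ := mul_le_mul_right h4 _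
      _ = _ := by ring

lemma hausdorffMeasure_frontier_lt_top : μH[(n : ℝ) - 1] (frontier Ω) < ⊤ := by
  have := h.isFiniteMeasure_coneMeasure
  have hcpt : IsCompact (frontier Ω) :=
    h.isCompact_closure.of_isClosed_subset isClosed_frontier frontier_subset_closure
  refine hcpt.measure_lt_top_of_nhdsWithin fun p hp => ?_
  obtain ⟨ρ, hρ, K, hK, hA⟩ := h.exists_hausdorffMeasure_le hc0 hc hp
  refine ⟨frontier Ω ∩ ball p ρ, inter_mem_nhdsWithin _ (ball_mem_nhds p hρ), ?_⟩
  refine (hA _ subset_rfl (isClosed_frontier.measurableSet.inter measurableSet_ball)).trans_lt ?_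
  exact ENNReal.mul_lt_top hK.lt_top (measure_lt_top _ _)

lemma restrict_hausdorffMeasure_absolutelyContinuous :
    (μH[(n : ℝ) - 1]).restrict (frontier Ω) ≪ coneMeasure Ω := by
  refine Measure.AbsolutelyContinuous.mk fun N hN hN0 => ?_
  rw [Measure.restrict_apply hN]
  refine measure_null_of_locally_null _ fun p hp => ?_
  obtain ⟨ρ, hρ, K, -, hA⟩ := h.exists_hausdorffMeasure_le hc0 hc hp.2
  refine ⟨(N ∩ frontier Ω) ∩ ball p ρ, inter_mem_nhdsWithin _ (ball_mem_nhds p hρ), ?_⟩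
  have h1 := hA ((N ∩ frontier Ω) ∩ ball p ρ) (inter_subset_inter_left _ inter_subset_right)
    ((hN.inter isClosed_frontier.measurableSet).inter measurableSet_ball)
  have h2 : coneMeasure Ω ((N ∩ frontier Ω) ∩ ball p ρ) = 0 :=
    measure_mono_null (inter_subset_left.trans inter_subset_left) hN0
  rw [h2, mul_zero] at h1
  exact le_antisymm h1 zero_le

lemma rnDeriv_hausdorffMeasure {p : Euc n} (hp : p ∈ frontier Ω)
    (hd : DifferentiableAt ℝ (gauge Ω) p) {D : ℝ≥0∞}
    (hD : Tendsto (fun t => (μH[(n : ℝ) - 1]).restrict (frontier Ω) (closedBall p t) /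
      coneMeasure Ω (closedBall p t)) (𝓝[>] 0) (𝓝 D)) :
    c * D = ENNReal.ofReal ‖gaugeGrad Ω p‖ := by
  have := h.isFiniteMeasure_coneMeasure
  set b := ENNReal.ofReal ‖gaugeGrad Ω p‖
  have hG : gaugeGrad Ω p ≠ 0 := norm_pos_iff.1 (h.norm_gaugeGrad_pos hd
    (h.ne_zero_of_mem_frontier hp))
  have hcD := ENNReal.Tendsto.const_mul hD (Or.inr (ENNReal.coe_ne_top (r := c)))
  have hlim : ∀ m k : ℕ, ∀ X : ℝ≥0∞, Tendsto (fun K : ℝ≥0 => (K : ℝ≥0∞) ^ m * (K : ℝ≥0∞) ^ k * X)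
      (𝓝[>] 1) (𝓝 X) := fun m k X => by
    have h1 : Tendsto (fun K : ℝ≥0 => ((K ^ m * K ^ k : ℝ≥0) : ℝ≥0∞)) (𝓝[>] 1) (𝓝 1) := by
      have h2 : Continuous fun K : ℝ≥0 => ((K ^ m * K ^ k : ℝ≥0) : ℝ≥0∞) :=
        ENNReal.continuous_coe.comp (by fun_prop)
      simpa using (h2.tendsto 1).mono_left nhdsWithin_le_nhds
    have h3 := ENNReal.Tendsto.mul_const h1 (b := X) (Or.inl one_ne_zero)
    rw [one_mul] at h3
    simpa using h3
  have hne : (𝓝[>] (1 : ℝ≥0)).NeBot := nhdsGT_neBot_of_exists_gt ⟨2, one_lt_two⟩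
  have hboth : ∀ K : ℝ≥0, 1 < K → c * D ≤ (K : ℝ≥0∞) ^ (n - 1) * (K : ℝ≥0∞) ^ n * b ∧
      b ≤ (K : ℝ≥0∞) ^ n * (K : ℝ≥0∞) ^ (n - 1) * (c * D) := fun K hK => by
    obtain ⟨ρ, hρ, hA⟩ := h.exists_flatten_almost_isometry hd hK
    have hev : ∀ᶠ t in 𝓝[>] (0 : ℝ), c * ((μH[(n : ℝ) - 1]).restrict (frontier Ω) (closedBall p t) /
          coneMeasure Ω (closedBall p t)) ≤ (K : ℝ≥0∞) ^ (n - 1) * (K : ℝ≥0∞) ^ n * b ∧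
        b ≤ (K : ℝ≥0∞) ^ n * (K : ℝ≥0∞) ^ (n - 1) *
          (c * ((μH[(n : ℝ) - 1]).restrict (frontier Ω) (closedBall p t) /
            coneMeasure Ω (closedBall p t))) := by
      filter_upwards [Ioo_mem_nhdsGT hρ] with t ht
      set A := closedBall p t ∩ frontier Ω
      have hAf : A ⊆ frontier Ω := inter_subset_right
      have hAm : MeasurableSet A :=
        isClosed_closedBall.measurableSet.inter isClosed_frontier.measurableSet
      obtain ⟨h1, h2, h3⟩ := hA A fun x hx => ⟨hx.2, closedBall_subset_ball ht.2 hx.1⟩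
      have k1 := h.hausdorffMeasure_le_coneMeasure hc hAm hAf hG h1 h2 h3
      have k2 := h.coneMeasure_le_hausdorffMeasure hc hAm hAf hG h1 h2 h3
      have e1 : (μH[(n : ℝ) - 1]).restrict (frontier Ω) (closedBall p t) = μH[(n : ℝ) - 1] A :=
        Measure.restrict_apply isClosed_closedBall.measurableSet
      have e2 : coneMeasure Ω A = coneMeasure Ω (closedBall p t) :=
        measure_inter_conull h.ae_coneMeasure_mem_frontier
      rw [e1]
      rw [e2] at k1 k2
      have hV0 := (h.coneMeasure_closedBall_pos hp ht.1).ne'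
      have hVt : coneMeasure Ω (closedBall p t) ≠ ⊤ := measure_ne_top _ _
      rw [← mul_div_assoc, ← mul_div_assoc]
      constructor
      · rw [ENNReal.div_le_iff hV0 hVt, mul_assoc _ b]
        exact k1
      · rw [ENNReal.le_div_iff_mul_le (Or.inl hV0) (Or.inl hVt)]
        exact k2
    constructor
    · exact le_of_tendsto hcD (hev.mono fun t ht => ht.1)
    · refine ge_of_tendsto (ENNReal.Tendsto.const_mul hcD (Or.inr ?_)) (hev.mono fun t ht => ht.2)
      exact ENNReal.mul_ne_top (ENNReal.pow_ne_top ENNReal.coe_ne_top)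
        (ENNReal.pow_ne_top ENNReal.coe_ne_top)
  refine le_antisymm ?_ ?_
  · exact ge_of_tendsto (hlim _ _ _) (eventually_mem_nhdsWithin.mono fun K hK => (hboth K hK).1)
  · exact ge_of_tendsto (hlim _ _ _) (eventually_mem_nhdsWithin.mono fun K hK => (hboth K hK).2)

/-- The surface measure of a convex set in terms of its cone measure. -/
lemma smul_restrict_hausdorffMeasure : c • (μH[(n : ℝ) - 1]).restrict (frontier Ω) =
    (coneMeasure Ω).withDensity fun x => ENNReal.ofReal ‖gaugeGrad Ω x‖ := by
  have i1 := h.isFiniteMeasure_coneMeasure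
  have i2 : IsFiniteMeasure ((μH[(n : ℝ) - 1]).restrict (frontier Ω)) :=
    ⟨by rw [Measure.restrict_apply_univ]; exact h.hausdorffMeasure_frontier_lt_top hc0 hc⟩
  have i3 : ((μH[(n : ℝ) - 1]).restrict (frontier Ω)).HaveLebesgueDecomposition (coneMeasure Ω) :=
    Measure.haveLebesgueDecomposition_of_sigmaFinite _ _
  have h1 := Measure.withDensity_rnDeriv_eq _ _
    (h.restrict_hausdorffMeasure_absolutelyContinuous hc0 hc)
  have h2 : (fun x => (c : ℝ≥0∞) *
      ((μH[(n : ℝ) - 1]).restrict (frontier Ω)).rnDeriv (coneMeasure Ω) x) =ᵐ[coneMeasure Ω]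
      fun x => ENNReal.ofReal ‖gaugeGrad Ω x‖ := by
    filter_upwards [Besicovitch.ae_tendsto_rnDeriv ((μH[(n : ℝ) - 1]).restrict (frontier Ω))
      (coneMeasure Ω), h.ae_coneMeasure_mem_frontier, h.ae_coneMeasure_differentiableAt]
      with p hD hp hd
    exact h.rnDeriv_hausdorffMeasure hc0 hc hp hd hD
  rw [← withDensity_congr_ae h2]
  change _ = (coneMeasure Ω).withDensity ((c : ℝ≥0∞) •
      ((μH[(n : ℝ) - 1]).restrict (frontier Ω)).rnDeriv (coneMeasure Ω))
  rw [withDensity_smul _ (Measure.measurable_rnDeriv _ _), h1]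
  rfl

lemma integral_frontier (f : Euc n → ℝ) : ∫ x in frontier Ω, f x ∂μH[(n : ℝ) - 1] =
    (c : ℝ)⁻¹ * ∫ x, ‖gaugeGrad Ω x‖ * f x ∂coneMeasure Ω := by
  have h1 : ∫ x, f x ∂(c • (μH[(n : ℝ) - 1]).restrict (frontier Ω)) =
      ∫ x, ‖gaugeGrad Ω x‖ * f x ∂coneMeasure Ω := by
    rw [h.smul_restrict_hausdorffMeasure hc0 hc]
    have := integral_withDensity_eq_integral_toReal_smul (μ := coneMeasure Ω)
      (f := fun x => ENNReal.ofReal ‖gaugeGrad Ω x‖)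
      (measurable_gaugeGrad Ω).norm.ennreal_ofReal (ae_of_all _ fun x => ENNReal.ofReal_lt_top) f
    rw [this]
    refine integral_congr_ae (ae_of_all _ fun x => ?_)
    simp only
    rw [ENNReal.toReal_ofReal (norm_nonneg _), smul_eq_mul]
  have hc' : (c : ℝ) ≠ 0 := by exact_mod_cast hc0
  rw [← h1, integral_smul_nnreal_measure, NNReal.smul_def, smul_eq_mul, inv_mul_cancel_left₀ hc']

end

end ConvexBetween

section

variable (Ω : Set (Euc n)) (a : Euc n)

lemma isOuterNormalAt_preimage_add_iff {K : Set (Euc n)} {x X : Euc n} :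
    IsOuterNormalAt ((fun y => a + y) ⁻¹' K) x X ↔ IsOuterNormalAt K (a + x) X := by
  refine and_congr_right fun _ => ⟨fun h y hy => ?_, fun h y hy => ?_⟩
  · have := h (y - a) (by simpa using hy)
    rw [inner_sub_left] at this
    rw [inner_add_left]
    linarith
  · have := h _ hy
    rw [inner_add_left, inner_add_left] at this
    linarith

lemma gaussMap_preimage_add (K : Set (Euc n)) (x : Euc n) :
    gaussMap ((fun y => a + y) ⁻¹' K) x = gaussMap K (a + x) := by
  have : IsOuterNormalAt ((fun y => a + y) ⁻¹' K) x = IsOuterNormalAt K (a + x) :=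
    funext fun X => propext (isOuterNormalAt_preimage_add_iff a)
  unfold gaussMap
  rw [this]

lemma closure_preimage_add : closure ((fun y => a + y) ⁻¹' Ω) = (fun y => a + y) ⁻¹' closure Ω :=
  ((Homeomorph.addLeft a).preimage_closure Ω).symm

lemma frontier_preimage_add :
    frontier ((fun y => a + y) ⁻¹' Ω) = (fun y => a + y) ⁻¹' frontier Ω :=
  ((Homeomorph.addLeft a).preimage_frontier Ω).symm

lemma ntCone_preimage_add (x : Euc n) (α : ℝ) :
    ntCone ((fun y => a + y) ⁻¹' Ω) x α = (fun y => a + y) ⁻¹' ntCone Ω (a + x) α := by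
  ext y
  have h1 : infDist y ((fun y => a + y) ⁻¹' frontier Ω) = infDist (a + y) (frontier Ω) := by
    have h2 := Metric.infDist_image (IsometryEquiv.addLeft a).isometry (x := y)
      (t := (fun y => a + y) ⁻¹' frontier Ω)
    rw [← h2]
    congr 1
    exact (image_preimage_eq _ (IsometryEquiv.addLeft a).surjective)
  simp only [ntCone, frontier_preimage_add, mem_ofPred_eq, mem_preimage, h1, dist_add_left]

lemma gradient_comp_add (u : Euc n → ℝ) (x : Euc n) :
    gradient (fun y => u (a + y)) x = gradient u (a + x) := by
  rw [gradient, gradient, fderiv_comp_add_left]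

lemma hasNTLimitAt_preimage_add_iff {u : Euc n → ℝ} {x L : Euc n} :
    HasNTLimitAt ((fun y => a + y) ⁻¹' Ω) (gradient fun y => u (a + y)) x L ↔
      HasNTLimitAt Ω (gradient u) (a + x) L := by
  refine forall₂_congr fun α _ => ?_
  rw [ntCone_preimage_add]
  have h1 : map (fun y => a + y) (𝓝[(fun y => a + y) ⁻¹' ntCone Ω (a + x) α] x) =
      𝓝[ntCone Ω (a + x) α] (a + x) := by
    have h3 := (Homeomorph.addLeft a).isEmbedding.map_nhdsWithin_eq
      ((fun y => a + y) ⁻¹' ntCone Ω (a + x) α) x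
    have h4 : (Homeomorph.addLeft a) '' ((fun y => a + y) ⁻¹' ntCone Ω (a + x) α) =
        ntCone Ω (a + x) α := image_preimage_eq _ (Homeomorph.addLeft a).surjective
    rwa [h4] at h3
  have h2 : (gradient fun y => u (a + y)) = gradient u ∘ fun y => a + y :=
    funext fun y => gradient_comp_add a u y
  rw [h2, ← tendsto_map'_iff, h1]

lemma ntGradient_preimage_add (u : Euc n → ℝ) (x : Euc n) :
    ntGradient ((fun y => a + y) ⁻¹' Ω) (fun y => u (a + y)) x = ntGradient Ω u (a + x) := by
  have : HasNTLimitAt ((fun y => a + y) ⁻¹' Ω) (gradient fun y => u (a + y)) x =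
      HasNTLimitAt Ω (gradient u) (a + x) :=
    funext fun L => propext (hasNTLimitAt_preimage_add_iff Ω a)
  unfold ntGradient
  rw [this]

variable {Ω}

lemma ntGradient_congr (hΩ : IsOpen Ω) {u v : Euc n → ℝ} (huv : EqOn u v Ω) (x : Euc n) :
    ntGradient Ω u x = ntGradient Ω v x := by
  have hg : EqOn (gradient u) (gradient v) Ω := fun y hy => by
    rw [gradient, gradient, (huv.eventuallyEq_of_mem (hΩ.mem_nhds hy)).fderiv_eq]
  have : HasNTLimitAt Ω (gradient u) x = HasNTLimitAt Ω (gradient v) x := by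
    funext L
    refine propext (forall₂_congr fun α _ => tendsto_congr' ?_)
    filter_upwards [self_mem_nhdsWithin] with y hy using hg hy.1
  unfold ntGradient
  rw [this]

lemma IsTorsionFunction.comp_add (hΩ : IsOpen Ω) {u : Euc n → ℝ} (hu : IsTorsionFunction Ω u) :
    IsTorsionFunction ((fun y => a + y) ⁻¹' Ω) fun y => u (a + y) where
  continuousOn := by
    rw [closure_preimage_add]
    exact hu.continuousOn.comp (by fun_prop) fun x hx => hx
  smooth := hu.smooth.comp (by fun_prop) fun x hx => hx
  lapl_eq := fun x hx => by
    have h1 := lapl_comp_affine a 1 x (f := u) (by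
      rw [one_smul]
      exact (hu.smooth.contDiffAt (hΩ.mem_nhds hx)).of_le two_le_infty)
    simp only [one_smul, one_pow, one_mul] at h1
    rw [h1]
    exact hu.lapl_eq _ hx
  boundary_zero := fun x hx => by
    rw [frontier_preimage_add] at hx
    exact hu.boundary_zero _ hx

lemma mixedTorsion_preimage_add [NeZero n] (hΩ : IsOpen Ω) (hb : IsBounded Ω) (K : Set (Euc n)) :
    mixedTorsion ((fun y => a + y) ⁻¹' Ω) K = mixedTorsion Ω K := by
  have hmp : MeasurePreserving (fun y : Euc n => a + y) μH[(n : ℝ) - 1] μH[(n : ℝ) - 1] :=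
    (IsometryEquiv.addLeft a).measurePreserving_hausdorffMeasure _
  have hΩ' : IsOpen ((fun y => a + y) ⁻¹' Ω) := hΩ.preimage (by fun_prop)
  have hb' : IsBounded ((fun y => a + y) ⁻¹' Ω) := by
    rw [isBounded_iff_forall_norm_le] at hb ⊢
    obtain ⟨C, hC⟩ := hb
    refine ⟨C + ‖a‖, fun x hx => ?_⟩
    have h1 := hC _ hx
    have h2 := norm_sub_le (a + x) a
    rw [add_sub_cancel_left] at h2
    linarith
  by_cases h : ∃ u, IsTorsionFunction Ω u
  · have h' : ∃ u, IsTorsionFunction ((fun y => a + y) ⁻¹' Ω) u :=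
      ⟨_, IsTorsionFunction.comp_add a hΩ h.choose_spec⟩
    have h1 := IsTorsionFunction.unique hΩ' hb' h'.choose_spec
      (IsTorsionFunction.comp_add a hΩ h.choose_spec)
    have h2 := hmp.setIntegral_preimage_emb (Homeomorph.addLeft a).measurableEmbedding
      (fun x => suppFn (closure K) (gaussMap (closure Ω) x) * ‖ntGradient Ω h.choose x‖ ^ 2)
      (frontier Ω)
    rw [mixedTorsion, mixedTorsion, dif_pos h, dif_pos h', frontier_preimage_add, ← h2]
    congr 1
    funext x
    rw [ntGradient_congr hΩ' (h1.mono subset_closure), ntGradient_preimage_add,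
      closure_preimage_add, gaussMap_preimage_add]
  · have h' : ¬∃ u, IsTorsionFunction ((fun y => a + y) ⁻¹' Ω) u := by
      rintro ⟨u, hu⟩
      have := IsTorsionFunction.comp_add (-a) hΩ' hu
      rw [← preimage_comp] at this
      have e : (fun y => a + y) ∘ (fun y => -a + y) = (id : Euc n → Euc n) := by
        funext y
        simp
      rw [e, preimage_id] at this
      exact h ⟨_, this⟩
    rw [mixedTorsion, mixedTorsion, dif_neg h, dif_neg h']

end

section

lemma suppFn_smul (K : Set (Euc n)) {s : ℝ} (hs : 0 ≤ s) (X : Euc n) :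
    suppFn K (s • X) = s * suppFn K X := by
  rw [suppFn, suppFn, ← smul_eq_mul, ← Real.sSup_smul_of_nonneg hs, ← image_smul, image_image]
  simp only [inner_smul_right, smul_eq_mul]

variable {K K' : Set (Euc n)} {M : ℝ}

lemma bddAbove_image_inner (hK : K ⊆ closedBall 0 M) (X : Euc n) :
    BddAbove ((fun y => ⟪y, X⟫) '' K) := by
  refine ⟨M * ‖X‖, ?_⟩
  rintro _ ⟨y, hy, rfl⟩
  exact (real_inner_le_norm y X).trans
    (mul_le_mul_of_nonneg_right (mem_closedBall_zero_iff.1 (hK hy)) (norm_nonneg X))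

lemma inner_le_suppFn (hK : K ⊆ closedBall 0 M) {y : Euc n} (hy : y ∈ K) (X : Euc n) :
    ⟪y, X⟫ ≤ suppFn K X :=
  le_csSup (bddAbove_image_inner hK X) (mem_image_of_mem _ hy)

lemma suppFn_le (hne : K.Nonempty) {X : Euc n} {c : ℝ} (h : ∀ y ∈ K, ⟪y, X⟫ ≤ c) :
    suppFn K X ≤ c := by
  refine csSup_le (hne.image _) ?_
  rintro _ ⟨y, hy, rfl⟩
  exact h y hy

lemma abs_suppFn_sub_le (hne : K.Nonempty) (hK : K ⊆ closedBall 0 M) (X Y : Euc n) :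
    |suppFn K X - suppFn K Y| ≤ M * ‖X - Y‖ := by
  have key : ∀ X Y : Euc n, suppFn K X ≤ suppFn K Y + M * ‖X - Y‖ := fun X Y => by
    refine suppFn_le hne fun y hy => ?_
    have h1 := inner_le_suppFn hK hy Y
    have h2 := (real_inner_le_norm y (X - Y)).trans
      (mul_le_mul_of_nonneg_right (mem_closedBall_zero_iff.1 (hK hy)) (norm_nonneg _))
    rw [inner_sub_right] at h2
    linarith
  rw [abs_sub_le_iff]
  have h1 := key X Y
  have h2 := key Y X
  rw [norm_sub_rev] at h2
  constructor <;> linarith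

lemma continuous_suppFn (hne : K.Nonempty) (hK : K ⊆ closedBall 0 M) : Continuous (suppFn K) := by
  obtain ⟨y, hy⟩ := hne
  have hM : 0 ≤ M := (norm_nonneg y).trans (mem_closedBall_zero_iff.1 (hK hy))
  refine (LipschitzWith.of_dist_le_mul (K := ⟨M, hM⟩) fun X Y => ?_).continuous
  rw [Real.dist_eq, dist_eq_norm]
  exact abs_suppFn_sub_le ⟨y, hy⟩ hK X Y

lemma abs_suppFn_le (hne : K.Nonempty) (hK : K ⊆ closedBall 0 M) (X : Euc n) :
    |suppFn K X| ≤ M * ‖X‖ := by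
  have h1 := abs_suppFn_sub_le hne hK X 0
  have h2 : suppFn K 0 = 0 := by simpa using suppFn_smul K le_rfl (0 : Euc n)
  rwa [h2, sub_zero, sub_zero] at h1

lemma abs_suppFn_sub_suppFn_le (hne : K.Nonempty) (hne' : K'.Nonempty)
    (hK : K ⊆ closedBall 0 M) (hK' : K' ⊆ closedBall 0 M) (X : Euc n) :
    |suppFn K X - suppFn K' X| ≤ hausdorffDist K K' * ‖X‖ := by
  have key : ∀ K K' : Set (Euc n), K.Nonempty → K'.Nonempty → K ⊆ closedBall 0 M →
      K' ⊆ closedBall 0 M → suppFn K X ≤ suppFn K' X + hausdorffDist K K' * ‖X‖ := by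
    intro K K' hne hne' hK hK'
    have hfin : hausdorffEDist K K' ≠ ⊤ := hausdorffEDist_ne_top_of_nonempty_of_bounded hne hne'
      (isBounded_closedBall.subset hK) (isBounded_closedBall.subset hK')
    have h1 : ∀ ε > 0, suppFn K X ≤ suppFn K' X + (hausdorffDist K K' + ε) * ‖X‖ := by
      intro ε hε
      refine suppFn_le hne fun y hy => ?_
      obtain ⟨z, hz, hyz⟩ := exists_dist_lt_of_hausdorffDist_lt hy
        (lt_add_of_pos_right (hausdorffDist K K') hε) hfin
      have h2 := inner_le_suppFn hK' hz X
      have h3 := (real_inner_le_norm (y - z) X).trans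
        (mul_le_mul_of_nonneg_right (dist_eq_norm y z ▸ hyz.le) (norm_nonneg X))
      rw [inner_sub_left] at h3
      linarith
    have h4 : Tendsto (fun ε : ℝ => suppFn K' X + (hausdorffDist K K' + ε) * ‖X‖) (𝓝[>] 0)
        (𝓝 (suppFn K' X + (hausdorffDist K K' + 0) * ‖X‖)) := by
      refine Tendsto.mono_left (Continuous.tendsto ?_ 0) nhdsWithin_le_nhds
      fun_prop
    rw [add_zero] at h4
    exact ge_of_tendsto h4 (eventually_mem_nhdsWithin.mono fun ε hε => h1 ε hε)
  rw [abs_sub_le_iff]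
  have h1 := key K K' hne hne' hK hK'
  have h2 := key K' K hne' hne hK' hK
  rw [hausdorffDist_comm] at h2
  constructor <;> linarith

end

namespace ConvexBetween

variable [NeZero n] {L r R : ℝ} {Ω : Set (Euc n)} (h : ConvexBetween r R Ω) {u F : Euc n → ℝ}
  (hu : IsLipTorsion L Ω u) (hF : MemLp F 2 (coneMeasure Ω))
  (hrep : ∀ φ : Euc n → ℝ, ContDiff ℝ ∞ φ → HasCompactSupport φ →
    bdryFn Ω u φ = ∫ x, φ x * F x ∂coneMeasure Ω)
  {c : ℝ≥0} (hc0 : c ≠ 0) (hc : ∀ G : Euc n, G ≠ 0 → ∀ E : Set (Euc n),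
    MeasurableSet E → (∀ x ∈ E, ⟪G, x⟫ = 1) →
      ENNReal.ofReal ‖G‖ * volume (coneSet E) = c * μH[(n : ℝ) - 1] E)
include h hu hF hrep hc0 hc

lemma mixedTorsion_eq (K : Set (Euc n)) : mixedTorsion Ω K = (c : ℝ)⁻¹ *
    ∫ p, suppFn (closure K) (gaugeGrad Ω p) * (F p / (n * ‖gaugeGrad Ω p‖)) ^ 2
      ∂coneMeasure Ω := by
  have hex : ∃ v, IsTorsionFunction Ω v := ⟨u, hu.torsion⟩
  have huv := IsTorsionFunction.unique h.isOpen h.isBounded hex.choose_spec hu.torsion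
  rw [mixedTorsion, dif_pos hex, h.integral_frontier hc0 hc]
  congr 1
  refine integral_congr_ae ?_
  filter_upwards [h.ae_coneMeasure_mem_frontier, h.ae_coneMeasure_differentiableAt,
    h.ae_isBdryLebesguePt hF] with p hp hd hL
  have hb := h.norm_gaugeGrad_pos hd (h.ne_zero_of_mem_frontier hp)
  have hn : (0 : ℝ) < n := natCast_pos_of_neZero
  rw [h.ntGradient_eq hu hF hrep hd hp hL (huv.mono subset_closure), h.gaussMap_eq hd hp,
    suppFn_smul _ (inv_nonneg.2 hb.le), norm_smul, norm_neg, Real.norm_eq_abs, mul_pow, sq_abs]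
  field_simp

end ConvexBetween

namespace ConvexBetween

section Comparison

variable [NeZero n] {L r R L' r' R' : ℝ} {Ω Ω' : Set (Euc n)} (h : ConvexBetween r R Ω)
  (h' : ConvexBetween r' R' Ω')
include h h'

lemma gauge_le_mul_gauge (x : Euc n) :
    gauge Ω x ≤ (1 + hausdorffDist (closure Ω') (closure Ω) / r) * gauge Ω' x := by
  rcases eq_or_ne x 0 with rfl | hx
  · simp
  have hne : (closure Ω).Nonempty := ⟨0, subset_closure h.zero_mem⟩
  have hne' : (closure Ω').Nonempty := ⟨0, subset_closure h'.zero_mem⟩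
  have hp : radProj Ω' x ∈ closure Ω' := (h'.mem_closure_iff _).2 (h'.gauge_radProj hx).le
  obtain ⟨y, hy, hxy⟩ := h.isCompact_closure.exists_infDist_eq_dist hne (radProj Ω' x)
  have h1 := infDist_le_hausdorffDist_of_mem hp (hausdorffEDist_ne_top_of_nonempty_of_bounded
    hne' hne h'.isCompact_closure.isBounded h.isCompact_closure.isBounded)
  rw [hxy, dist_eq_norm] at h1
  have h2 := (abs_le.1 (h.abs_gauge_sub_le (radProj Ω' x) y)).2
  have h3 := (h.mem_closure_iff y).1 hy
  have h4 := div_le_div_of_nonneg_right h1 h.pos.le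
  have h5 : gauge Ω x = gauge Ω' x * gauge Ω (radProj Ω' x) := by
    rw [← gauge_smul_nonneg Ω (gauge_nonneg x), h'.gauge_smul_radProj]
  rw [h5, mul_comm]
  exact mul_le_mul_of_nonneg_right (by linarith) (gauge_nonneg x)

/-- Comparison of the torsion functions of nested domains, one of them dilated. -/
lemma torsion_le_dilate {u u' : Euc n → ℝ} (hu : IsLipTorsion L Ω u)
    (hu' : IsLipTorsion L' Ω' u') {t : ℝ} (ht : 0 < t)
    (hle : ∀ x, gauge Ω x ≤ t * gauge Ω' x) (x : Euc n) :
    u' x ≤ t ^ 2 * u (t⁻¹ • x) := by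
  by_cases hx : x ∈ Ω'
  swap
  · rw [hu'.zero_outside x hx]
    exact mul_nonneg (sq_nonneg t) (hu.nonneg _)
  have hmem : ∀ y ∈ Ω', (0 : Euc n) + t⁻¹ • y ∈ Ω := fun y hy => by
    rw [zero_add, h.mem_iff, gauge_smul_nonneg Ω (inv_pos.2 ht).le]
    have h1 := hle y
    have h2 := mul_lt_mul_of_pos_left ((h'.mem_iff y).1 hy) ht
    rw [inv_mul_lt_iff₀ ht]
    linarith
  have hcd : ∀ y ∈ Ω', ContDiffAt ℝ ∞ u ((0 : Euc n) + t⁻¹ • y) := fun y hy =>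
    hu.torsion.smooth.contDiffAt (h.isOpen.mem_nhds (hmem y hy))
  have hcd' : ∀ y ∈ Ω', ContDiffAt ℝ ∞ u' y := fun y hy =>
    hu'.torsion.smooth.contDiffAt (h'.isOpen.mem_nhds hy)
  have hcomp : ∀ y ∈ Ω', ContDiffAt ℝ ∞ (fun y => u ((0 : Euc n) + t⁻¹ • y)) y :=
    fun y hy => ContDiffAt.comp (f := fun y : Euc n => (0 : Euc n) + t⁻¹ • y) y (hcd y hy)
      (by fun_prop)
  have hcomp' : ∀ y ∈ Ω', ContDiffAt ℝ ∞ (fun y => t ^ 2 * u ((0 : Euc n) + t⁻¹ • y)) y :=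
    fun y hy => contDiffAt_const.mul (hcomp y hy)
  have key := le_zero_of_lapl_nonneg h'.isOpen h'.isBounded
    (h := fun y => u' y - t ^ 2 * u ((0 : Euc n) + t⁻¹ • y)) ?_ ?_ ?_ ?_ x (subset_closure hx)
  · simp only [zero_add] at key
    linarith
  · refine (hu'.continuous.sub (continuous_const.mul (hu.continuous.comp ?_))).continuousOn
    fun_prop
  · exact fun y hy => (((hcd' y hy).sub (hcomp' y hy)).of_le two_le_infty).contDiffWithinAt
  · intro y hy
    rw [lapl_sub ((hcd' y hy).of_le two_le_infty) ((hcomp' y hy).of_le two_le_infty),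
      lapl_const_mul _ ((hcomp y hy).of_le two_le_infty),
      lapl_comp_affine _ _ _ ((hcd y hy).of_le two_le_infty), hu'.torsion.lapl_eq y hy,
      hu.torsion.lapl_eq _ (hmem y hy), ← mul_assoc, ← mul_pow, mul_inv_cancel₀ ht.ne']
    norm_num
  · intro y hy
    rw [hu'.torsion.boundary_zero y hy, zero_sub, neg_nonpos]
    exact mul_nonneg (sq_nonneg t) (hu.nonneg _)

end Comparison

variable [NeZero n] {r R L : ℝ} {Ω : Set (Euc n)} {Ωs : ℕ → Set (Euc n)}
  (h : ConvexBetween r R Ω) (hs : ∀ i, ConvexBetween r R (Ωs i))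
  (hconv : Tendsto (fun i => hausdorffDist (closure (Ωs i)) (closure Ω)) atTop (𝓝 0))
include h hs hconv

lemma abs_gauge_sub_gauge_le (i : ℕ) (x : Euc n) :
    |gauge (Ωs i) x - gauge Ω x| ≤ hausdorffDist (closure (Ωs i)) (closure Ω) / r ^ 2 * ‖x‖ := by
  have h1 := h.gauge_le_mul_gauge (hs i) x
  have h2 := (hs i).gauge_le_mul_gauge h x
  rw [hausdorffDist_comm] at h2
  set d := hausdorffDist (closure (Ωs i)) (closure Ω) with hd
  have hd0 : 0 ≤ d / r := div_nonneg hausdorffDist_nonneg h.pos.le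
  have e : d / r ^ 2 * ‖x‖ = d / r * (‖x‖ / r) := by
    have := h.pos.ne'
    field_simp
  have h3 := mul_le_mul_of_nonneg_left (h.gauge_le x) hd0
  have h4 := mul_le_mul_of_nonneg_left ((hs i).gauge_le x) hd0
  rw [e, abs_sub_le_iff]
  constructor <;> linarith

lemma tendsto_gauge (x : Euc n) : Tendsto (fun i => gauge (Ωs i) x) atTop (𝓝 (gauge Ω x)) := by
  rw [← tendsto_sub_nhds_zero_iff]
  refine squeeze_zero_norm (a := fun i => hausdorffDist (closure (Ωs i)) (closure Ω) /
    r ^ 2 * ‖x‖) (fun i => h.abs_gauge_sub_gauge_le hs hconv i x) ?_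
  simpa using (hconv.div_const (r ^ 2)).mul_const ‖x‖

lemma tendsto_radProj {x : Euc n} (hx : x ≠ 0) :
    Tendsto (fun i => radProj (Ωs i) x) atTop (𝓝 (radProj Ω x)) :=
  ((h.tendsto_gauge hs hconv x).inv₀ (h.gauge_pos hx).ne').smul_const x

lemma tendsto_gaugeGrad {x : Euc n} (hd : DifferentiableAt ℝ (gauge Ω) x)
    (hds : ∀ i, DifferentiableAt ℝ (gauge (Ωs i)) x) :
    Tendsto (fun i => gaugeGrad (Ωs i) x) atTop (𝓝 (gaugeGrad Ω x)) := by
  have hr := h.pos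
  rw [Metric.tendsto_atTop']
  intro ε hε
  obtain ⟨ρ, hρ, hρb⟩ := h.exists_abs_gauge_sub_inner_le hd (half_pos hε)
  set s : ℝ := ρ * r / 4 with hsdef
  have hs0 : 0 < s := by positivity
  set B : ℝ := 2 * ‖x‖ + ρ with hB
  have hB0 : 0 < B := by positivity
  have h1 : Tendsto (fun i => hausdorffDist (closure (Ωs i)) (closure Ω) / r ^ 2 * B) atTop
      (𝓝 0) := by simpa using (hconv.div_const (r ^ 2)).mul_const B
  obtain ⟨N, hN⟩ := eventually_atTop.1
    (h1.eventually_lt_const (show (0 : ℝ) < s * (ε ^ 2 / 2) by positivity))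
  refine ⟨N, fun i hi => ?_⟩
  have h2 := hN i hi.le
  set d := hausdorffDist (closure (Ωs i)) (closure Ω) / r ^ 2 with hdd
  have hd0 : 0 ≤ d := div_nonneg hausdorffDist_nonneg (sq_nonneg r)
  set e := gaugeGrad (Ωs i) x - gaugeGrad Ω x with he
  have hen : ‖e‖ ≤ 2 * r⁻¹ := (norm_sub_le _ _).trans (by
    linarith [(hs i).norm_gaugeGrad_le x, h.norm_gaugeGrad_le x])
  have hse : ‖s • e‖ < ρ := by
    rw [norm_smul, Real.norm_of_nonneg hs0.le]
    calc s * ‖e‖ ≤ s * (2 * r⁻¹) := by gcongr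
      _ = ρ / 2 := by rw [hsdef]; field_simp; norm_num
      _ < ρ := by linarith
  have h3 := (hs i).gauge_add_inner_le (hds i) (x + s • e)
  have h4 := hρb (x + s • e) (by simpa [mem_ball, dist_eq_norm] using hse) x (mem_ball_self hρ)
  rw [add_sub_cancel_left] at h3 h4
  have h5 := (abs_le.1 (h.abs_gauge_sub_gauge_le hs hconv i (x + s • e))).2
  have h6 := (abs_le.1 (h.abs_gauge_sub_gauge_le hs hconv i x)).1
  rw [← hdd] at h5 h6
  have h7 : d * ‖x + s • e‖ + d * ‖x‖ ≤ d * B := by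
    rw [← mul_add]
    refine mul_le_mul_of_nonneg_left ?_ hd0
    linarith [norm_add_le x (s • e)]
  have h8 := (abs_le.1 h4).2
  have h9 : ⟪gaugeGrad (Ωs i) x, s • e⟫ - ⟪gaugeGrad Ω x, s • e⟫ = s * ‖e‖ ^ 2 := by
    rw [← inner_sub_left, ← he, inner_smul_right, real_inner_self_eq_norm_sq]
  rw [norm_smul, Real.norm_of_nonneg hs0.le] at h8
  rw [dist_eq_norm, ← he]
  by_contra hcon
  push Not at hcon
  have h10 : s * ‖e‖ ^ 2 < s * (ε / 2 * ‖e‖ + ε ^ 2 / 2) := by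
    have e1 : s * (ε / 2 * ‖e‖ + ε ^ 2 / 2) = ε / 2 * (s * ‖e‖) + s * (ε ^ 2 / 2) := by ring
    linarith
  have h11 := lt_of_mul_lt_mul_left h10 hs0.le
  nlinarith

lemma tendsto_torsion {u : Euc n → ℝ} {us : ℕ → Euc n → ℝ} (hu : IsLipTorsion L Ω u)
    (hus : ∀ i, IsLipTorsion L (Ωs i) (us i)) (x : Euc n) :
    Tendsto (fun i => us i x) atTop (𝓝 (u x)) := by
  set t : ℕ → ℝ := fun i => 1 + hausdorffDist (closure (Ωs i)) (closure Ω) / r with ht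
  have ht1 : ∀ i, 1 ≤ t i := fun i =>
    le_add_of_nonneg_right (div_nonneg hausdorffDist_nonneg h.pos.le)
  have ht0 : ∀ i, 0 < t i := fun i => one_pos.trans_le (ht1 i)
  have htt : Tendsto t atTop (𝓝 1) := by
    have h1 := (hconv.div_const r).const_add 1
    rwa [zero_div, add_zero] at h1
  have hti : Tendsto (fun i => (t i)⁻¹) atTop (𝓝 1) := by simpa using htt.inv₀ one_ne_zero
  have hup : ∀ i, us i x ≤ t i ^ 2 * u ((t i)⁻¹ • x) := fun i =>
    h.torsion_le_dilate (hs i) hu (hus i) (ht0 i) (fun y => h.gauge_le_mul_gauge (hs i) y) x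
  have hlo : ∀ i, (t i ^ 2)⁻¹ * u x - L * ‖x - (t i)⁻¹ • x‖ ≤ us i x := fun i => by
    have h1 := (hs i).torsion_le_dilate h (hus i) hu (ht0 i) (fun y => by
      have := (hs i).gauge_le_mul_gauge h y
      rwa [hausdorffDist_comm] at this) x
    have h2 := (abs_le.1 ((hus i).lip x ((t i)⁻¹ • x))).1
    have h3 := (inv_mul_le_iff₀ (by have := ht0 i; positivity)).2 h1
    linarith
  have e1 : Tendsto (fun i => t i ^ 2 * u ((t i)⁻¹ • x)) atTop (𝓝 (u x)) := by
    simpa using (htt.pow 2).mul ((hu.continuous.tendsto _).comp (hti.smul_const x))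
  have e2 : Tendsto (fun i => (t i ^ 2)⁻¹ * u x - L * ‖x - (t i)⁻¹ • x‖) atTop (𝓝 (u x)) := by
    have h1 : Tendsto (fun i => (t i ^ 2)⁻¹) atTop (𝓝 1) := by
      simpa using (htt.pow 2).inv₀ (by norm_num)
    have h2 : Tendsto (fun i => ‖x - (t i)⁻¹ • x‖) atTop (𝓝 0) := by
      simpa using ((tendsto_const_nhds (x := x)).sub (hti.smul_const x)).norm
    simpa using (h1.mul_const (u x)).sub (h2.const_mul L)
  exact tendsto_of_tendsto_of_tendsto_of_le_of_le e2 e1 hlo hup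

/-- Dominated convergence over converging convex domains. -/
lemma tendsto_setIntegral {f : Euc n → ℝ} {fs : ℕ → Euc n → ℝ} {B : ℝ}
    (hm : ∀ i, AEStronglyMeasurable (fs i) volume) (hB : ∀ i x, x ∈ Ωs i → |fs i x| ≤ B)
    (hlim : ∀ᵐ x, Tendsto (fun i => fs i x) atTop (𝓝 (f x))) :
    Tendsto (fun i => ∫ x in Ωs i, fs i x) atTop (𝓝 (∫ x in Ω, f x)) := by
  simp only [← integral_indicator h.isOpen.measurableSet,
    fun i => (integral_indicator (μ := volume) (f := fs i) (hs i).isOpen.measurableSet).symm]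
  have hB0 : 0 ≤ B := (abs_nonneg _).trans (hB 0 0 (hs 0).zero_mem)
  refine tendsto_integral_of_dominated_convergence ((closedBall (0 : Euc n) R).indicator
    fun _ => B) (fun i => (hm i).indicator (hs i).isOpen.measurableSet) ?_ ?_ ?_
  · exact (integrable_indicator_iff measurableSet_closedBall).2
      (integrableOn_const measure_closedBall_lt_top.ne)
  · refine fun i => Eventually.of_forall fun x => ?_
    by_cases hx : x ∈ Ωs i
    · rw [indicator_of_mem hx, indicator_of_mem ((hs i).subset_ball hx)]
      exact hB i x hx
    · rw [indicator_of_notMem hx, norm_zero]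
      exact indicator_nonneg (fun _ _ => hB0) x
  · have hfr : ∀ᵐ x : Euc n, x ∉ frontier Ω := by
      rw [ae_iff]
      simpa using h.convex.addHaar_frontier volume
    filter_upwards [hlim, hfr] with x hx hxf
    have hg := h.tendsto_gauge hs hconv x
    rw [h.mem_frontier_iff] at hxf
    rcases lt_or_gt_of_ne hxf with h1 | h1
    · rw [indicator_of_mem ((h.mem_iff x).2 h1)]
      refine hx.congr' ?_
      filter_upwards [hg.eventually_lt_const h1] with i hi
      rw [indicator_of_mem (((hs i).mem_iff x).2 hi)]
    · rw [indicator_of_notMem fun hc => h1.not_gt ((h.mem_iff x).1 hc)]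
      refine tendsto_const_nhds.congr' ?_
      filter_upwards [hg.eventually_const_lt h1] with i hi
      rw [indicator_of_notMem fun hc => hi.not_gt (((hs i).mem_iff x).1 hc)]

end ConvexBetween

namespace ConvexBetween

variable [NeZero n]

section Single

variable {L r R : ℝ} {Ω : Set (Euc n)} (h : ConvexBetween r R Ω) {u F : Euc n → ℝ}
  (hu : IsLipTorsion L Ω u) (hF : MemLp F 2 (coneMeasure Ω))
  (hrep : ∀ φ : Euc n → ℝ, ContDiff ℝ ∞ φ → HasCompactSupport φ →
    bdryFn Ω u φ = ∫ x, φ x * F x ∂coneMeasure Ω)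
include h

lemma ae_norm_gaugeGrad : ∀ᵐ p ∂coneMeasure Ω, 0 < ‖gaugeGrad Ω p‖ ∧ 1 ≤ R * ‖gaugeGrad Ω p‖ := by
  filter_upwards [h.ae_coneMeasure_mem_frontier, h.ae_coneMeasure_differentiableAt] with p hp hd
  have hp0 := h.ne_zero_of_mem_frontier hp
  exact ⟨h.norm_gaugeGrad_pos hd hp0, h.le_norm_gaugeGrad hd hp0⟩

include hF in
lemma memLp_div_pow (k : ℕ) : MemLp (fun p => F p / (n * ‖gaugeGrad Ω p‖ ^ k)) 2
    (coneMeasure Ω) := by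
  have hn : (0 : ℝ) < n := natCast_pos_of_neZero
  have hm := (measurable_gaugeGrad Ω).norm
  refine MemLp.of_le_mul (c := R ^ k / n) hF (hF.aestronglyMeasurable.mul
    ((hm.pow_const k).const_mul (n : ℝ)).inv.aestronglyMeasurable) ?_
  filter_upwards [h.ae_norm_gaugeGrad] with p hp
  have h1 : 1 ≤ (R * ‖gaugeGrad Ω p‖) ^ k := one_le_pow₀ hp.2
  have h2 : 0 < ‖gaugeGrad Ω p‖ ^ k := pow_pos hp.1 k
  generalize ‖gaugeGrad Ω p‖ = b at *
  rw [norm_div, Real.norm_of_nonneg (by positivity : (0 : ℝ) ≤ n * b ^ k), div_mul_eq_mul_div,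
    div_le_div_iff₀ (by positivity) hn]
  rw [mul_pow] at h1
  have h3 := mul_le_mul_of_nonneg_left h1 (mul_nonneg (norm_nonneg (F p)) hn.le)
  linarith

lemma memLp_mul_norm {φ : Euc n → ℝ} (hφ : Continuous φ) :
    MemLp (fun p => φ p * ‖gaugeGrad Ω p‖) 2 (coneMeasure Ω) := by
  have := h.isFiniteMeasure_coneMeasure
  obtain ⟨C, hC⟩ := (isCompact_closedBall (0 : Euc n) R).exists_bound_of_continuousOn
    hφ.continuousOn
  refine MemLp.of_bound (hφ.measurable.mul (measurable_gaugeGrad Ω).norm).aestronglyMeasurable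
    (C * r⁻¹) ?_
  filter_upwards [h.ae_coneMeasure_mem_frontier] with p hp
  have h1 : ‖φ p‖ ≤ C := by
    refine hC p ?_
    rw [← h.radProj_of_mem_frontier hp]
    simpa using h.norm_radProj_le p
  rw [norm_mul, norm_norm]
  exact mul_le_mul h1 (h.norm_gaugeGrad_le p) (norm_nonneg _) ((norm_nonneg _).trans h1)

include hu in
lemma torsion_le (x : Euc n) :
    |u x| ≤ L * R := by
  rw [abs_of_nonneg (hu.nonneg x)]
  by_cases hx : x ∈ Ω
  · simpa using h.abs_le_of_gauge hu hx (gauge_nonneg x)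
  · rw [hu.zero_outside x hx]
    exact mul_nonneg hu.lip_nonneg h.radius_pos.le

include hu hF hrep

lemma integral_sq_div : ∫ p, (F p / (n * ‖gaugeGrad Ω p‖)) ^ 2 ∂coneMeasure Ω
    = 2 * (n + 2) / n * ∫ x in Ω, u x := by
  have hn : (0 : ℝ) < n := natCast_pos_of_neZero
  have h1 := h.integral_sq_bdryDensity hu hF hrep
  have h2 : ∫ p, F p / (n * ‖gaugeGrad Ω p‖ ^ 2) * F p ∂coneMeasure Ω
      = n * ∫ p, (F p / (n * ‖gaugeGrad Ω p‖)) ^ 2 ∂coneMeasure Ω := by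
    rw [← integral_const_mul]
    refine integral_congr_ae ?_
    filter_upwards [h.ae_norm_gaugeGrad] with p hp
    have h0 := hp.1.ne'
    generalize ‖gaugeGrad Ω p‖ = b at *
    field_simp
  rw [h2] at h1
  rw [div_mul_eq_mul_div, eq_div_iff hn.ne']
  linarith

lemma integral_sq_sub {φ : Euc n → ℝ} (hφ : ContDiff ℝ ∞ φ) (hc : HasCompactSupport φ) :
    ∫ p, (φ p * ‖gaugeGrad Ω p‖ - F p / (n * ‖gaugeGrad Ω p‖)) ^ 2 ∂coneMeasure Ω
      = (∫ p, (φ p * ‖gaugeGrad Ω p‖) ^ 2 ∂coneMeasure Ω) - 2 / n * bdryFn Ω u φ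
        + 2 * (n + 2) / n * ∫ x in Ω, u x := by
  have hn : (0 : ℝ) < n := natCast_pos_of_neZero
  have hc1 := h.memLp_div_pow hF 1
  simp only [pow_one] at hc1
  have i1 : Integrable (fun p => (φ p * ‖gaugeGrad Ω p‖) ^ 2) (coneMeasure Ω) :=
    (h.memLp_mul_norm hφ.continuous).integrable_sq
  have i2 : Integrable (fun p => (F p / (n * ‖gaugeGrad Ω p‖)) ^ 2) (coneMeasure Ω) :=
    hc1.integrable_sq
  have i3 : Integrable (fun p => 2 * (φ p * ‖gaugeGrad Ω p‖ * (F p / (n * ‖gaugeGrad Ω p‖))))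
      (coneMeasure Ω) :=
    ((h.memLp_mul_norm hφ.continuous).integrable_mul hc1).const_mul 2
  have i4 : Integrable (fun p => (φ p * ‖gaugeGrad Ω p‖) ^ 2 -
      2 * (φ p * ‖gaugeGrad Ω p‖ * (F p / (n * ‖gaugeGrad Ω p‖)))) (coneMeasure Ω) := i1.sub i3
  rw [← h.integral_sq_div hu hF hrep]
  have e : ∀ s c : ℝ, (s - c) ^ 2 = s ^ 2 - 2 * (s * c) + c ^ 2 := fun s c => by ring
  simp only [e]
  rw [integral_add i4 i2, integral_sub i1 i3, hrep φ hφ hc, ← integral_const_mul]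
  congr 2
  refine integral_congr_ae ?_
  filter_upwards [h.ae_norm_gaugeGrad] with p hp
  have h0 := hp.1.ne'
  generalize ‖gaugeGrad Ω p‖ = b at *
  field_simp

lemma abs_integral_sub_le {φ H : Euc n → ℝ} (hφ : ContDiff ℝ ∞ φ) (hc : HasCompactSupport φ)
    {B η : ℝ} (hη : 0 < η) (hHm : Measurable H) (hH : ∀ p, |H p| ≤ B) :
    |(∫ p, H p * (F p / (n * ‖gaugeGrad Ω p‖)) ^ 2 ∂coneMeasure Ω) -
      ∫ p, H p * (φ p * ‖gaugeGrad Ω p‖) ^ 2 ∂coneMeasure Ω| ≤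
    B * ((1 + η⁻¹) * ((∫ p, (φ p * ‖gaugeGrad Ω p‖) ^ 2 ∂coneMeasure Ω)
        - 2 / n * bdryFn Ω u φ + 2 * (n + 2) / n * ∫ x in Ω, u x)
      + η * (2 * (n + 2) / n * ∫ x in Ω, u x)) := by
  rw [← h.integral_sq_sub hu hF hrep hφ hc, ← h.integral_sq_div hu hF hrep]
  have hc1 := h.memLp_div_pow hF 1
  simp only [pow_one] at hc1
  have hb1 := h.memLp_mul_norm hφ.continuous
  have hbd : ∀ᵐ p ∂coneMeasure Ω, ‖H p‖ ≤ B := Eventually.of_forall hH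
  have i1 : Integrable (fun p => H p * (φ p * ‖gaugeGrad Ω p‖) ^ 2) (coneMeasure Ω) :=
    hb1.integrable_sq.bdd_mul hHm.aestronglyMeasurable hbd
  have i2 : Integrable (fun p => H p * (F p / (n * ‖gaugeGrad Ω p‖)) ^ 2) (coneMeasure Ω) :=
    hc1.integrable_sq.bdd_mul hHm.aestronglyMeasurable hbd
  have i3 : Integrable (fun p => (φ p * ‖gaugeGrad Ω p‖ - F p / (n * ‖gaugeGrad Ω p‖)) ^ 2)
    (coneMeasure Ω) := (hb1.sub hc1).integrable_sq
  have i4 : Integrable (fun p => (F p / (n * ‖gaugeGrad Ω p‖)) ^ 2) (coneMeasure Ω) :=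
    hc1.integrable_sq
  have i5 := i3.const_mul (1 + η⁻¹)
  have i6 := i4.const_mul η
  rw [← integral_sub i2 i1, ← integral_const_mul, ← integral_const_mul, ← integral_add i5 i6,
    ← integral_const_mul, ← Real.norm_eq_abs]
  refine norm_integral_le_of_norm_le ((i5.add i6).const_mul B) (Eventually.of_forall fun p => ?_)
  have hB := hH p
  generalize φ p * ‖gaugeGrad Ω p‖ = s
  generalize F p / (n * ‖gaugeGrad Ω p‖) = c
  rw [← mul_sub, norm_mul]
  refine mul_le_mul hB ?_ (norm_nonneg _) ((abs_nonneg _).trans hB)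
  have k1 : 0 ≤ η⁻¹ * ((s - c) - η * c) ^ 2 := by positivity
  have k2 : 0 ≤ η⁻¹ * ((s - c) + η * c) ^ 2 := by positivity
  have e1 : η⁻¹ * ((s - c) - η * c) ^ 2 = η⁻¹ * (s - c) ^ 2 - 2 * (s - c) * c + η * c ^ 2 := by
    field_simp
    ring
  have e2 : η⁻¹ * ((s - c) + η * c) ^ 2 = η⁻¹ * (s - c) ^ 2 + 2 * (s - c) * c + η * c ^ 2 := by
    field_simp
    ring
  rw [Real.norm_eq_abs, abs_le]
  constructor <;> nlinarith [sq_nonneg (s - c)]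

/-- Smooth functions approximate the boundary gradient in `L²`. -/
lemma exists_approx {δ : ℝ} (hδ : 0 < δ) : ∃ φ : Euc n → ℝ, ContDiff ℝ ∞ φ ∧
    HasCompactSupport φ ∧ (∫ p, (φ p * ‖gaugeGrad Ω p‖) ^ 2 ∂coneMeasure Ω)
      - 2 / n * bdryFn Ω u φ + 2 * (n + 2) / n * (∫ x in Ω, u x) ≤ δ := by
  have := h.isFiniteMeasure_coneMeasure
  have hr := h.pos
  have hm := h.memLp_div_pow hF 2
  obtain ⟨φ, hc, hφ, hle⟩ := hm.exist_eLpNorm_sub_le (p := 2) (by norm_num) one_le_two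
    (ε := r * √δ) (by positivity)
  refine ⟨φ, hφ, hc, ?_⟩
  rw [← h.integral_sq_sub hu hF hrep hφ hc]
  have hmem : MemLp (fun p => F p / (n * ‖gaugeGrad Ω p‖ ^ 2) - φ p) 2 (coneMeasure Ω) :=
    hm.sub (hφ.continuous.memLp_of_hasCompactSupport hc)
  have h1 : ∫ p, (F p / (n * ‖gaugeGrad Ω p‖ ^ 2) - φ p) ^ 2 ∂coneMeasure Ω ≤ (r * √δ) ^ 2 := by
    replace hle : eLpNorm (fun p => F p / (n * ‖gaugeGrad Ω p‖ ^ 2) - φ p) 2 (coneMeasure Ω)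
        ≤ ENNReal.ofReal (r * √δ) := hle
    rw [hmem.eLpNorm_eq_integral_rpow_norm two_ne_zero ENNReal.ofNat_ne_top,
      ENNReal.ofReal_le_ofReal_iff (by positivity)] at hle
    simp only [ENNReal.toReal_ofNat, Real.rpow_ofNat, Real.norm_eq_abs, sq_abs] at hle
    rw [← one_div, ← Real.sqrt_eq_rpow] at hle
    exact (Real.sqrt_le_left (by positivity)).1 hle
  have h2 : ∫ p, (φ p * ‖gaugeGrad Ω p‖ - F p / (n * ‖gaugeGrad Ω p‖)) ^ 2 ∂coneMeasure Ω
      ≤ ∫ p, (r⁻¹) ^ 2 * (F p / (n * ‖gaugeGrad Ω p‖ ^ 2) - φ p) ^ 2 ∂coneMeasure Ω := by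
    refine integral_mono_of_nonneg (Eventually.of_forall fun p => sq_nonneg _)
      (hmem.integrable_sq.const_mul _) ?_
    filter_upwards [h.ae_norm_gaugeGrad] with p hp
    have h3 := h.norm_gaugeGrad_le p
    have h0 := hp.1
    generalize ‖gaugeGrad Ω p‖ = b at *
    have e : φ p * b - F p / (n * b) = -(b * (F p / (n * b ^ 2) - φ p)) := by
      field_simp
      ring
    rw [e, neg_sq, mul_pow]
    gcongr
  rw [integral_const_mul] at h2
  refine h2.trans ?_
  calc r⁻¹ ^ 2 * _ ≤ r⁻¹ ^ 2 * (r * √δ) ^ 2 := by gcongr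
    _ = δ := by
      rw [← mul_pow, inv_mul_cancel_left₀ hr.ne', Real.sq_sqrt hδ.le]

end Single

section Limit

variable {r R : ℝ} {Ω : Set (Euc n)} {Ωs : ℕ → Set (Euc n)}
  (h : ConvexBetween r R Ω) (hs : ∀ i, ConvexBetween r R (Ωs i))
  (hconv : Tendsto (fun i => hausdorffDist (closure (Ωs i)) (closure Ω)) atTop (𝓝 0))
include h hs hconv

lemma tendsto_integral_weight {H : Euc n → ℝ} {Hs : ℕ → Euc n → ℝ} {B : ℝ}
    (hm : Measurable H) (hms : ∀ i, Measurable (Hs i))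
    (hB : ∀ i X, ‖X‖ ≤ r⁻¹ → |Hs i X| ≤ B)
    (hlim : ∀ (Xs : ℕ → Euc n) X, Tendsto Xs atTop (𝓝 X) →
      Tendsto (fun i => Hs i (Xs i)) atTop (𝓝 (H X)))
    {φ : Euc n → ℝ} (hφ : Continuous φ) :
    Tendsto (fun i => ∫ p, Hs i (gaugeGrad (Ωs i) p) * (φ p * ‖gaugeGrad (Ωs i) p‖) ^ 2
        ∂coneMeasure (Ωs i)) atTop
      (𝓝 (∫ p, H (gaugeGrad Ω p) * (φ p * ‖gaugeGrad Ω p‖) ^ 2 ∂coneMeasure Ω)) := by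
  obtain ⟨C, hC⟩ := (isCompact_closedBall (0 : Euc n) R).exists_bound_of_continuousOn
    hφ.continuousOn
  have key : ∀ {D : Set (Euc n)} {W : Euc n → ℝ}, ConvexBetween r R D → Measurable W →
      Measurable (fun p => W (gaugeGrad D p) * (φ p * ‖gaugeGrad D p‖) ^ 2) := fun hD hW =>
    (hW.comp (measurable_gaugeGrad _)).mul
      ((hφ.measurable.mul (measurable_gaugeGrad _).norm).pow_const 2)
  rw [h.integral_coneMeasure (key h hm).aestronglyMeasurable]
  simp only [fun i => (hs i).integral_coneMeasure (key (hs i) (hms i)).aestronglyMeasurable]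
  refine h.tendsto_setIntegral hs hconv (B := B * (C * r⁻¹) ^ 2)
    (fun i => ((key (hs i) (hms i)).comp (hs i).measurable_radProj).aestronglyMeasurable) ?_ ?_
  · intro i x _
    have h1 := (hs i).norm_gaugeGrad_le (radProj (Ωs i) x)
    have h2 := hB i _ h1
    have h3 : ‖φ (radProj (Ωs i) x)‖ ≤ C := hC _ (by simpa using (hs i).norm_radProj_le x)
    rw [abs_mul, abs_pow, abs_mul, abs_norm]
    have hC0 : 0 ≤ C := (norm_nonneg _).trans h3
    have hB0 : 0 ≤ B := (abs_nonneg _).trans h2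
    rw [Real.norm_eq_abs] at h3
    gcongr
  · have hd : ∀ᵐ x : Euc n, ∀ i, DifferentiableAt ℝ (gauge (Ωs i)) x :=
      ae_all_iff.2 fun i => (hs i).ae_differentiableAt_gauge
    have h0 : ∀ᵐ x : Euc n, x ≠ 0 := by simpa using ae_ne_zero (univ : Set (Euc n))
    filter_upwards [h.ae_differentiableAt_gauge, hd, h0] with x hx hxs hx0
    have hG := h.tendsto_gaugeGrad hs hconv hx hxs
    simp only [h.gaugeGrad_radProj hx0, fun i => (hs i).gaugeGrad_radProj hx0]
    exact (hlim _ _ hG).mul ((((hφ.tendsto _).comp (h.tendsto_radProj hs hconv hx0)).mul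
      hG.norm).pow 2)

variable {L : ℝ} {u : Euc n → ℝ} {us : ℕ → Euc n → ℝ} (hu : IsLipTorsion L Ω u)
  (hus : ∀ i, IsLipTorsion L (Ωs i) (us i))
include hu hus

lemma tendsto_integral_torsion : Tendsto (fun i => ∫ x in Ωs i, us i x) atTop
    (𝓝 (∫ x in Ω, u x)) :=
  h.tendsto_setIntegral hs hconv (fun i => (hus i).continuous.aestronglyMeasurable)
    (fun i x _ => (hs i).torsion_le (hus i) x)
    (Eventually.of_forall fun x => h.tendsto_torsion hs hconv hu hus x)

lemma tendsto_bdryFn {φ : Euc n → ℝ} (hφ : ContDiff ℝ ∞ φ) (hc : HasCompactSupport φ) :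
    Tendsto (fun i => bdryFn (Ωs i) (us i) φ) atTop (𝓝 (bdryFn Ω u φ)) := by
  have hlc := (lapl_contDiff hφ).continuous
  obtain ⟨C, -, hC⟩ := exists_abs_le_of_hasCompactSupport hφ.continuous hc
  refine Tendsto.add ?_ (Tendsto.const_mul 2 ?_)
  · refine tendsto_integral_of_dominated_convergence (fun x => L * R * |lapl φ x|)
      (fun i => ((hus i).continuous.mul hlc).aestronglyMeasurable)
      ((hlc.abs.integrable_of_hasCompactSupport hc.lapl.abs).const_mul _)
      (fun i => Eventually.of_forall fun x => ?_) (Eventually.of_forall fun x =>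
        (h.tendsto_torsion hs hconv hu hus x).mul_const _)
    rw [norm_mul]
    exact mul_le_mul_of_nonneg_right ((hs i).torsion_le (hus i) x) (norm_nonneg _)
  · exact h.tendsto_setIntegral hs hconv (fun _ => hφ.continuous.aestronglyMeasurable)
      (fun i x _ => hC x) (Eventually.of_forall fun x => tendsto_const_nhds)

/-- Continuity of the mixed torsional rigidity for domains between two fixed balls. -/
lemma tendsto_mixedTorsion {Ω' : Set (Euc n)} {Ω's : ℕ → Set (Euc n)} {M : ℝ}
    (hne : Ω'.Nonempty) (hnes : ∀ i, (Ω's i).Nonempty) (hM : closure Ω' ⊆ closedBall 0 M)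
    (hMs : ∀ i, closure (Ω's i) ⊆ closedBall 0 M)
    (hconv' : Tendsto (fun i => hausdorffDist (closure (Ω's i)) (closure Ω')) atTop (𝓝 0)) :
    Tendsto (fun i => mixedTorsion (Ωs i) (Ω's i)) atTop (𝓝 (mixedTorsion Ω Ω')) := by
  obtain ⟨c, hc0, hc⟩ := exists_volume_coneSet_eq (n := n)
  obtain ⟨F, -, hF, hrep⟩ := h.exists_bdryDensity hu
  choose Fs _ hFs hreps using fun i => (hs i).exists_bdryDensity (hus i)
  have hr := h.pos
  have hM0 : 0 ≤ M := by
    obtain ⟨y, hy⟩ := hne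
    exact (norm_nonneg y).trans (by simpa using hM (subset_closure hy))
  rw [h.mixedTorsion_eq hu hF hrep hc0 hc]
  simp only [fun i => (hs i).mixedTorsion_eq (hus i) (hFs i) (hreps i) hc0 hc]
  refine Tendsto.const_mul _ ?_
  have hsc := continuous_suppFn hne.closure hM
  have hscs := fun i => continuous_suppFn (hnes i).closure (hMs i)
  have hbd : ∀ X : Euc n, ‖X‖ ≤ r⁻¹ → |suppFn (closure Ω') X| ≤ M * r⁻¹ := fun X hX =>
    (abs_suppFn_le hne.closure hM X).trans (mul_le_mul_of_nonneg_left hX hM0)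
  have hbds : ∀ i, ∀ X : Euc n, ‖X‖ ≤ r⁻¹ → |suppFn (closure (Ω's i)) X| ≤ M * r⁻¹ :=
    fun i X hX => (abs_suppFn_le (hnes i).closure (hMs i) X).trans
      (mul_le_mul_of_nonneg_left hX hM0)
  have hlim : ∀ (Xs : ℕ → Euc n) X, Tendsto Xs atTop (𝓝 X) →
      Tendsto (fun i => suppFn (closure (Ω's i)) (Xs i)) atTop (𝓝 (suppFn (closure Ω') X)) := by
    intro Xs X hX
    have h1 : Tendsto (fun i => suppFn (closure (Ω's i)) (Xs i) - suppFn (closure Ω') (Xs i))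
        atTop (𝓝 0) := by
      refine squeeze_zero_norm (fun i => abs_suppFn_sub_suppFn_le (hnes i).closure hne.closure
        (hMs i) hM (Xs i)) ?_
      simpa only [zero_mul] using hconv'.mul hX.norm
    simpa using h1.add ((hsc.tendsto X).comp hX)
  set Q : ℝ := 2 * (n + 2) / n * ∫ x in Ω, u x with hQ
  set Qs : ℕ → ℝ := fun i => 2 * (n + 2) / n * ∫ x in Ωs i, us i x with hQs
  have hQt : Tendsto Qs atTop (𝓝 Q) :=
    (h.tendsto_integral_torsion hs hconv hu hus).const_mul _
  have hQ0 : 0 ≤ Q := by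
    have := integral_nonneg (μ := volume.restrict Ω) (f := u) hu.nonneg
    positivity
  rw [Metric.tendsto_atTop']
  intro ε hε
  set B : ℝ := M * r⁻¹ with hBdef
  have hB0 : 0 ≤ B := mul_nonneg hM0 (inv_pos.2 hr).le
  set η : ℝ := ε / (8 * (B * Q + 1)) with hηdef
  have hη : 0 < η := by positivity
  obtain ⟨φ, hφ, hφc, hφle⟩ := h.exists_approx hu hF hrep
    (show 0 < ε / (8 * (B + 1) * (1 + η⁻¹)) by positivity)
  set A : ℝ := ∫ p, (φ p * ‖gaugeGrad Ω p‖) ^ 2 ∂coneMeasure Ω with hA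
  set As : ℕ → ℝ := fun i => ∫ p, (φ p * ‖gaugeGrad (Ωs i) p‖) ^ 2 ∂coneMeasure (Ωs i) with hAs
  have hAt : Tendsto As atTop (𝓝 A) := by
    have h1 := h.tendsto_integral_weight hs hconv (H := fun _ => 1) (Hs := fun _ _ => 1) (B := 1)
      measurable_const (fun _ => measurable_const) (by simp) (fun _ _ _ => tendsto_const_nhds)
      hφ.continuous
    simpa only [one_mul] using h1
  have hEt : Tendsto (fun i => B * ((1 + η⁻¹) * (As i - 2 / n * bdryFn (Ωs i) (us i) φ + Qs i)
      + η * Qs i)) atTop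
      (𝓝 (B * ((1 + η⁻¹) * (A - 2 / n * bdryFn Ω u φ + Q) + η * Q))) :=
    ((((hAt.sub ((h.tendsto_bdryFn hs hconv hu hus hφ hφc).const_mul _)).add hQt).const_mul
      _).add (hQt.const_mul _)).const_mul _
  have hSt := h.tendsto_integral_weight hs hconv hsc.measurable (fun i => (hscs i).measurable)
    hbds hlim hφ.continuous
  have hsmall : B * ((1 + η⁻¹) * (A - 2 / n * bdryFn Ω u φ + Q) + η * Q) < ε / 3 := by
    have k1 : B * (η * Q) ≤ ε / 8 := by
      have : B * (η * Q) = ε / 8 * (B * Q / (B * Q + 1)) := by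
        rw [hηdef]
        have : B * Q + 1 ≠ 0 := by positivity
        field_simp
      rw [this]
      refine mul_le_of_le_one_right (by positivity) ((div_le_one (by positivity)).2 (by linarith))
    have k2 : B * ((1 + η⁻¹) * (A - 2 / n * bdryFn Ω u φ + Q)) ≤ ε / 8 := by
      calc B * ((1 + η⁻¹) * (A - 2 / n * bdryFn Ω u φ + Q))
          ≤ B * ((1 + η⁻¹) * (ε / (8 * (B + 1) * (1 + η⁻¹)))) := by gcongr
        _ = ε / 8 * (B / (B + 1)) := by
          have : 1 + η⁻¹ ≠ 0 := by positivity
          have : B + 1 ≠ 0 := by positivity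
          generalize η⁻¹ = ζ at *
          field_simp
        _ ≤ ε / 8 := mul_le_of_le_one_right (by positivity)
          ((div_le_one (by positivity)).2 (by linarith))
    rw [mul_add]
    linarith
  have hT := h.abs_integral_sub_le hu hF hrep hφ hφc hη
    (hsc.measurable.comp (measurable_gaugeGrad Ω)) fun p => hbd _ (h.norm_gaugeGrad_le p)
  have hTs := fun i => (hs i).abs_integral_sub_le (hus i) (hFs i) (hreps i) hφ hφc hη
    ((hscs i).measurable.comp (measurable_gaugeGrad (Ωs i)))
    fun p => hbds i _ ((hs i).norm_gaugeGrad_le p)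
  have hSe := (Metric.tendsto_nhds.1 hSt) (ε / 3) (by positivity)
  obtain ⟨N, hN⟩ := eventually_atTop.1 ((hEt.eventually_lt_const hsmall).and hSe)
  refine ⟨N, fun i hi => ?_⟩
  obtain ⟨a1, a2⟩ := hN i hi.le
  have a3 := hTs i
  simp only [Function.comp_apply] at hT a3
  rw [Real.dist_eq] at a2 ⊢
  rw [abs_sub_lt_iff] at a2 ⊢
  have a4 := hT.trans_lt hsmall
  have a5 := a3.trans_lt a1
  rw [abs_sub_lt_iff] at a4 a5
  constructor <;> linarith [a2.1, a2.2, a4.1, a4.2, a5.1, a5.2]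

end Limit

end ConvexBetween

lemma subset_closedBall_of_hausdorffDist_lt {K K' : Set (Euc n)} {R : ℝ} (hK : K ⊆ closedBall 0 R)
    (hne : K.Nonempty) (hne' : K'.Nonempty) (hb' : IsBounded K')
    (hd : hausdorffDist K' K < 1) : K' ⊆ closedBall 0 (R + 1) := by
  intro x hx
  obtain ⟨y, hy, hxy⟩ := exists_dist_lt_of_hausdorffDist_lt hx hd
    (hausdorffEDist_ne_top_of_nonempty_of_bounded hne' hne hb' (isBounded_closedBall.subset hK))
  have h1 := hK hy
  rw [mem_closedBall] at h1 ⊢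
  linarith [dist_triangle x y 0]

lemma closedBall_subset_of_hausdorffDist_lt {D D' : Set (Euc n)} {r : ℝ} (hr : 0 < r)
    (hD : closedBall 0 (2 * r) ⊆ D) (hb : IsBounded D) (ho : IsOpen D') (hc : Convex ℝ D')
    (hne : D'.Nonempty) (hb' : IsBounded D')
    (hd : hausdorffDist (closure D') (closure D) < r) : closedBall 0 r ⊆ D' := by
  intro x hx
  by_contra hxD
  obtain ⟨ν, hν, hsep⟩ := exists_unit_normal ho hc hne hxD
  have hz : (2 * r) • ν ∈ closure D := subset_closure (hD (by
    rw [mem_closedBall_zero_iff, norm_smul, hν, Real.norm_of_nonneg (by positivity), mul_one]))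
  obtain ⟨y, hy, hyz⟩ := exists_dist_lt_of_hausdorffDist_lt' hz hd
    (hausdorffEDist_ne_top_of_nonempty_of_bounded hne.closure ⟨_, hz⟩ hb'.closure hb.closure)
  have h1 : ⟪y, ν⟫ ≤ ⟪x, ν⟫ := closure_minimal (t := {y : Euc n | ⟪y, ν⟫ ≤ ⟪x, ν⟫})
    (fun w hw => (hsep w hw).le) (isClosed_le (by fun_prop) continuous_const) hy
  have h2 : ⟪x, ν⟫ ≤ r := (real_inner_le_norm x ν).trans (by
    rw [hν, mul_one]; exact mem_closedBall_zero_iff.1 hx)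
  have h3 := real_inner_le_norm ((2 * r) • ν - y) ν
  rw [inner_sub_left, real_inner_smul_left, real_inner_self_eq_norm_sq, hν, mul_one,
    ← dist_eq_norm, dist_comm] at h3
  linarith

lemma hausdorffDist_preimage_add (a : Euc n) (s t : Set (Euc n)) :
    hausdorffDist ((fun y => a + y) ⁻¹' s) ((fun y => a + y) ⁻¹' t) = hausdorffDist s t := by
  rw [← hausdorffDist_image (IsometryEquiv.addLeft a).isometry]
  congr 1 <;> exact image_preimage_eq _ (IsometryEquiv.addLeft a).surjective

lemma mixedTorsion_eq_zero (Ω K : Set (Euc 0)) : mixedTorsion Ω K = 0 := by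
  have h : frontier Ω = ∅ := by
    rcases Subsingleton.eq_empty_or_singleton (subsingleton_of_subsingleton (s := Ω)) with h | ⟨x, h⟩
    · rw [h, frontier_empty]
    · rw [h, eq_univ_of_forall (s := {x}) fun y => Subsingleton.elim y x, frontier_univ]
  rw [mixedTorsion]
  split_ifs
  · rw [h, setIntegral_empty]
  · rfl

/-- The mixed torsional rigidity `τ₁` is continuous in both arguments with respect to
the Hausdorff metric. -/
theorem mixedTorsion_continuous (Ω Ω' : Set (Euc n)) (Ωs Ω's : ℕ → Set (Euc n))
    (hΩo : IsOpen Ω) (hΩb : IsBounded Ω) (hΩc : Convex ℝ Ω) (hΩne : Ω.Nonempty)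
    (hΩ'o : IsOpen Ω') (hΩ'b : IsBounded Ω') (hΩ'c : Convex ℝ Ω') (hΩ'ne : Ω'.Nonempty)
    (hΩs : ∀ i, IsOpen (Ωs i) ∧ IsBounded (Ωs i) ∧ Convex ℝ (Ωs i) ∧ (Ωs i).Nonempty)
    (hΩ's : ∀ i, IsOpen (Ω's i) ∧ IsBounded (Ω's i) ∧ Convex ℝ (Ω's i) ∧ (Ω's i).Nonempty)
    (hconv : Tendsto (fun i => hausdorffDist (closure (Ωs i)) (closure Ω)) atTop (𝓝 0))
    (hconv' : Tendsto (fun i => hausdorffDist (closure (Ω's i)) (closure Ω')) atTop (𝓝 0)) :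
    Tendsto (fun i => mixedTorsion (Ωs i) (Ω's i)) atTop (𝓝 (mixedTorsion Ω Ω')) := by
  rcases Nat.eq_zero_or_pos n with rfl | hn
  · simp only [mixedTorsion_eq_zero]
    exact tendsto_const_nhds
  have : NeZero n := ⟨hn.ne'⟩
  obtain ⟨a, ha⟩ := hΩne
  set T : Set (Euc n) → Set (Euc n) := fun s => (fun y => a + y) ⁻¹' s with hT
  have hTo : ∀ {s}, IsOpen s → IsOpen (T s) := fun hs => hs.preimage (by fun_prop)
  have hTc : ∀ {s}, Convex ℝ s → Convex ℝ (T s) := fun hs => hs.translate_preimage_right a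
  have hTb : ∀ {s}, IsBounded s → IsBounded (T s) := fun hs =>
    (IsometryEquiv.addLeft a).isometry.antilipschitz.isBounded_preimage hs
  have hTne : ∀ {s}, s.Nonempty → (T s).Nonempty := fun hs =>
    hs.preimage (IsometryEquiv.addLeft a).surjective
  have hTd : Tendsto (fun i => hausdorffDist (closure (T (Ωs i))) (closure (T Ω))) atTop
      (𝓝 0) := by
    simpa only [hT, closure_preimage_add, hausdorffDist_preimage_add] using hconv
  have h0 : (0 : Euc n) ∈ T Ω := by simpa [hT] using ha
  obtain ⟨ρ, hρ, hρs⟩ := Metric.nhds_basis_closedBall.mem_iff.1 ((hTo hΩo).mem_nhds h0)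
  have hr : 0 < ρ / 2 := half_pos hρ
  obtain ⟨R, hR⟩ := (hTb hΩb).closure.subset_closedBall (0 : Euc n)
  obtain ⟨M, hM⟩ := hΩ'b.closure.subset_closedBall (0 : Euc n)
  obtain ⟨N, hN⟩ := eventually_atTop.1 (((hTd.eventually_lt_const hr).and
    (hTd.eventually_lt_const one_pos)).and (hconv'.eventually_lt_const one_pos))
  have h : ConvexBetween (ρ / 2) (R + 1) (T Ω) :=
    ⟨hTo hΩo, hTc hΩc, hr, (closedBall_subset_closedBall (by linarith)).trans hρs,
      subset_closure.trans (hR.trans (closedBall_subset_closedBall (by linarith)))⟩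
  have hs : ∀ i, ConvexBetween (ρ / 2) (R + 1) (T (Ωs (i + N))) := fun i => by
    obtain ⟨ho, hb, hc, hne⟩ := hΩs (i + N)
    obtain ⟨⟨h1, h2⟩, -⟩ := hN (i + N) (Nat.le_add_left N i)
    exact ⟨hTo ho, hTc hc, hr, closedBall_subset_of_hausdorffDist_lt hr
        (by rwa [mul_div_cancel₀ ρ two_ne_zero]) (hTb hΩb) (hTo ho) (hTc hc) (hTne hne) (hTb hb) h1,
      subset_closure.trans (subset_closedBall_of_hausdorffDist_lt hR ⟨0, subset_closure h0⟩
        (hTne hne).closure (hTb hb).closure h2)⟩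
  obtain ⟨u, hu⟩ := h.exists_isLipTorsion
  choose us hus using fun i => (hs i).exists_isLipTorsion
  have key := h.tendsto_mixedTorsion hs ((tendsto_add_atTop_iff_nat N).2 hTd) hu hus
    (Ω' := Ω') (Ω's := fun i => Ω's (i + N)) (M := M + 1) hΩ'ne (fun i => (hΩ's _).2.2.2)
    (hM.trans (closedBall_subset_closedBall (by linarith)))
    (fun i => subset_closedBall_of_hausdorffDist_lt hM hΩ'ne.closure (hΩ's _).2.2.2.closure
      (hΩ's _).2.1.closure (hN _ (Nat.le_add_left N i)).2)
    ((tendsto_add_atTop_iff_nat N).2 hconv')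
  simp only [hT, mixedTorsion_preimage_add a hΩo hΩb,
    fun i => mixedTorsion_preimage_add a (hΩs i).1 (hΩs i).2.1] at key
  exact (tendsto_add_atTop_iff_nat N (f := fun i => mixedTorsion (Ωs i) (Ω's i))).1 key

end
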